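/- Let 2 ≤ m < n be integers with α = log m / log n irrational. Let Y ⊆ (Λ×Λ')^ℕ be a topologically transitive subshift of finite type, μ a shift-invariant probability measure on Y with the Gibbs property for some Hölder potential, and μ̂ its natural extension, i.e. the unique shift-invariant probability measure on (Λ×Λ')^ℤ whose pushforward under the restriction map ω ↦ (ω_k)_{k≥1} equals μ. Fix t ∈ [0,1), a finite union of intervals I ⊆ [0,1), words c over Λ, d over Λ', and words a_1,…,a_r over Λ and b_1,…,b_r over Λ'. For k ≥ 1 set U_{i,k} = {ω ∈ (Λ×Λ')^ℕ : ω¹_{k+1}…ω¹_{k+|a_i|} = a_i and ω²_{l_k(t)+1}…ω²_{l_k(t)+|b_i|} = b_i}. Then for μ-almost every ω the averages (1/N) ∑_{k=1}^N 𝟙_I({t+kα}) · 𝟙[ω¹_{k+1}…ω¹_{k+|c|} = c] · 𝟙[ω²_{l_k(t)+1}…ω²_{l_k(t)+|d|} = d] · ∏_{i=1}^r E_μ[𝟙_{U_{i,k}} | 𝓕_1^k ∨ 𝓖_1^{l_k(t)}](ω) converge as N → ∞ to λ(I) · E_{μ̂}[f̃] · E_{μ̂}[g̃], where g̃ = 𝟙_{C̄}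 · ∏_{i=1}^r E_{μ̂}[𝟙_{Ā_i} | ⋂_{k≥1}(𝓕_{−∞}^0 ∨ 𝓖_{−∞}^{−k})] and f̃ = 𝟙_{D̄} · ∏_{i=1}^r E_{μ̂}[𝟙_{B̄_i} | 𝓕_{−∞}^∞ ∨ 𝓖_{−∞}^0], with C̄, Ā_i the cylinder sets in (Λ×Λ')^ℤ where the first coordinate reads c (resp. a_i) in positions 1,…,|c| (resp. 1,…,|a_i|), and D̄, B̄_i those where the second coordinate reads d (resp. b_i) in positions 1,…,|d| (resp. 1,…,|b_i|). -/

import Mathlib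

open MeasureTheory Filter Topology

/-- The one-sided shift on sequences. -/
def shiftN {A : Type*} (ω : ℕ → A) : ℕ → A := fun k => ω (k + 1)

/-- The concatenation `aω` of a finite word `a` with an infinite sequence `ω`. -/
def prepend {A : Type*} (a : List A) (ω : ℕ → A) : ℕ → A :=
  fun i => if h : i < a.length then a.get ⟨i, h⟩ else ω (i - a.length)

/-- The cylinder set `[a]` of sequences having the word `a` as a prefix. -/
def cylinder {A : Type*} (a : List A) : Set (ℕ → A) :=
  {ω | ∀ i : Fin a.length, ω i = a.get i}

/-- The Birkhoff sum `S_j^φ(ω) = ∑_{i=0}^{j-1} φ(T^i ω)`. -/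
def birkhoff {A : Type*} (φ : (ℕ → A) → ℝ) (j : ℕ) (ω : ℕ → A) : ℝ :=
  ∑ i ∈ Finset.range j, φ (shiftN^[i] ω)

/-- The subshift of finite type determined by a transition relation `M`. -/
def SFT {A : Type*} (M : A → A → Prop) : Set (ℕ → A) :=
  {ω | ∀ k : ℕ, M (ω k) (ω (k + 1))}

/-- Irreducibility of the transition relation `M` (equivalently, topological
transitivity of the subshift of finite type): any symbol can be joined to any
other by an admissible path of length `k ≥ 1`. -/
def IrreducibleTransition {A : Type*} (M : A → A → Prop) : Prop :=
  ∀ a b : A, ∃ k ≥ 1, ∃ p : ℕ → A, p 0 = a ∧ p k = b ∧ ∀ i < k, M (p i) (p (i + 1))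

/-- `φ` is Hölder on `Y` for the metric `d(ω,ω̃) = ρ^(min{k : ω_k ≠ ω̃_k})`:
if `ω, ω̃ ∈ Y` agree in their first `N` coordinates then `|φ ω - φ ω̃| ≤ K ρ^N`. -/
def IsHolder {A : Type*} (Y : Set (ℕ → A)) (φ : (ℕ → A) → ℝ) (ρ : ℝ) : Prop :=
  ∃ K > 0, ∀ ω ∈ Y, ∀ ω' ∈ Y, ∀ N : ℕ,
    (∀ i < N, ω i = ω' i) → |φ ω - φ ω'| ≤ K * ρ ^ N

/-- `μ` has the Gibbs property on `Y` for the potential `φ` and pressure `P`: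
`K⁻¹ ≤ μ([a]) / exp(-|a| P + S_{|a|}^φ(aω)) ≤ K` for every word `a` and
every `ω` with `aω ∈ Y`. -/
def HasGibbsProperty {A : Type*} [MeasurableSpace A]
    (Y : Set (ℕ → A)) (μ : MeasureTheory.Measure (ℕ → A)) (φ : (ℕ → A) → ℝ) (P : ℝ) : Prop :=
  ∃ K > 0, ∀ (a : List A) (ω : ℕ → A), prepend a ω ∈ Y →
    K⁻¹ * Real.exp (-(a.length : ℝ) * P + birkhoff φ a.length (prepend a ω)) ≤
        (μ (cylinder a)).toReal ∧
      (μ (cylinder a)).toReal ≤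
        K * Real.exp (-(a.length : ℝ) * P + birkhoff φ a.length (prepend a ω))

/-- The two-sided shift on sequences. -/
def shiftZ {A : Type*} (ω : ℤ → A) : ℤ → A := fun k => ω (k + 1)

/-- `l_k(t) = ⌊t + α k⌋` (as a natural number). -/
noncomputable def lk (α t : ℝ) (k : ℕ) : ℕ := (⌊t + α * k⌋).toNat

/-- A finite union of (half-open) intervals in `ℝ`. -/
def IsFinUnionIntervals (I : Set ℝ) : Prop :=
  ∃ s : Finset (ℝ × ℝ), I = ⋃ p ∈ s, Set.Ico p.1 p.2

/-- The σ-algebra on `(Λ × Λ')^ℕ` generated by the first coordinates `ω¹_r`, `r ∈ S`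
(here sequences are indexed from `0`, so the paper's coordinate `ω_k`, `k ≥ 1`,
is `ω (k-1)`). -/
def FalgN {Λ Λ' : Type*} [MeasurableSpace Λ] (S : Set ℕ) :
    MeasurableSpace (ℕ → Λ × Λ') :=
  ⨆ r ∈ S, MeasurableSpace.comap (fun ω : ℕ → Λ × Λ' => (ω r).1) inferInstance

/-- The σ-algebra on `(Λ × Λ')^ℕ` generated by the second coordinates `ω²_r`, `r ∈ S`. -/
def GalgN {Λ Λ' : Type*} [MeasurableSpace Λ'] (S : Set ℕ) :
    MeasurableSpace (ℕ → Λ × Λ') :=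
  ⨆ r ∈ S, MeasurableSpace.comap (fun ω : ℕ → Λ × Λ' => (ω r).2) inferInstance

/-- The set of `ω` whose first coordinate reads the word `c` in positions
`start, …, start + |c| - 1` (0-indexed; this is the paper's
`ω¹_{start+1} … ω¹_{start+|c|} = c`). -/
def cylF {Λ Λ' : Type*} (c : List Λ) (start : ℕ) : Set (ℕ → Λ × Λ') :=
  {ω | ∀ j : Fin c.length, (ω (start + j)).1 = c.get j}

/-- The set of `ω` whose second coordinate reads the word `d` in positions
`start, …, start + |d| - 1` (0-indexed). -/
def cylG {Λ Λ' : Type*} (d : List Λ') (start : ℕ) : Set (ℕ → Λ × Λ') :=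
  {ω | ∀ j : Fin d.length, (ω (start + j)).2 = d.get j}

/-- The σ-algebra `𝓕_S` on `(Λ × Λ')^ℤ` generated by the first coordinates `ω¹_r`, `r ∈ S`. -/
def FalgZ {Λ Λ' : Type*} [MeasurableSpace Λ] (S : Set ℤ) :
    MeasurableSpace (ℤ → Λ × Λ') :=
  ⨆ r ∈ S, MeasurableSpace.comap (fun ω : ℤ → Λ × Λ' => (ω r).1) inferInstance

/-- The σ-algebra `𝓖_S` on `(Λ × Λ')^ℤ` generated by the second coordinates `ω²_r`, `r ∈ S`. -/
def GalgZ {Λ Λ' : Type*} [MeasurableSpace Λ'] (S : Set ℤ) :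
    MeasurableSpace (ℤ → Λ × Λ') :=
  ⨆ r ∈ S, MeasurableSpace.comap (fun ω : ℤ → Λ × Λ' => (ω r).2) inferInstance

/-- `C̄ = {ω ∈ (Λ × Λ')^ℤ : ω¹_1 … ω¹_{|c|} = c}`. -/
def AbarZ {Λ Λ' : Type*} (c : List Λ) : Set (ℤ → Λ × Λ') :=
  {ω | ∀ j : Fin c.length, (ω ((j : ℕ) + 1 : ℤ)).1 = c.get j}

/-- `D̄ = {ω ∈ (Λ × Λ')^ℤ : ω²_1 … ω²_{|d|} = d}`. -/
def BbarZ {Λ Λ' : Type*} (d : List Λ') : Set (ℤ → Λ × Λ') :=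
  {ω | ∀ j : Fin d.length, (ω ((j : ℕ) + 1 : ℤ)).2 = d.get j}

open scoped ENNReal NNReal

/-- One half of Birkhoff's theorem: Birkhoff sums of a function of negative mean are bounded
above. -/
theorem ae_bddAbove_birkhoff_of_integral_neg {Ω : Type*} [MeasurableSpace Ω] {μ : Measure Ω}
    [IsProbabilityMeasure μ] {T : Ω → Ω} (hT : Ergodic T μ) {g : Ω → ℝ} (hgm : Measurable g)
    (hg : Integrable g μ) (hneg : ∫ ω, g ω ∂μ < 0) :
    ∀ᵐ ω ∂μ, BddAbove (Set.range fun n : ℕ => ∑ k ∈ Finset.range n, g (T^[k] ω)) := by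
  have hTm : Measurable T := hT.measurable
  obtain ⟨M, M0', Ms'⟩ : ∃ M : ℕ → Ω → ℝ, (M 0 = fun _ => 0) ∧
      ∀ n, M (n + 1) = fun ω => max 0 (g ω + M n (T ω)) :=
    ⟨fun n => Nat.rec (fun _ => 0) (fun _ F ω => max 0 (g ω + F (T ω))) n, rfl, fun n => rfl⟩
  have M0 : ∀ ω, M 0 ω = 0 := fun ω => by rw [M0']
  have Ms : ∀ n ω, M (n + 1) ω = max 0 (g ω + M n (T ω)) := fun n ω => by rw [Ms']
  have Mmeas : ∀ n, Measurable (M n) := by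
    intro n
    induction n with
    | zero => rw [M0']; exact measurable_const
    | succ n ih => rw [Ms']; exact measurable_const.max (hgm.add (ih.comp hTm))
  have Mint : ∀ n, Integrable (M n) μ := by
    intro n
    induction n with
    | zero => rw [M0']; exact integrable_const 0
    | succ n ih =>
      rw [Ms']
      exact (integrable_const (0 : ℝ)).sup
        (hg.add (hT.toMeasurePreserving.integrable_comp_of_integrable ih))
  have Mnonneg : ∀ n ω, 0 ≤ M n ω := by
    intro n ω
    cases n with
    | zero => exact (M0 ω).ge
    | succ n => rw [Ms]; exact le_max_left _ _
  have Mmono : ∀ n ω, M n ω ≤ M (n + 1) ω := by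
    intro n
    induction n with
    | zero => intro ω; rw [M0]; exact Mnonneg _ _
    | succ n ih =>
      intro ω
      rw [Ms, Ms (n + 1)]
      exact max_le_max le_rfl (by linarith [ih (T ω)])
  have SM : ∀ n ω, ∑ k ∈ Finset.range n, g (T^[k] ω) ≤ M n ω := by
    intro n
    induction n with
    | zero => intro ω; simp [M0]
    | succ n ih =>
      intro ω
      rw [Finset.sum_range_succ', Ms]
      refine le_trans ?_ (le_max_right _ _)
      have := ih (T ω)
      simp only [Function.iterate_succ_apply, Function.iterate_zero, id] at *
      linarith
  set B : Set Ω := {ω | BddAbove (Set.range fun n : ℕ => ∑ k ∈ Finset.range n, g (T^[k] ω))}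
    with hB
  have hBm : MeasurableSet B := by
    refine measurableSet_bddAbove_range (fun n => ?_)
    exact Finset.measurable_sum _ (fun k _ => hgm.comp (hTm.iterate k))
  have hBinv : T ⁻¹' B = B := by
    ext ω
    simp only [hB, Set.mem_preimage, Set.mem_ofPred_eq, bddAbove_def, Set.forall_mem_range]
    constructor
    · rintro ⟨x, hx⟩
      refine ⟨max 0 (g ω + x), fun n => ?_⟩
      cases n with
      | zero => simp
      | succ n =>
        rw [Finset.sum_range_succ']
        refine le_trans ?_ (le_max_right _ _)
        have := hx n
        simp only [Function.iterate_succ_apply, Function.iterate_zero, id] at *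
        linarith
    · rintro ⟨x, hx⟩
      refine ⟨x - g ω, fun n => ?_⟩
      have := hx (n + 1)
      rw [Finset.sum_range_succ'] at this
      simp only [Function.iterate_succ_apply, Function.iterate_zero, id] at *
      linarith
  rcases hT.toPreErgodic.ae_mem_or_ae_notMem hBm hBinv with h | h
  · exact h
  exfalso
  have hlim : Tendsto (fun n => ∫ ω, (M (n + 1) ω - M n (T ω)) ∂μ) atTop (𝓝 (∫ ω, g ω ∂μ)) := by
    refine tendsto_integral_of_dominated_convergence (fun ω => |g ω|)
      (fun n => ((Mmeas (n + 1)).sub ((Mmeas n).comp hTm)).aestronglyMeasurable) hg.abs ?_ ?_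
    · refine fun n => ae_of_all _ fun ω => ?_
      rw [Ms, Real.norm_eq_abs]
      have := Mnonneg n (T ω)
      rcases max_cases 0 (g ω + M n (T ω)) with ⟨h1, h2⟩ | ⟨h1, h2⟩ <;> rw [h1]
      · rw [abs_of_nonpos (by linarith)]
        have := neg_abs_le (g ω)
        linarith
      · simp
    · filter_upwards [h] with ω hω
      have hω' : T ω ∉ B := fun hh => hω (by rw [← hBinv]; exact hh)
      have : ∃ n, -g ω < M n (T ω) := by
        by_contra! hc
        exact hω' ⟨-g ω, by rintro _ ⟨n, rfl⟩; exact (SM n _).trans (hc n)⟩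
      obtain ⟨n, hn⟩ := this
      refine tendsto_const_nhds.congr' ?_
      filter_upwards [eventually_ge_atTop n] with k hk
      have : M n (T ω) ≤ M k (T ω) := monotone_nat_of_le_succ (fun n => Mmono n (T ω)) hk
      rw [Ms, max_eq_right (by linarith)]
      ring
  have hge : ∀ n, 0 ≤ ∫ ω, (M (n + 1) ω - M n (T ω)) ∂μ := by
    intro n
    have hi : Integrable (fun ω => M n (T ω)) μ :=
      hT.toMeasurePreserving.integrable_comp_of_integrable (Mint n)
    rw [integral_sub (Mint _) hi]
    have : ∫ ω, M n (T ω) ∂μ = ∫ ω, M n ω ∂μ := by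
      rw [← integral_map hTm.aemeasurable (Mmeas n).aestronglyMeasurable, hT.map_eq]
    rw [this, sub_nonneg]
    exact integral_mono (Mint _) (Mint _) (Mmono n)
  linarith [ge_of_tendsto' hlim hge]

theorem sum_Icc_one_eq (u : ℕ → ℝ) (N : ℕ) :
    ∑ k ∈ Finset.Icc 1 N, u k = ∑ k ∈ Finset.range N, u (k + 1) := by
  induction N with
  | zero => simp
  | succ N ih => rw [Finset.sum_Icc_succ_top (by omega), ih, Finset.sum_range_succ]

/-- Cesàro average of `u 1, …, u N`. -/
noncomputable def cavg (u : ℕ → ℝ) (N : ℕ) : ℝ := (N : ℝ)⁻¹ * ∑ k ∈ Finset.Icc 1 N, u k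

theorem ae_eventually_cavg_le {Ω : Type*} [MeasurableSpace Ω] {μ : Measure Ω}
    [IsProbabilityMeasure μ] {T : Ω → Ω} (hT : Ergodic T μ) {f : Ω → ℝ} (hfm : Measurable f)
    (hf : Integrable f μ) :
    ∀ᵐ ω ∂μ, ∀ ε > 0, ∀ᶠ N in atTop, cavg (fun k => f (T^[k] ω)) N ≤ ∫ ω, f ω ∂μ + ε := by
  have key : ∀ j : ℕ, ∀ᵐ ω ∂μ, ∀ᶠ N in atTop,
      cavg (fun k => f (T^[k] ω)) N ≤ ∫ ω, f ω ∂μ + 2 * (1 / ((j : ℝ) + 1)) := by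
    intro j
    have hj : (0 : ℝ) < 1 / ((j : ℝ) + 1) := by positivity
    set δ : ℝ := 1 / ((j : ℝ) + 1)
    have hfT : Integrable (fun ω => f (T ω)) μ :=
      hT.toMeasurePreserving.integrable_comp_of_integrable hf
    have hint : ∫ ω, f (T ω) ∂μ = ∫ ω, f ω ∂μ := by
      rw [← integral_map hT.measurable.aemeasurable hfm.aestronglyMeasurable, hT.map_eq]
    have := ae_bddAbove_birkhoff_of_integral_neg hT
      (g := fun ω => f (T ω) - (∫ ω, f ω ∂μ + δ))
      ((hfm.comp hT.measurable).sub_const _) (hfT.sub (integrable_const _))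
      (by rw [integral_sub hfT (integrable_const _), hint]; simp; exact hj)
    filter_upwards [this] with ω ⟨K, hK⟩
    filter_upwards [eventually_ge_atTop (max 1 ⌈K / δ⌉₊)] with N hN
    have hN1 : (0 : ℝ) < N := by
      have : 1 ≤ N := (le_max_left _ _).trans hN
      exact_mod_cast this
    have hN2 : K ≤ N * δ := by
      have : ⌈K / δ⌉₊ ≤ N := (le_max_right _ _).trans hN
      rw [← div_le_iff₀ hj]
      exact (Nat.le_ceil _).trans (by exact_mod_cast this)
    have h1 := hK ⟨N, rfl⟩
    simp only [Finset.sum_sub_distrib, Finset.sum_const, Finset.card_range, nsmul_eq_mul] at h1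
    have h2 : ∑ k ∈ Finset.Icc 1 N, f (T^[k] ω) = ∑ k ∈ Finset.range N, f (T (T^[k] ω)) := by
      rw [sum_Icc_one_eq]
      simp only [Function.iterate_succ_apply']
    rw [cavg, h2, inv_mul_le_iff₀ hN1]
    nlinarith
  filter_upwards [ae_all_iff.2 key] with ω hω ε hε
  obtain ⟨j, hj⟩ := exists_nat_one_div_lt (half_pos hε)
  filter_upwards [hω j] with N hN
  linarith

theorem cavg_add (u v : ℕ → ℝ) (N : ℕ) :
    cavg (fun k => u k + v k) N = cavg u N + cavg v N := by
  simp only [cavg, Finset.sum_add_distrib, mul_add]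

theorem cavg_sub (u v : ℕ → ℝ) (N : ℕ) :
    cavg (fun k => u k - v k) N = cavg u N - cavg v N := by
  simp only [cavg, Finset.sum_sub_distrib, mul_sub]

theorem cavg_const_mul (c : ℝ) (u : ℕ → ℝ) (N : ℕ) :
    cavg (fun k => c * u k) N = c * cavg u N := by
  simp only [cavg, ← Finset.mul_sum]
  ring

theorem cavg_mono {u v : ℕ → ℝ} (h : ∀ k, u k ≤ v k) (N : ℕ) : cavg u N ≤ cavg v N :=
  mul_le_mul_of_nonneg_left (Finset.sum_le_sum fun k _ => h k) (by positivity)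

theorem cavg_nonneg {u : ℕ → ℝ} (h : ∀ k, 0 ≤ u k) (N : ℕ) : 0 ≤ cavg u N :=
  mul_nonneg (by positivity) (Finset.sum_nonneg fun k _ => h k)

theorem cavg_const_le {c : ℝ} (hc : 0 ≤ c) (N : ℕ) : cavg (fun _ => c) N ≤ c := by
  rcases Nat.eq_zero_or_pos N with rfl | hN
  · simpa [cavg] using hc
  · have : (N : ℝ) ≠ 0 := by positivity
    simp [cavg, this]

theorem abs_cavg_le (u : ℕ → ℝ) (N : ℕ) : |cavg u N| ≤ cavg (fun k => |u k|) N := by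
  rw [cavg, abs_mul, abs_of_nonneg (by positivity : (0 : ℝ) ≤ (N : ℝ)⁻¹)]
  exact mul_le_mul_of_nonneg_left (Finset.abs_sum_le_sum_abs _ _) (by positivity)

/-- The Cesàro averages of `|u|` tend to zero. -/
def CesaroNull (u : ℕ → ℝ) : Prop := Tendsto (cavg fun k => |u k|) atTop (𝓝 0)

theorem CesaroNull.tendsto {u : ℕ → ℝ} (h : CesaroNull u) : Tendsto (cavg u) atTop (𝓝 0) :=
  squeeze_zero_norm (fun N => abs_cavg_le u N) h

theorem CesaroNull.of_abs_le {u v : ℕ → ℝ} (h : CesaroNull v) (huv : ∀ k, |u k| ≤ |v k|) :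
    CesaroNull u :=
  squeeze_zero (fun N => cavg_nonneg (fun _ => abs_nonneg _) N) (fun N => cavg_mono huv N) h

theorem CesaroNull.abs {u : ℕ → ℝ} (h : CesaroNull u) : CesaroNull fun k => |u k| :=
  h.of_abs_le fun _ => (abs_abs _).le

theorem CesaroNull.add {u v : ℕ → ℝ} (hu : CesaroNull u) (hv : CesaroNull v) :
    CesaroNull fun k => u k + v k := by
  have h := Tendsto.add hu hv
  rw [add_zero] at h
  refine squeeze_zero (fun N => cavg_nonneg (fun _ => abs_nonneg _) N) (fun N => ?_) h
  rw [← cavg_add]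
  exact cavg_mono (fun k => abs_add_le _ _) N

theorem CesaroNull.const_mul {u : ℕ → ℝ} (hu : CesaroNull u) (c : ℝ) :
    CesaroNull fun k => c * u k := by
  have h := Tendsto.const_mul |c| hu
  rw [mul_zero] at h
  refine h.congr fun N => ?_
  rw [← cavg_const_mul]
  simp only [abs_mul]

theorem CesaroNull.sub {u v : ℕ → ℝ} (hu : CesaroNull u) (hv : CesaroNull v) :
    CesaroNull fun k => u k - v k := by
  convert hu.add (hv.const_mul (-1)) using 2
  ring

theorem CesaroNull.mul_bounded {u v : ℕ → ℝ} (hu : CesaroNull u) (hv : ∀ k, |v k| ≤ 1) :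
    CesaroNull fun k => u k * v k :=
  hu.of_abs_le fun k => by
    rw [abs_mul]; exact mul_le_of_le_one_right (abs_nonneg _) (hv k)

theorem cesaroNull_zero : CesaroNull fun _ => 0 := by
  have : (cavg fun _ : ℕ => |(0 : ℝ)|) = fun _ => 0 := by
    funext N
    simp [cavg]
  rw [CesaroNull, this]
  exact tendsto_const_nhds

theorem cesaroNull_of_forall_eventually_le {u : ℕ → ℝ}
    (h : ∀ ε > 0, ∀ᶠ N in atTop, cavg (fun k => |u k|) N ≤ ε) : CesaroNull u := by
  rw [CesaroNull, Metric.tendsto_atTop']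
  intro ε hε
  obtain ⟨n, hn⟩ := eventually_atTop.1 (h (ε / 2) (by linarith))
  refine ⟨n, fun N hN => ?_⟩
  rw [Real.dist_eq, sub_zero, abs_of_nonneg (cavg_nonneg (fun _ => abs_nonneg _) N)]
  linarith [hn N hN.le]

theorem cesaroNull_of_sq {u : ℕ → ℝ} (h : Tendsto (cavg fun k => u k ^ 2) atTop (𝓝 0)) :
    CesaroNull u := by
  refine cesaroNull_of_forall_eventually_le fun ε hε => ?_
  have h2 : ∀ᶠ N in atTop, cavg (fun k => u k ^ 2) N < (ε / 2) * (ε / 2) :=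
    h.eventually_lt_const (by positivity)
  filter_upwards [h2] with N hN
  have h3 : cavg (fun k => |u k|) N ≤ cavg (fun k => ε / 2 + (ε / 2)⁻¹ * u k ^ 2) N := by
    refine cavg_mono (fun k => ?_) N
    have h4 : (ε / 2) * (ε / 2)⁻¹ = 1 := mul_inv_cancel₀ (by positivity)
    have h5 : 0 < (ε / 2)⁻¹ := by positivity
    have h6 := sq_abs (u k)
    by_cases hc : |u k| ≤ ε / 2
    · have : 0 ≤ (ε / 2)⁻¹ * u k ^ 2 := by positivity
      linarith
    · push Not at hc
      have : |u k| ≤ (ε / 2)⁻¹ * u k ^ 2 := by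
        rw [← h6, le_inv_mul_iff₀ (by positivity)]
        nlinarith
      linarith
  rw [cavg_add, cavg_const_mul] at h3
  have h4 := cavg_const_le (c := ε / 2) (by positivity) N
  have h5 : (ε / 2)⁻¹ * cavg (fun k => u k ^ 2) N ≤ ε / 2 := by
    rw [inv_mul_le_iff₀ (by positivity)]
    exact hN.le
  linarith

theorem cesaroNull_of_eventually_zero {u : ℕ → ℝ} {K : ℕ} (h : ∀ k ≥ K, u k = 0) :
    CesaroNull u := by
  refine cesaroNull_of_forall_eventually_le fun ε hε => ?_
  set C := ∑ k ∈ Finset.Icc 1 K, |u k|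
  filter_upwards [eventually_ge_atTop (max (max 1 K) ⌈C / ε⌉₊)] with N hN
  have h1 : 1 ≤ N := (le_max_left _ _).trans ((le_max_left _ _).trans hN)
  have h2 : K ≤ N := (le_max_right _ _).trans ((le_max_left _ _).trans hN)
  have h3 : C / ε ≤ N := (Nat.le_ceil _).trans (by exact_mod_cast (le_max_right _ _).trans hN)
  rw [div_le_iff₀ hε] at h3
  rw [cavg, inv_mul_le_iff₀ (by exact_mod_cast h1)]
  refine le_trans (le_of_eq ?_) h3
  refine (Finset.sum_subset (Finset.Icc_subset_Icc_right h2) fun k hk hk' => ?_).symm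
  rw [h k, abs_zero]
  simp only [Finset.mem_Icc] at hk hk'
  omega

/-- Convergence of Cesàro averages of a bounded sequence can be checked along the squares. -/
theorem tendsto_cavg_of_squares {u : ℕ → ℝ} {B : ℝ} (hB : ∀ k, |u k| ≤ B)
    (h : Tendsto (fun j : ℕ => cavg u (j ^ 2)) atTop (𝓝 0)) : Tendsto (cavg u) atTop (𝓝 0) := by
  have hB0 : 0 ≤ B := (abs_nonneg _).trans (hB 0)
  have hsq : Tendsto Nat.sqrt atTop atTop :=
    tendsto_atTop.2 fun b => (eventually_ge_atTop (b * b)).mono fun N hN => Nat.le_sqrt.2 hN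
  have h1 : Tendsto (fun j : ℕ => |cavg u (j ^ 2)| + 2 * B * (1 / (j : ℝ))) atTop (𝓝 0) := by
    have := h.abs.add ((tendsto_one_div_atTop_nhds_zero_nat (𝕜 := ℝ)).const_mul (2 * B))
    simpa using this
  refine squeeze_zero_norm' ?_ (h1.comp hsq)
  filter_upwards [eventually_ge_atTop 1] with N hN
  simp only [Function.comp]
  set j := Nat.sqrt N
  have hj1 : 1 ≤ j := Nat.le_sqrt.2 (by simpa using hN)
  have hj2 : j ^ 2 ≤ N := Nat.sqrt_le' N
  have hj3 : N ≤ j ^ 2 + 2 * j := by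
    have := Nat.sqrt_le_add N
    nlinarith
  have hsplit : ∑ k ∈ Finset.Icc 1 N, u k =
      ∑ k ∈ Finset.Icc 1 (j ^ 2), u k + ∑ k ∈ Finset.Ioc (j ^ 2) N, u k := by
    rw [← Finset.sum_union]
    · congr 1
      ext k
      simp only [Finset.mem_Icc, Finset.mem_union, Finset.mem_Ioc]
      omega
    · rw [Finset.disjoint_left]
      intro k
      simp only [Finset.mem_Icc, Finset.mem_Ioc]
      omega
  have htail : |∑ k ∈ Finset.Ioc (j ^ 2) N, u k| ≤ 2 * j * B := by
    refine (Finset.abs_sum_le_sum_abs _ _).trans ((Finset.sum_le_sum fun k _ => hB k).trans ?_)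
    rw [Finset.sum_const, Nat.card_Ioc, nsmul_eq_mul]
    refine mul_le_mul_of_nonneg_right ?_ hB0
    have : N - j ^ 2 ≤ 2 * j := by omega
    exact_mod_cast this
  have hNr : (0 : ℝ) < N := by exact_mod_cast hN
  have hjr : (0 : ℝ) < j := by exact_mod_cast hj1
  have hj2r : (j : ℝ) ^ 2 ≤ N := by exact_mod_cast hj2
  have e1 : ∑ k ∈ Finset.Icc 1 (j ^ 2), u k = (j : ℝ) ^ 2 * cavg u (j ^ 2) := by
    rw [cavg]
    push_cast
    field_simp
  rw [Real.norm_eq_abs, cavg, abs_mul, abs_of_pos (inv_pos.2 hNr), inv_mul_le_iff₀ hNr, hsplit, e1]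
  refine (abs_add_le _ _).trans ?_
  rw [abs_mul, abs_of_nonneg (by positivity : (0 : ℝ) ≤ (j : ℝ) ^ 2), mul_add]
  refine add_le_add (mul_le_mul_of_nonneg_right hj2r (abs_nonneg _)) (htail.trans ?_)
  have : (j : ℝ) ≤ N * (1 / j) := by
    rw [mul_one_div, le_div_iff₀ hjr]
    nlinarith
  nlinarith

/-- Strong law of large numbers for bounded sequences that are orthogonal at distance `s`. -/
theorem ae_tendsto_cavg_of_orthogonal {Ω : Type*} [MeasurableSpace Ω] {μ : Measure Ω}
    [IsProbabilityMeasure μ] {Z : ℕ → Ω → ℝ} {B : ℝ} (hm : ∀ k, StronglyMeasurable (Z k))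
    (hB : ∀ k, ∀ᵐ ω ∂μ, |Z k ω| ≤ B) (s : ℕ)
    (horth : ∀ i j, i + s ≤ j → ∫ ω, Z i ω * Z j ω ∂μ = 0) :
    ∀ᵐ ω ∂μ, Tendsto (cavg fun k => Z k ω) atTop (𝓝 0) := by
  have hint2 : ∀ i j, Integrable (fun ω => Z i ω * Z j ω) μ := by
    intro i j
    refine Integrable.of_bound ((hm i).mul (hm j)).aestronglyMeasurable (B * B) ?_
    filter_upwards [hB i, hB j] with ω h1 h2
    rw [norm_mul]
    exact mul_le_mul h1 h2 (abs_nonneg _) ((abs_nonneg _).trans h1)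
  have hBB : ∀ i j, ∫ ω, Z i ω * Z j ω ∂μ ≤ B * B := by
    intro i j
    have : ∫ ω, Z i ω * Z j ω ∂μ ≤ ∫ _, B * B ∂μ := by
      refine integral_mono_ae (hint2 i j) (integrable_const _) ?_
      filter_upwards [hB i, hB j] with ω h1 h2
      refine (le_abs_self _).trans ?_
      rw [abs_mul]
      exact mul_le_mul h1 h2 (abs_nonneg _) ((abs_nonneg _).trans h1)
    simpa using this
  have hrow : ∀ N i, ∑ j ∈ Finset.Icc 1 N, ∫ ω, Z i ω * Z j ω ∂μ ≤ 2 * s * (B * B) := by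
    intro N i
    have h1 : ∀ j ∈ Finset.Icc 1 N, ∫ ω, Z i ω * Z j ω ∂μ ≤
        if i < j + s ∧ j < i + s then B * B else 0 := by
      intro j _
      split_ifs with hc
      · exact hBB i j
      · rw [not_and_or, not_lt, not_lt] at hc
        rcases hc with hc | hc
        · simp_rw [mul_comm (Z i _)]
          exact (horth j i hc).le
        · exact (horth i j hc).le
    refine (Finset.sum_le_sum h1).trans ?_
    rw [← Finset.sum_filter, Finset.sum_const, nsmul_eq_mul]
    refine mul_le_mul_of_nonneg_right ?_ (mul_self_nonneg B)
    have hsub : (Finset.Icc 1 N).filter (fun j => i < j + s ∧ j < i + s) ⊆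
        Finset.Ico (i + 1 - s) (i + s) := by
      intro j
      simp only [Finset.mem_filter, Finset.mem_Icc, Finset.mem_Ico]
      omega
    have := Finset.card_le_card hsub
    rw [Nat.card_Ico] at this
    have : _ ≤ 2 * s := this.trans (by omega)
    exact_mod_cast this
  have hsecond : ∀ N, ∫ ω, (∑ k ∈ Finset.Icc 1 N, Z k ω) ^ 2 ∂μ ≤ N * (2 * s * (B * B)) := by
    intro N
    have : ∫ ω, (∑ k ∈ Finset.Icc 1 N, Z k ω) ^ 2 ∂μ =
        ∑ i ∈ Finset.Icc 1 N, ∑ j ∈ Finset.Icc 1 N, ∫ ω, Z i ω * Z j ω ∂μ := by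
      simp_rw [sq, Finset.sum_mul_sum]
      rw [integral_finsetSum _ fun i _ => integrable_finsetSum _ fun j _ => hint2 i j]
      refine Finset.sum_congr rfl fun i _ => ?_
      rw [integral_finsetSum _ fun j _ => hint2 i j]
    rw [this]
    refine (Finset.sum_le_sum fun i _ => hrow N i).trans ?_
    simp
  have hint3 : ∀ N, Integrable (fun ω => (∑ k ∈ Finset.Icc 1 N, Z k ω) ^ 2) μ := by
    intro N
    simp_rw [sq, Finset.sum_mul_sum]
    exact integrable_finsetSum _ fun i _ => integrable_finsetSum _ fun j _ => hint2 i j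
  have hsq : ∀ j : ℕ, ∫ ω, (cavg (fun k => Z k ω) (j ^ 2)) ^ 2 ∂μ ≤
      2 * s * (B * B) * (1 / (j : ℝ) ^ 2) := by
    intro j
    simp_rw [cavg, mul_pow]
    rw [integral_const_mul]
    rcases Nat.eq_zero_or_pos j with rfl | hj
    · simp
    · have h1 := hsecond (j ^ 2)
      have hjr : (0 : ℝ) < j := by exact_mod_cast hj
      refine (mul_le_mul_of_nonneg_left h1 (by positivity)).trans (le_of_eq ?_)
      push_cast
      field_simp
  have hsum : Summable fun j : ℕ => ∫ ω, (cavg (fun k => Z k ω) (j ^ 2)) ^ 2 ∂μ :=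
    Summable.of_nonneg_of_le (fun j => integral_nonneg fun ω => sq_nonneg _) hsq
      ((Real.summable_one_div_nat_pow.2 (by norm_num)).mul_left _)
  have hcm : ∀ j : ℕ, Measurable fun ω => (cavg (fun k => Z k ω) (j ^ 2)) ^ 2 := fun j =>
    ((Finset.measurable_sum _ fun k _ => (hm k).measurable).const_mul _).pow_const 2
  have hci : ∀ j : ℕ, Integrable (fun ω => (cavg (fun k => Z k ω) (j ^ 2)) ^ 2) μ := by
    intro j
    simp_rw [cavg, mul_pow]
    exact (hint3 _).const_mul _
  have hfin : ∀ᵐ ω ∂μ, ∑' j : ℕ, ENNReal.ofReal ((cavg (fun k => Z k ω) (j ^ 2)) ^ 2) < ⊤ := by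
    refine ae_lt_top (Measurable.tsum fun j => (hcm j).ennreal_ofReal) ?_
    rw [lintegral_tsum fun j => (hcm j).ennreal_ofReal.aemeasurable]
    simp_rw [← fun j => ofReal_integral_eq_lintegral_ofReal (hci j)
      (ae_of_all _ fun ω => sq_nonneg _)]
    rw [← ENNReal.ofReal_tsum_of_nonneg (fun j => integral_nonneg fun ω => sq_nonneg _) hsum]
    exact ENNReal.ofReal_ne_top
  filter_upwards [hfin, ae_all_iff.2 hB] with ω h1 h2
  refine tendsto_cavg_of_squares h2 ?_
  have h3 := ENNReal.tendsto_atTop_zero_of_tsum_ne_top h1.ne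
  have h4 : Tendsto (fun j : ℕ => (cavg (fun k => Z k ω) (j ^ 2)) ^ 2) atTop (𝓝 0) := by
    have := (ENNReal.tendsto_toReal ENNReal.zero_ne_top).comp h3
    simpa [Function.comp_def, ENNReal.toReal_ofReal (sq_nonneg _)] using this
  have h5 := h4.sqrt
  simp only [Real.sqrt_sq_eq_abs, Real.sqrt_zero] at h5
  exact (tendsto_zero_iff_abs_tendsto_zero _).2 h5

theorem condExp_comp_measurePreserving {Ω Ω' : Type*} {m m0 : MeasurableSpace Ω} {μ : Measure Ω}
    {m0' : MeasurableSpace Ω'} {μ' : Measure Ω'}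
    [IsFiniteMeasure μ] [IsFiniteMeasure μ'] {π : Ω' → Ω} (hπ : MeasurePreserving π μ' μ)
    (hm : m ≤ m0) {X : Ω → ℝ} (hX : Integrable X μ) :
    (fun ω => (μ[X|m]) (π ω)) =ᵐ[μ'] μ'[fun ω => X (π ω)|m.comap π] := by
  have hm' : m.comap π ≤ m0' := (MeasurableSpace.comap_mono hm).trans hπ.measurable.comap_le
  have hXi : Integrable (fun ω => X (π ω)) μ' := hπ.integrable_comp_of_integrable hX
  have hCi : Integrable (fun ω => (μ[X|m]) (π ω)) μ' :=
    hπ.integrable_comp_of_integrable integrable_condExp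
  refine ae_eq_condExp_of_forall_setIntegral_eq hm' hXi (fun _ _ _ => hCi.integrableOn) ?_ ?_
  · rintro _ ⟨s, hs, rfl⟩ _
    have h : ∀ g : Ω → ℝ, Integrable g μ →
        ∫ ω in π ⁻¹' s, g (π ω) ∂μ' = ∫ x in s, g x ∂μ := by
      intro g hg
      have h1 := hg.aestronglyMeasurable
      rw [← hπ.map_eq] at h1 ⊢
      exact (setIntegral_map (hm _ hs) h1 hπ.measurable.aemeasurable).symm
    rw [h _ integrable_condExp, h _ hX]
    exact setIntegral_condExp hm hX hs
  · have h1 : StronglyMeasurable[m.comap π] (fun ω => (μ[X|m]) (π ω)) :=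
      stronglyMeasurable_condExp.comp_measurable (comap_measurable π)
    exact h1.aestronglyMeasurable

theorem ae_abs_condExp_le {Ω : Type*} {m m0 : MeasurableSpace Ω} {μ : Measure Ω} {X : Ω → ℝ} {c : ℝ}
    (h : ∀ᵐ ω ∂μ, |X ω| ≤ c) : ∀ᵐ ω ∂μ, |(μ[X|m]) ω| ≤ c :=
  ae_bdd_abs_condExp_of_ae_bdd_abs h

section CondExpTools

variable {Ω : Type*} {m0 : MeasurableSpace Ω} {μ : Measure Ω} [IsProbabilityMeasure μ]

theorem integral_mul_condExp {m : MeasurableSpace Ω} (hm : m ≤ m0) {V X : Ω → ℝ}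
    (hV : StronglyMeasurable[m] V) {c : ℝ} (hVb : ∀ᵐ ω ∂μ, |V ω| ≤ c) (hX : Integrable X μ) :
    ∫ ω, V ω * (μ[X|m]) ω ∂μ = ∫ ω, V ω * X ω ∂μ := by
  have h := condExp_stronglyMeasurable_mul_of_bound (μ := μ) hm hV hX c (by simpa using hVb)
  calc ∫ ω, V ω * (μ[X|m]) ω ∂μ = ∫ ω, (μ[V * X|m]) ω ∂μ := integral_congr_ae h.symm
    _ = ∫ ω, V ω * X ω ∂μ := integral_condExp hm

/-- A strong law for bounded martingale-difference-like sequences. -/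
theorem ae_tendsto_cavg_sub_condExp {H : ℕ → MeasurableSpace Ω} (hH : ∀ k, H k ≤ m0)
    (hmono : Monotone H) {Y V : ℕ → Ω → ℝ} (s k0 : ℕ)
    (hY : ∀ k, StronglyMeasurable[H (k + s)] (Y k)) (hYb : ∀ k, ∀ᵐ ω ∂μ, |Y k ω| ≤ 1)
    (hV : ∀ k ≥ k0, StronglyMeasurable[H k] (V k)) (hVb : ∀ k, ∀ᵐ ω ∂μ, |V k ω| ≤ 1) :
    ∀ᵐ ω ∂μ, Tendsto (cavg fun k => (Y k ω - (μ[Y k|H k]) ω) * V k ω) atTop (𝓝 0) := by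
  set Z : ℕ → Ω → ℝ := fun k ω => if k0 ≤ k then (Y k ω - (μ[Y k|H k]) ω) * V k ω else 0 with hZ
  have hZm : ∀ k, StronglyMeasurable[H (k + s)] (Z k) := by
    intro k
    by_cases hk : k0 ≤ k
    · simp only [hZ, hk, if_true]
      exact ((hY k).sub (stronglyMeasurable_condExp.mono (hmono (Nat.le_add_right k s)))).mul
        ((hV k hk).mono (hmono (Nat.le_add_right k s)))
    · simp only [hZ, hk, if_false]
      exact stronglyMeasurable_const
  have hYi : ∀ k, Integrable (Y k) μ := fun k =>
    Integrable.of_bound ((hY k).mono (hH _)).aestronglyMeasurable 1 (by simpa using hYb k)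
  have hZb : ∀ k, ∀ᵐ ω ∂μ, |Z k ω| ≤ 2 := by
    intro k
    filter_upwards [hYb k, hVb k, ae_abs_condExp_le (m := H k) (hYb k)] with ω h1 h2 h3
    by_cases hk : k0 ≤ k
    · simp only [hZ, hk, if_true, abs_mul]
      have : |Y k ω - (μ[Y k|H k]) ω| ≤ 2 := (abs_sub _ _).trans (by linarith)
      calc _ ≤ 2 * 1 := mul_le_mul this h2 (abs_nonneg _) (by norm_num)
        _ = 2 := by norm_num
    · simp [hZ, hk]
  have horth : ∀ i j, i + s ≤ j → ∫ ω, Z i ω * Z j ω ∂μ = 0 := by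
    intro i j hij
    by_cases hj : k0 ≤ j
    · have hW : StronglyMeasurable[H j] (fun ω => Z i ω * V j ω) :=
        ((hZm i).mono (hmono hij)).mul (hV j hj)
      have hWb : ∀ᵐ ω ∂μ, |Z i ω * V j ω| ≤ 2 := by
        filter_upwards [hZb i, hVb j] with ω h1 h2
        rw [abs_mul]
        calc _ ≤ 2 * 1 := mul_le_mul h1 h2 (abs_nonneg _) (by norm_num)
          _ = 2 := by norm_num
      have h1 := integral_mul_condExp (μ := μ) (hH j) hW hWb (hYi j)
      have h2 : ∀ ω, Z i ω * Z j ω =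
          (Z i ω * V j ω) * Y j ω - (Z i ω * V j ω) * (μ[Y j|H j]) ω := by
        intro ω
        have : Z j ω = (Y j ω - (μ[Y j|H j]) ω) * V j ω := by simp [hZ, hj]
        rw [this]; ring
      have hWm := (hW.mono (hH j)).aestronglyMeasurable (μ := μ)
      simp_rw [h2]
      rw [integral_sub, h1, sub_self]
      · exact (hYi j).bdd_mul hWm (by simpa using hWb)
      · exact integrable_condExp.bdd_mul hWm (by simpa using hWb)
    · simp [hZ, hj]
  filter_upwards [ae_tendsto_cavg_of_orthogonal (fun k => (hZm k).mono (hH _)) hZb s horth]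
    with ω hω
  have h1 : CesaroNull fun k => (Y k ω - (μ[Y k|H k]) ω) * V k ω - Z k ω :=
    cesaroNull_of_eventually_zero (K := k0) fun k hk => by
      have hk' : k0 ≤ k := hk
      simp [hZ, hk']
  have h2 := h1.tendsto.add hω
  rw [add_zero] at h2
  refine h2.congr fun N => ?_
  rw [← cavg_add]
  simp

theorem tendsto_integral_abs_condExp_sub {m : ℕ → MeasurableSpace Ω}
    (hmono : Monotone m) (hm : ∀ k, m k ≤ m0) (g : Ω → ℝ) :
    Tendsto (fun n => ∫ ω, |(μ[g|m n]) ω - (μ[g|⨆ n, m n]) ω| ∂μ) atTop (𝓝 0) := by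
  have h := tendsto_eLpNorm_condExp (μ := μ) (ℱ := ⟨m, hmono, hm⟩) g
  have h2 := (ENNReal.tendsto_toReal ENNReal.zero_ne_top).comp h
  refine h2.congr fun n => ?_
  have := integral_norm_eq_lintegral_enorm (μ := μ)
    (f := fun ω => (μ[g|m n]) ω - (μ[g|⨆ n, m n]) ω)
    (integrable_condExp.sub integrable_condExp).aestronglyMeasurable
  simp only [Real.norm_eq_abs] at this
  rw [this, Function.comp, eLpNorm_one_eq_lintegral_enorm]
  rfl

theorem exists_measurableSet_symmDiff_lt {m : ℕ → MeasurableSpace Ω} (hmono : Monotone m)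
    (hm : ∀ k, m k ≤ m0) {s : Set Ω} (hs : MeasurableSet[⨆ k, m k] s) {ε : ℝ} (hε : 0 < ε) :
    ∃ k, ∃ s', MeasurableSet[m k] s' ∧ μ.real (symmDiff s s') < ε := by
  have hs0 : MeasurableSet s := iSup_le hm _ hs
  set g : Ω → ℝ := s.indicator 1
  have hgi : Integrable g μ := (integrable_const (1 : ℝ)).indicator hs0
  have hg : μ[g|⨆ k, m k] = g := condExp_of_stronglyMeasurable (iSup_le hm)
    (stronglyMeasurable_one.indicator hs) hgi
  have h := tendsto_integral_abs_condExp_sub (μ := μ) hmono hm g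
  rw [hg] at h
  obtain ⟨k, hk⟩ := (h.eventually_lt_const (show (0 : ℝ) < ε / 2 by linarith)).exists
  refine ⟨k, {ω | 1 / 2 < (μ[g|m k]) ω}, ?_, ?_⟩
  · exact stronglyMeasurable_condExp.measurable measurableSet_Ioi
  set s' := {ω | 1 / 2 < (μ[g|m k]) ω}
  have hs' : MeasurableSet s' := hm k _ (stronglyMeasurable_condExp.measurable measurableSet_Ioi)
  have hle : ∀ ω, (symmDiff s s').indicator (1 : Ω → ℝ) ω ≤ 2 * |(μ[g|m k]) ω - g ω| := by
    intro ω
    by_cases h1 : ω ∈ s <;> by_cases h2 : ω ∈ s'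
    · simp [Set.mem_symmDiff, h1, h2]
    · have h3 : ¬ 1 / 2 < (μ[g|m k]) ω := h2
      have h4 : g ω = 1 := by simp [g, h1]
      have h5 : ω ∈ symmDiff s s' := by simp [Set.mem_symmDiff, h1, h2]
      rw [Set.indicator_of_mem h5, h4, abs_sub_comm, Pi.one_apply]
      have := le_abs_self (1 - (μ[g|m k]) ω)
      linarith
    · have h3 : 1 / 2 < (μ[g|m k]) ω := h2
      have h4 : g ω = 0 := by simp [g, h1]
      have h5 : ω ∈ symmDiff s s' := by simp [Set.mem_symmDiff, h1, h2]
      rw [Set.indicator_of_mem h5, h4, Pi.one_apply]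
      have := le_abs_self ((μ[g|m k]) ω - 0)
      linarith
    · simp [Set.mem_symmDiff, h1, h2]
  have h6 := integral_mono (μ := μ) ((integrable_const (1 : ℝ)).indicator (hs0.symmDiff hs'))
    (((integrable_condExp.sub hgi).abs).const_mul 2) hle
  rw [integral_const_mul] at h6
  have h7 : ∫ ω, (symmDiff s s').indicator (1 : Ω → ℝ) ω ∂μ = μ.real (symmDiff s s') :=
    integral_indicator_one (hs0.symmDiff hs')
  have h8 : ∫ ω, |((μ[g|m k]) - g) ω| ∂μ < ε / 2 := hk
  calc μ.real (symmDiff s s') = _ := h7.symm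
    _ ≤ _ := h6
    _ < ε := by
      simp only [Pi.sub_apply] at h8 ⊢
      linarith

end CondExpTools

theorem integral_abs_le_of_sq {Ω : Type*} {m0 : MeasurableSpace Ω} {μ : Measure Ω}
    [IsProbabilityMeasure μ] {f : Ω → ℝ} (hf2 : Integrable (fun ω => f ω ^ 2) μ)
    (hf : Integrable f μ) {δ : ℝ} (hδ : 0 < δ) (h : ∫ ω, f ω ^ 2 ∂μ ≤ δ ^ 2) :
    ∫ ω, |f ω| ∂μ ≤ 2 * δ := by
  have h1 : ∀ ω, |f ω| ≤ δ + δ⁻¹ * f ω ^ 2 := by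
    intro ω
    have h4 : δ * δ⁻¹ = 1 := mul_inv_cancel₀ hδ.ne'
    have h5 : 0 < δ⁻¹ := by positivity
    have h6 := sq_abs (f ω)
    by_cases hc : |f ω| ≤ δ
    · have : 0 ≤ δ⁻¹ * f ω ^ 2 := by positivity
      linarith
    · push Not at hc
      have : |f ω| ≤ δ⁻¹ * f ω ^ 2 := by
        rw [← h6, le_inv_mul_iff₀ hδ]
        nlinarith
      linarith
  have h2 := integral_mono hf.abs ((integrable_const δ).add (hf2.const_mul δ⁻¹)) h1
  refine h2.trans ?_
  simp only [Pi.add_apply]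
  rw [integral_add (integrable_const δ) (hf2.const_mul δ⁻¹), integral_const_mul]
  simp only [integral_const, probReal_univ, smul_eq_mul, one_mul]
  have h3 : δ⁻¹ * ∫ ω, f ω ^ 2 ∂μ ≤ δ := by
    rw [inv_mul_le_iff₀ hδ]
    linarith [sq δ]
  linarith

/-- Reverse martingale convergence in `L¹`, with a limit measurable for every `m Q`. -/
theorem exists_tendsto_condExp_antitone {Ω : Type*} {m0 : MeasurableSpace Ω} {μ : Measure Ω}
    [IsProbabilityMeasure μ] {m : ℕ → MeasurableSpace Ω} (hm : ∀ n, m n ≤ m0) (hanti : Antitone m)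
    {G : Ω → ℝ} (hG : Measurable G) (hGb : ∀ ω, |G ω| ≤ 1) :
    ∃ G' : Ω → ℝ, (∀ Q, Measurable[m Q] G') ∧ (∀ ω, |G' ω| ≤ 1) ∧ ∫ ω, G' ω ∂μ = ∫ ω, G ω ∂μ ∧
      Tendsto (fun Q => ∫ ω, |(μ[G|m Q]) ω - G' ω| ∂μ) atTop (𝓝 0) := by
  have hGi : Integrable G μ := Integrable.of_bound hG.aestronglyMeasurable 1
    (ae_of_all _ (by simpa using hGb))
  set g : ℕ → Ω → ℝ := fun Q => μ[G|m Q] with hg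
  have hgb : ∀ Q, ∀ᵐ ω ∂μ, |g Q ω| ≤ 1 := fun Q => ae_abs_condExp_le (ae_of_all _ hGb)
  have hgsm : ∀ Q, StronglyMeasurable[m Q] (g Q) := fun Q => stronglyMeasurable_condExp
  have hgi : ∀ Q, Integrable (g Q) μ := fun Q => integrable_condExp
  have hgg : ∀ Q R, Integrable (fun ω => g Q ω * g R ω) μ := fun Q R =>
    (hgi R).bdd_mul (hgi Q).aestronglyMeasurable (by simpa using hgb Q)
  have hcross : ∀ Q R, Q ≤ R → ∫ ω, g R ω * g Q ω ∂μ = ∫ ω, g R ω * g R ω ∂μ := by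
    intro Q R hQR
    rw [← integral_mul_condExp (hm R) (hgsm R) (hgb R) (hgi Q)]
    refine integral_congr_ae ?_
    filter_upwards [condExp_condExp_of_le (μ := μ) (f := G) (hanti hQR) (hm Q)] with ω hω
    rw [hg]
    simp only [hω]
  set a : ℕ → ℝ := fun Q => ∫ ω, g Q ω * g Q ω ∂μ with ha
  have hdiff : ∀ Q R, Q ≤ R → ∫ ω, (g Q ω - g R ω) ^ 2 ∂μ = a Q - a R := by
    intro Q R hQR
    have : ∀ ω, (g Q ω - g R ω) ^ 2 = g Q ω * g Q ω - 2 * (g R ω * g Q ω) + g R ω * g R ω := by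
      intro ω; ring
    simp_rw [this]
    have hs : Integrable (fun ω => g Q ω * g Q ω - 2 * (g R ω * g Q ω)) μ :=
      (hgg Q Q).sub ((hgg R Q).const_mul 2)
    rw [integral_add hs (hgg R R),
      integral_sub (hgg Q Q) ((hgg R Q).const_mul 2), integral_const_mul, hcross Q R hQR]
    simp only [ha]
    ring
  have hanti_a : Antitone a := by
    intro Q R hQR
    have := hdiff Q R hQR
    have h0 : 0 ≤ ∫ ω, (g Q ω - g R ω) ^ 2 ∂μ := integral_nonneg fun ω => sq_nonneg _
    linarith
  have hbdd : BddBelow (Set.range a) := ⟨0, by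
    rintro _ ⟨Q, rfl⟩
    exact integral_nonneg fun ω => mul_self_nonneg _⟩
  have hcauchy_a := (tendsto_atTop_ciInf hanti_a hbdd).cauchySeq
  set u : ℕ → Lp ℝ 1 μ := fun Q => (hgi Q).toL1 (g Q) with hu
  have hdist : ∀ Q R, dist (u Q) (u R) = ∫ ω, |g Q ω - g R ω| ∂μ := by
    intro Q R
    rw [dist_eq_norm, hu, ← Integrable.toL1_sub _ _ (hgi Q) (hgi R),
      L1.norm_of_fun_eq_integral_norm]
    rfl
  have hcu : CauchySeq u := by
    rw [Metric.cauchySeq_iff']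
    intro ε hε
    obtain ⟨N, hN⟩ := Metric.cauchySeq_iff'.1 hcauchy_a ((ε / 3) ^ 2) (by positivity)
    refine ⟨N, fun n hn => ?_⟩
    rw [dist_comm, hdist]
    have h1 : ∫ ω, (g N ω - g n ω) ^ 2 ∂μ ≤ (ε / 3) ^ 2 := by
      rw [hdiff N n hn]
      have := hN n hn
      rw [dist_comm, Real.dist_eq] at this
      exact (le_abs_self _).trans this.le
    have h2 : Integrable (fun ω => (g N ω - g n ω) ^ 2) μ := by
      have : ∀ ω, (g N ω - g n ω) ^ 2 = g N ω * g N ω - 2 * (g n ω * g N ω) + g n ω * g n ω := by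
        intro ω; ring
      simp_rw [this]
      exact ((hgg _ _).sub ((hgg _ _).const_mul 2)).add (hgg _ _)
    have := integral_abs_le_of_sq h2 ((hgi N).sub (hgi n)) (by positivity : 0 < ε / 3) h1
    linarith
  obtain ⟨f, hf⟩ := cauchySeq_tendsto_of_complete hcu
  obtain ⟨ns, hns, hae⟩ := (tendstoInMeasure_of_tendsto_Lp hf).exists_seq_tendsto_ae
  have hcoe : ∀ᵐ ω ∂μ, ∀ Q, u Q ω = g Q ω := ae_all_iff.2 fun Q => (hgi Q).coeFn_toL1
  set G' : Ω → ℝ := fun ω => max (-1) (min 1 (limsup (fun i => g (ns i) ω) atTop)) with hG'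
  have hG'f : ∀ᵐ ω ∂μ, f ω = G' ω := by
    filter_upwards [hae, hcoe, ae_all_iff.2 hgb] with ω h1 h2 h3
    simp only [h2] at h1
    have h4 : |f ω| ≤ 1 := le_of_tendsto h1.abs (Eventually.of_forall fun i => h3 _)
    rw [hG']
    simp only [h1.limsup_eq]
    rw [abs_le] at h4
    rw [min_eq_right h4.2, max_eq_right h4.1]
  have hb' : ∀ ω, |G' ω| ≤ 1 := fun ω => by
    rw [abs_le]
    exact ⟨le_max_left _ _, max_le (by norm_num) (min_le_left _ _)⟩
  have hmeas : ∀ Q, Measurable[m Q] G' := by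
    intro Q
    have h1 : Measurable[m Q] fun ω => limsup (fun i => g (ns (i + Q)) ω) atTop := by
      refine @Measurable.limsup _ _ _ _ _ (m Q) _ _ _ _ fun i => ?_
      have hle : Q ≤ ns (i + Q) := (Nat.le_add_left Q i).trans (hns.id_le _)
      exact (hgsm _).measurable.mono (hanti hle) le_rfl
    have h2 : ∀ ω, limsup (fun i => g (ns (i + Q)) ω) atTop =
        limsup (fun i => g (ns i) ω) atTop := fun ω =>
      limsup_nat_add (fun i => g (ns i) ω) Q
    simp_rw [h2] at h1
    exact measurable_const.max (measurable_const.min h1)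
  have hlim : Tendsto (fun Q => ∫ ω, |g Q ω - G' ω| ∂μ) atTop (𝓝 0) := by
    have h1 := tendsto_iff_norm_sub_tendsto_zero.1 hf
    refine h1.congr fun Q => ?_
    rw [L1.norm_eq_integral_norm]
    refine integral_congr_ae ?_
    filter_upwards [Lp.coeFn_sub (u Q) f, hcoe, hG'f] with ω h2 h3 h4
    rw [h2, Pi.sub_apply, h3, h4, Real.norm_eq_abs]
  refine ⟨G', hmeas, hb', ?_, hlim⟩
  have hG'i : Integrable G' μ := Integrable.of_bound
    ((hmeas 0).mono (hm 0) le_rfl).aestronglyMeasurable 1 (ae_of_all _ (by simpa using hb'))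
  have h1 : ∀ Q, |∫ ω, G ω ∂μ - ∫ ω, G' ω ∂μ| ≤ ∫ ω, |g Q ω - G' ω| ∂μ := by
    intro Q
    rw [← integral_condExp (μ := μ) (f := G) (hm Q), ← integral_sub (hgi Q) hG'i]
    exact abs_integral_le_integral_abs
  have h2 := le_of_tendsto_of_tendsto' tendsto_const_nhds hlim h1
  have h3 := abs_eq_zero.1 (le_antisymm h2 (abs_nonneg _))
  linarith

theorem integral_mul_sub_condExp_eq_zero {Ω : Type*} {m m0 : MeasurableSpace Ω} {μ : Measure Ω}
    [IsProbabilityMeasure μ] (hm : m ≤ m0) {V X : Ω → ℝ}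
    (hV : StronglyMeasurable[m] V) (hVi : Integrable V μ) (hX : Integrable X μ)
    (hXb : ∀ᵐ ω ∂μ, |X ω| ≤ 1) :
    ∫ ω, V ω * (X ω - (μ[X|m]) ω) ∂μ = 0 := by
  have hVX : Integrable (V * X) μ :=
    hVi.mul_bdd hX.aestronglyMeasurable (by simpa using hXb)
  have hVC : Integrable (V * μ[X|m]) μ :=
    hVi.mul_bdd (c := 1) integrable_condExp.aestronglyMeasurable
      (by simpa using ae_abs_condExp_le hXb)
  have h := condExp_mul_of_stronglyMeasurable_left (μ := μ) hV hVX hX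
  have e : ∀ ω, V ω * (X ω - (μ[X|m]) ω) = (V * X) ω - (V * μ[X|m]) ω := by
    intro ω; simp only [Pi.mul_apply]; ring
  simp_rw [e]
  rw [integral_sub hVX hVC, ← integral_congr_ae h, integral_condExp hm, sub_self]

theorem integral_mul_sub_condExp_prod_eq_zero {α β : Type*} {mα : MeasurableSpace α}
    {H mβ : MeasurableSpace β} {μ₁ : Measure α} {μ₂ : Measure β} [IsProbabilityMeasure μ₁]
    [IsProbabilityMeasure μ₂] (hH : H ≤ mβ) {X : β → ℝ}
    (hX : Measurable X) (hXb : ∀ y, |X y| ≤ 1) {W : α × β → ℝ}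
    (hW : StronglyMeasurable[mα.comap Prod.fst ⊔ H.comap Prod.snd] W)
    (hWi : Integrable W (μ₁.prod μ₂)) :
    ∫ z, W z * (X z.2 - (μ₂[X|H]) z.2) ∂(μ₁.prod μ₂) = 0 := by
  have hXi : Integrable X μ₂ := Integrable.of_bound hX.aestronglyMeasurable 1
    (ae_of_all _ (by simpa using hXb))
  have hb : ∀ᵐ z ∂(μ₁.prod μ₂), ‖X z.2 - (μ₂[X|H]) z.2‖ ≤ 2 := by
    have h1 : ∀ᵐ y ∂μ₂, ‖X y - (μ₂[X|H]) y‖ ≤ 2 := by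
      filter_upwards [ae_abs_condExp_le (μ := μ₂) (m := H) (ae_of_all _ hXb)] with y hy
      exact (abs_sub _ _).trans (by linarith [hXb y])
    exact Measure.quasiMeasurePreserving_snd.ae h1
  have hm : AEStronglyMeasurable (fun z : α × β => X z.2 - (μ₂[X|H]) z.2) (μ₁.prod μ₂) :=
    ((hX.sub (stronglyMeasurable_condExp.measurable.mono hH le_rfl)).comp
      measurable_snd).aestronglyMeasurable
  have hint : Integrable (fun z : α × β => W z * (X z.2 - (μ₂[X|H]) z.2)) (μ₁.prod μ₂) :=
    hWi.mul_bdd hm hb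
  rw [integral_prod _ hint]
  have h0 : ∀ᵐ a ∂μ₁, ∫ y, W (a, y) * (X y - (μ₂[X|H]) y) ∂μ₂ = 0 := by
    filter_upwards [hWi.prod_right_ae] with a ha
    refine integral_mul_sub_condExp_eq_zero hH ?_ ha hXi (ae_of_all _ hXb)
    exact hW.comp_measurable (@measurable_prodMk_left _ _ mα H a)
  rw [integral_congr_ae h0, integral_zero]

/-- If the joint law of `p` and `f` is absolutely continuous with respect to the product of the
marginals, conditioning additionally on `p` asymptotically does not matter. -/
theorem tendsto_integral_abs_condExp_sup_sub {Ω α β : Type*} {mΩ : MeasurableSpace Ω}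
    {mα : MeasurableSpace α} {mβ : MeasurableSpace β} {μ : Measure Ω} [IsProbabilityMeasure μ]
    {p : Ω → α} {f : Ω → β} (hp : Measurable p) (hf : Measurable f)
    (hac : μ.map (fun ω => (p ω, f ω)) ≪ (μ.map p).prod (μ.map f))
    {H : ℕ → MeasurableSpace β} (hH : ∀ k, H k ≤ mβ) (hmono : Monotone H)
    (hsup : ⨆ k, H k = mβ) {X : ℕ → β → ℝ} (hX : ∀ k, Measurable (X k))
    (hXb : ∀ k y, |X k y| ≤ 1) :
    Tendsto (fun k => ∫ ω, |(μ[fun ω => X k (f ω)|mα.comap p ⊔ (H k).comap f]) ω -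
      (μ[fun ω => X k (f ω)|(H k).comap f]) ω| ∂μ) atTop (𝓝 0) := by
  have hpf : Measurable fun ω => (p ω, f ω) := hp.prodMk hf
  set lam := μ.map (fun ω => (p ω, f ω)) with hlam
  set μ₁ := μ.map p
  set μ₂ := μ.map f
  have : IsProbabilityMeasure lam := Measure.isProbabilityMeasure_map hpf.aemeasurable
  have : IsProbabilityMeasure μ₁ := Measure.isProbabilityMeasure_map hp.aemeasurable
  have : IsProbabilityMeasure μ₂ := Measure.isProbabilityMeasure_map hf.aemeasurable
  have mpf : MeasurePreserving (fun ω => (p ω, f ω)) μ lam := ⟨hpf, rfl⟩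
  have mp2 : MeasurePreserving f μ μ₂ := ⟨hf, rfl⟩
  set K : ℕ → MeasurableSpace (α × β) := fun k => mα.comap Prod.fst ⊔ (H k).comap Prod.snd
    with hK
  have hKle : ∀ k, K k ≤ Prod.instMeasurableSpace := fun k =>
    sup_le_sup le_rfl (MeasurableSpace.comap_mono (hH k))
  have hKmono : Monotone K := fun i j hij =>
    sup_le_sup le_rfl (MeasurableSpace.comap_mono (hmono hij))
  have hKsup : ⨆ k, K k = Prod.instMeasurableSpace := by
    rw [hK, ← sup_iSup, ← MeasurableSpace.comap_iSup, hsup]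
    rfl
  set D : α × β → ℝ := fun z => (lam.rnDeriv (μ₁.prod μ₂) z).toReal
  have hDi : Integrable D (μ₁.prod μ₂) := Measure.integrable_toReal_rnDeriv
  set Dk : ℕ → α × β → ℝ := fun k => (μ₁.prod μ₂)[D|K k] with hDk
  have hlim := tendsto_integral_abs_condExp_sub (μ := μ₁.prod μ₂) hKmono hKle D
  rw [hKsup, condExp_of_stronglyMeasurable le_rfl
    (Measure.measurable_rnDeriv _ _).ennreal_toReal.stronglyMeasurable hDi] at hlim
  have hlim2 := hlim.const_mul 2
  rw [mul_zero] at hlim2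
  refine squeeze_zero (fun k => integral_nonneg fun ω => abs_nonneg _) (fun k => ?_) hlim2
  set x : β → ℝ := μ₂[X k|H k] with hx
  have hXi2 : Integrable (X k) μ₂ := Integrable.of_bound (hX k).aestronglyMeasurable 1
    (ae_of_all _ (by simpa using hXb k))
  have hXil : Integrable (fun z : α × β => X k z.2) lam :=
    Integrable.of_bound ((hX k).comp measurable_snd).aestronglyMeasurable 1
      (ae_of_all _ fun z => by simpa using hXb k z.2)
  set L : α × β → ℝ := lam[fun z => X k z.2|K k] with hL
  have hcomap : (K k).comap (fun ω => (p ω, f ω)) = mα.comap p ⊔ (H k).comap f := by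
    simp only [hK, MeasurableSpace.comap_sup, MeasurableSpace.comap_comp]
    rfl
  have e1 := condExp_comp_measurePreserving mpf (hKle k) hXil
  rw [hcomap] at e1
  have e2 := condExp_comp_measurePreserving mp2 (hH k) hXi2
  have hxm : StronglyMeasurable[H k] x := stronglyMeasurable_condExp
  have hxm' : Measurable x := hxm.measurable.mono (hH k) le_rfl
  have hLm : StronglyMeasurable[K k] L := stronglyMeasurable_condExp
  have hxK : StronglyMeasurable[K k] (fun z : α × β => x z.2) :=
    hxm.comp_measurable (measurable_iff_comap_le.2 le_sup_right)
  have hint : ∫ ω, |(μ[fun ω => X k (f ω)|mα.comap p ⊔ (H k).comap f]) ω -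
      (μ[fun ω => X k (f ω)|(H k).comap f]) ω| ∂μ = ∫ z, |L z - x z.2| ∂lam := by
    rw [hlam, integral_map hpf.aemeasurable]
    · refine integral_congr_ae ?_
      filter_upwards [e1, e2] with ω h1 h2
      rw [← h1, ← h2]
    · exact (continuous_abs.comp_stronglyMeasurable
        ((hLm.sub hxK).mono (hKle k))).aestronglyMeasurable
  rw [hint]
  set s : Set (α × β) := {z | x z.2 ≤ L z}
  have hs : MeasurableSet[K k] s := @measurableSet_le _ _ _ _ _ (K k) _ _ _ _ _
    hxK.measurable hLm.measurable
  set σ : α × β → ℝ := fun z => 2 * s.indicator (fun _ => (1 : ℝ)) z - 1 with hσ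
  have hσm : StronglyMeasurable[K k] σ :=
    ((stronglyMeasurable_const.indicator hs).const_mul 2).sub stronglyMeasurable_const
  have hσb : ∀ z, |σ z| ≤ 1 := by
    intro z
    by_cases hz : z ∈ s <;> simp [hσ, hz]
    norm_num
  have habs : ∀ z, |L z - x z.2| = σ z * (L z - x z.2) := by
    intro z
    by_cases hz : z ∈ s
    · have : x z.2 ≤ L z := hz
      rw [abs_of_nonneg (by linarith)]
      simp [hσ, hz]
      norm_num
    · have : ¬ x z.2 ≤ L z := hz
      rw [abs_of_neg (by linarith)]
      simp [hσ, hz]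
  have hxb2 : ∀ᵐ y ∂μ₂, |x y| ≤ 1 := ae_abs_condExp_le (ae_of_all _ (hXb k))
  have hxbν : ∀ᵐ z ∂(μ₁.prod μ₂), |x z.2| ≤ 1 := Measure.quasiMeasurePreserving_snd.ae hxb2
  have hxbl : ∀ᵐ z ∂lam, |x z.2| ≤ 1 := hac.ae_le hxbν
  have hxil : Integrable (fun z : α × β => x z.2) lam :=
    Integrable.of_bound (hxm'.comp measurable_snd).aestronglyMeasurable 1 (by simpa using hxbl)
  have hσ0 := (hσm.mono (hKle k)).aestronglyMeasurable (μ := lam)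
  have hσ0' := (hσm.mono (hKle k)).aestronglyMeasurable (μ := μ₁.prod μ₂)
  have hσbn : ∀ z, ‖σ z‖ ≤ 1 := hσb
  have e3 : ∫ z, |L z - x z.2| ∂lam = ∫ z, σ z * (X k z.2 - x z.2) ∂lam := by
    simp_rw [habs, mul_sub]
    rw [integral_sub (integrable_condExp.bdd_mul hσ0 (ae_of_all _ hσbn))
        (hxil.bdd_mul hσ0 (ae_of_all _ hσbn)),
      integral_sub (hXil.bdd_mul hσ0 (ae_of_all _ hσbn))
        (hxil.bdd_mul hσ0 (ae_of_all _ hσbn)),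
      integral_mul_condExp (hKle k) hσm (ae_of_all _ hσb) hXil]
  have e4 : ∫ z, σ z * (X k z.2 - x z.2) ∂lam =
      ∫ z, D z * (σ z * (X k z.2 - x z.2)) ∂(μ₁.prod μ₂) :=
    (integral_rnDeriv_smul (E := ℝ) hac).symm
  have hRb : ∀ᵐ z ∂(μ₁.prod μ₂), ‖σ z * (X k z.2 - x z.2)‖ ≤ 2 := by
    filter_upwards [hxbν] with z hz
    rw [norm_mul]
    have : |X k z.2 - x z.2| ≤ 2 := (abs_sub _ _).trans (by linarith [hXb k z.2])
    calc _ ≤ 1 * 2 := mul_le_mul (hσbn z) this (abs_nonneg _) zero_le_one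
      _ = 2 := by norm_num
  have hRm : AEStronglyMeasurable (fun z : α × β => σ z * (X k z.2 - x z.2)) (μ₁.prod μ₂) :=
    hσ0'.mul (((hX k).sub hxm').comp measurable_snd).aestronglyMeasurable
  have e5 : ∫ z, Dk k z * (σ z * (X k z.2 - x z.2)) ∂(μ₁.prod μ₂) = 0 := by
    simp_rw [← mul_assoc]
    refine integral_mul_sub_condExp_prod_eq_zero (hH k) (hX k) (hXb k)
      (W := fun z => Dk k z * σ z) (stronglyMeasurable_condExp.mul hσm) ?_
    exact integrable_condExp.mul_bdd hσ0' (ae_of_all _ hσbn)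
  have hi1 : Integrable (fun z => D z * (σ z * (X k z.2 - x z.2))) (μ₁.prod μ₂) :=
    hDi.mul_bdd hRm hRb
  have hi2 : Integrable (fun z => Dk k z * (σ z * (X k z.2 - x z.2))) (μ₁.prod μ₂) :=
    integrable_condExp.mul_bdd hRm hRb
  rw [e3, e4, ← sub_zero (∫ z, D z * _ ∂_), ← e5, ← integral_sub hi1 hi2, ← integral_const_mul]
  refine integral_mono_ae (hi1.sub hi2) ((integrable_condExp.sub hDi).abs.const_mul 2) ?_
  filter_upwards [hRb] with z hz
  have : D z * (σ z * (X k z.2 - x z.2)) - Dk k z * (σ z * (X k z.2 - x z.2)) =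
      (D z - Dk k z) * (σ z * (X k z.2 - x z.2)) := by ring
  rw [this]
  refine (le_abs_self _).trans ?_
  rw [abs_mul, abs_sub_comm, mul_comm]
  exact mul_le_mul_of_nonneg_right hz (abs_nonneg _)

/-- Cesàro averages of nonnegative functions along the times `τ` are asymptotically at most `q`
times their mean. -/
def DominatedTimes {Ω : Type*} [MeasurableSpace Ω] (μ : Measure Ω) (S : Ω → Ω) (τ : ℕ → ℕ)
    (q : ℝ) : Prop :=
  ∀ ψ : Ω → ℝ, Measurable ψ → (∀ ω, 0 ≤ ψ ω) → Integrable ψ μ →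
    ∀ᵐ ω ∂μ, ∀ ε > 0, ∀ᶠ N in atTop, cavg (fun k => ψ (S^[τ k] ω)) N ≤ q * ∫ ω, ψ ω ∂μ + ε

section Dominated

variable {Ω : Type*} [MeasurableSpace Ω] {μ : Measure Ω} [IsProbabilityMeasure μ] {S : Ω → Ω}

theorem Ergodic.dominatedTimes_id (hS : Ergodic S μ) : DominatedTimes μ S (fun k => k) 1 := by
  intro ψ hψ _ hi
  simpa using ae_eventually_cavg_le hS hψ hi

theorem sum_comp_le_of_fibers {τ : ℕ → ℕ} {q : ℕ} (hmono : Monotone τ) (hle : ∀ k, τ k ≤ k)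
    (hq : ∀ k, τ k < τ (k + q)) {u : ℕ → ℝ} (hu : ∀ k, 0 ≤ u k) (N : ℕ) :
    ∑ k ∈ Finset.Icc 1 N, u (τ k) ≤ q * ∑ l ∈ Finset.range (N + 1), u l := by
  have hmaps : ∀ k ∈ Finset.Icc 1 N, τ k ∈ Finset.range (N + 1) := by
    intro k hk
    simp only [Finset.mem_Icc] at hk
    have := hle k
    simp only [Finset.mem_range]
    omega
  rw [← Finset.sum_fiberwise_of_maps_to hmaps, Finset.mul_sum]
  refine Finset.sum_le_sum fun l _ => ?_
  have h1 : ∀ k ∈ (Finset.Icc 1 N).filter (fun k => τ k = l), u (τ k) = u l := by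
    intro k hk
    rw [(Finset.mem_filter.1 hk).2]
  rw [Finset.sum_congr rfl h1, Finset.sum_const, nsmul_eq_mul]
  refine mul_le_mul_of_nonneg_right ?_ (hu l)
  rcases ((Finset.Icc 1 N).filter (fun k => τ k = l)).eq_empty_or_nonempty with he | hne
  · simp [he]
  · set F := (Finset.Icc 1 N).filter (fun k => τ k = l)
    have hsub : F ⊆ Finset.Ico (F.min' hne) (F.min' hne + q) := by
      intro k hk
      rw [Finset.mem_Ico]
      refine ⟨F.min'_le k hk, ?_⟩
      by_contra hc
      push Not at hc
      have h2 := (Finset.mem_filter.1 hk).2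
      have h3 := (Finset.mem_filter.1 (F.min'_mem hne)).2
      have h4 := hq (F.min' hne)
      have h5 := hmono hc
      omega
    have := Finset.card_le_card hsub
    rw [Nat.card_Ico] at this
    exact_mod_cast (by omega : F.card ≤ q)

theorem Ergodic.dominatedTimes (hS : Ergodic S μ) {τ : ℕ → ℕ} {q : ℕ} (hmono : Monotone τ)
    (hle : ∀ k, τ k ≤ k) (hq : ∀ k, τ k < τ (k + q)) : DominatedTimes μ S τ q := by
  intro ψ hψ h0 hi
  filter_upwards [ae_eventually_cavg_le hS hψ hi] with ω hω ε hε
  have hε' : (0 : ℝ) < ε / (2 * (q + 1)) := by positivity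
  have hlim : Tendsto (fun N : ℕ => (N : ℝ)⁻¹ * (q * ψ ω)) atTop (𝓝 0) := by
    simpa using (tendsto_inv_atTop_nhds_zero_nat (𝕜 := ℝ)).mul_const (q * ψ ω)
  filter_upwards [hω _ hε', hlim.eventually_lt_const (half_pos hε)] with N h1 h2
  have h3 := sum_comp_le_of_fibers hmono hle hq (u := fun l => ψ (S^[l] ω)) (fun k => h0 _) N
  rw [Finset.sum_range_succ', ← sum_Icc_one_eq (fun l => ψ (S^[l] ω))] at h3
  have h4 : cavg (fun k => ψ (S^[τ k] ω)) N ≤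
      q * cavg (fun k => ψ (S^[k] ω)) N + (N : ℝ)⁻¹ * (q * ψ ω) := by
    have := mul_le_mul_of_nonneg_left h3 (by positivity : (0 : ℝ) ≤ (N : ℝ)⁻¹)
    simp only [cavg]
    simp only [Function.iterate_zero, id] at this
    linarith
  have h5 : (q : ℝ) * cavg (fun k => ψ (S^[k] ω)) N ≤ q * ∫ ω, ψ ω ∂μ + ε / 2 := by
    have h6 := mul_le_mul_of_nonneg_left h1 (Nat.cast_nonneg (α := ℝ) q)
    have h7 : (q : ℝ) * (ε / (2 * (q + 1))) ≤ ε / 2 := by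
      rw [← mul_div_assoc, div_le_div_iff₀ (by positivity) (by positivity)]
      nlinarith [Nat.cast_nonneg (α := ℝ) q]
    linarith
  linarith

theorem ae_tendsto_zero_of_dominatedTimes {τ : ℕ → ℕ} {q : ℝ} (hdom : DominatedTimes μ S τ q)
    {x : Ω → ℕ → ℝ} (hx : ∀ ω N, 0 ≤ x ω N) {w : ℕ → Ω → ℕ → ℝ}
    (hw : ∀ Q, ∀ᵐ ω ∂μ, Tendsto (w Q ω) atTop (𝓝 0)) {ψ : ℕ → Ω → ℝ}
    (hψ : ∀ Q, Measurable (ψ Q)) (hψ0 : ∀ Q ω, 0 ≤ ψ Q ω) (hψi : ∀ Q, Integrable (ψ Q) μ)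
    (hlim : Tendsto (fun Q => ∫ ω, ψ Q ω ∂μ) atTop (𝓝 0))
    (hle : ∀ Q, ∀ᵐ ω ∂μ, ∀ N, x ω N ≤ w Q ω N + cavg (fun k => ψ Q (S^[τ k] ω)) N) :
    ∀ᵐ ω ∂μ, Tendsto (x ω) atTop (𝓝 0) := by
  filter_upwards [ae_all_iff.2 hw, ae_all_iff.2 hle,
    ae_all_iff.2 fun Q => hdom (ψ Q) (hψ Q) (hψ0 Q) (hψi Q)] with ω h1 h2 h3
  rw [Metric.tendsto_atTop']
  intro ε hε
  have h4 := hlim.const_mul q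
  rw [mul_zero] at h4
  obtain ⟨Q, hQ⟩ := (h4.eventually_lt_const (show (0 : ℝ) < ε / 3 by linarith)).exists
  obtain ⟨n, hn⟩ := eventually_atTop.1 ((h3 Q (ε / 3) (by linarith)).and
    ((h1 Q).eventually_lt_const (show (0 : ℝ) < ε / 3 by linarith)))
  refine ⟨n, fun N hN => ?_⟩
  rw [Real.dist_eq, sub_zero, abs_of_nonneg (hx ω N)]
  have := hn N hN.le
  linarith [h2 Q N]

theorem iterate_ae {S : Ω → Ω} (hS : MeasurePreserving S μ μ) {P : Ω → Prop}
    (h : ∀ᵐ ω ∂μ, P ω) : ∀ᵐ ω ∂μ, ∀ k, P (S^[k] ω) :=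
  ae_all_iff.2 fun k => (hS.iterate k).quasiMeasurePreserving.ae h

theorem ae_cesaroNull_sub_of_ae_tendsto {τ : ℕ → ℕ} {q : ℝ} (hS : MeasurePreserving S μ μ)
    (hdom : DominatedTimes μ S τ q) {f : ℕ → Ω → ℝ} {g : Ω → ℝ} (hf : ∀ k, Measurable (f k))
    (hg : Measurable g) (hfb : ∀ k, ∀ᵐ ω ∂μ, |f k ω| ≤ 1) (hgb : ∀ᵐ ω ∂μ, |g ω| ≤ 1)
    (hlim : ∀ᵐ ω ∂μ, Tendsto (fun k => f k ω) atTop (𝓝 (g ω))) :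
    ∀ᵐ ω ∂μ, CesaroNull fun k => f k (S^[τ k] ω) - g (S^[τ k] ω) := by
  set e : ℕ → Ω → ℝ := fun k ω => min |f k ω - g ω| 2 with he
  have he0 : ∀ k ω, 0 ≤ e k ω := fun k ω => le_min (abs_nonneg _) (by norm_num)
  have he2 : ∀ k ω, e k ω ≤ 2 := fun k ω => min_le_right _ _
  have hem : ∀ k, Measurable (e k) := fun k => (((hf k).sub hg).abs).min measurable_const
  set ψ : ℕ → Ω → ℝ := fun K ω => ⨆ j, e (K + j) ω with hψ
  have hbdd : ∀ K ω, BddAbove (Set.range fun j => e (K + j) ω) := fun K ω =>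
    ⟨2, by rintro _ ⟨j, rfl⟩; exact he2 _ _⟩
  have hψm : ∀ K, Measurable (ψ K) := fun K => Measurable.iSup fun j => hem (K + j)
  have hψ0 : ∀ K ω, 0 ≤ ψ K ω := fun K ω => Real.iSup_nonneg fun j => he0 _ _
  have hψ2 : ∀ K ω, ψ K ω ≤ 2 := fun K ω => ciSup_le fun j => he2 _ _
  have hψb : ∀ K, ∀ᵐ ω ∂μ, ‖ψ K ω‖ ≤ 2 := fun K => ae_of_all _ fun ω => by
    rw [Real.norm_eq_abs, abs_of_nonneg (hψ0 K ω)]; exact hψ2 K ω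
  have hψi : ∀ K, Integrable (ψ K) μ := fun K =>
    Integrable.of_bound (hψm K).aestronglyMeasurable 2 (hψb K)
  have hψlim : Tendsto (fun K => ∫ ω, ψ K ω ∂μ) atTop (𝓝 0) := by
    rw [← integral_zero Ω ℝ (μ := μ)]
    refine tendsto_integral_of_dominated_convergence (fun _ => 2)
      (fun K => (hψm K).aestronglyMeasurable) (integrable_const _) hψb ?_
    filter_upwards [hlim] with ω hω
    rw [Metric.tendsto_atTop]
    intro ε hε
    obtain ⟨n, hn⟩ := Metric.tendsto_atTop.1 hω (ε / 2) (by linarith)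
    refine ⟨n, fun K hK => ?_⟩
    rw [Real.dist_eq, sub_zero, abs_of_nonneg (hψ0 K ω)]
    have : ψ K ω ≤ ε / 2 := ciSup_le fun j => (min_le_left _ _).trans (hn _ (by omega)).le
    linarith
  refine ae_tendsto_zero_of_dominatedTimes hdom
    (w := fun K _ => cavg fun k => |if k < K then (2 : ℝ) else 0|)
    (fun ω N => cavg_nonneg (fun _ => abs_nonneg _) N) (fun K => ae_of_all _ fun ω => ?_)
    hψm hψ0 hψi hψlim fun K => ?_
  · exact cesaroNull_of_eventually_zero (K := K) fun k hk => by simp [hk]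
  · filter_upwards [iterate_ae hS (ae_all_iff.2 hfb), iterate_ae hS hgb] with ω h1 h2 N
    rw [← cavg_add]
    refine cavg_mono (fun k => ?_) N
    have h3 : |f k (S^[τ k] ω) - g (S^[τ k] ω)| ≤ 2 :=
      (abs_sub _ _).trans (by linarith [h1 (τ k) k, h2 (τ k)])
    by_cases hk : k < K
    · simp only [hk, if_true]
      have := hψ0 K (S^[τ k] ω)
      rw [abs_of_nonneg (by norm_num : (0 : ℝ) ≤ 2)]
      linarith
    · simp only [hk, if_false, abs_zero, zero_add]
      push Not at hk
      have h4 := le_ciSup (hbdd K (S^[τ k] ω)) (k - K)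
      simp only [Nat.add_sub_cancel' hk] at h4
      simp only [he] at h4
      rw [min_eq_left h3] at h4
      exact h4

end Dominated

section Windows

variable {Λ Λ' : Type*} [MeasurableSpace Λ] [MeasurableSpace Λ']

/-- First coordinates in `s` and second coordinates in `t`. -/
@[reducible] def windowAlg (s t : Set ℤ) : MeasurableSpace (ℤ → Λ × Λ') := FalgZ s ⊔ GalgZ t

theorem shiftZ_iterate {A : Type*} (k : ℕ) (ω : ℤ → A) (z : ℤ) :
    shiftZ^[k] ω z = ω (z + k) := by
  induction k generalizing z with
  | zero => simp
  | succ k ih =>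
    rw [Function.iterate_succ_apply', shiftZ, ih]
    congr 1
    push_cast
    ring

theorem measurable_shiftZ {A : Type*} [MeasurableSpace A] :
    Measurable (shiftZ : (ℤ → A) → ℤ → A) :=
  measurable_pi_lambda _ fun _ => measurable_pi_apply _

theorem GalgZ_empty : (GalgZ ∅ : MeasurableSpace (ℤ → Λ × Λ')) = ⊥ := by simp [GalgZ]

theorem windowAlg_empty_right (s : Set ℤ) :
    (windowAlg s ∅ : MeasurableSpace (ℤ → Λ × Λ')) = FalgZ s := by
  rw [windowAlg, GalgZ_empty, sup_bot_eq]

theorem windowAlg_mono {s s' t t' : Set ℤ} (hs : s ⊆ s') (ht : t ⊆ t') :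
    (windowAlg s t : MeasurableSpace (ℤ → Λ × Λ')) ≤ windowAlg s' t' :=
  sup_le_sup (biSup_mono fun _ hr => hs hr) (biSup_mono fun _ hr => ht hr)

theorem windowAlg_le (s t : Set ℤ) :
    (windowAlg s t : MeasurableSpace (ℤ → Λ × Λ')) ≤ MeasurableSpace.pi :=
  sup_le (iSup₂_le fun r _ => ((measurable_fst.comp (measurable_pi_apply r))).comap_le)
    (iSup₂_le fun r _ => ((measurable_snd.comp (measurable_pi_apply r))).comap_le)

theorem windowAlg_sup (s s' t t' : Set ℤ) :
    (windowAlg s t ⊔ windowAlg s' t' : MeasurableSpace (ℤ → Λ × Λ')) =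
      windowAlg (s ∪ s') (t ∪ t') := by
  simp only [windowAlg, FalgZ, GalgZ, iSup_union]
  exact sup_sup_sup_comm _ _ _ _

theorem iSup_windowAlg (s t : ℕ → Set ℤ) :
    (⨆ k, windowAlg (s k) (t k) : MeasurableSpace (ℤ → Λ × Λ')) =
      windowAlg (⋃ k, s k) (⋃ k, t k) := by
  simp only [windowAlg, FalgZ, GalgZ, iSup_iUnion]
  exact iSup_sup_eq

theorem comap_shiftZ_windowAlg (k : ℕ) (s t : Set ℤ) :
    (windowAlg {z | z + k ∈ s} {z | z + k ∈ t} : MeasurableSpace (ℤ → Λ × Λ')).comap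
      (shiftZ^[k]) = windowAlg s t := by
  simp only [windowAlg, FalgZ, GalgZ, MeasurableSpace.comap_sup, MeasurableSpace.comap_iSup,
    MeasurableSpace.comap_comp]
  congr 1
  · refine le_antisymm (iSup₂_le fun r hr => le_iSup₂_of_le (r + k) hr ?_)
      (iSup₂_le fun r hr => le_iSup₂_of_le (r - k) (by simpa using hr) ?_)
    · simp [Function.comp_def, shiftZ_iterate]
    · simp [Function.comp_def, shiftZ_iterate]
  · refine le_antisymm (iSup₂_le fun r hr => le_iSup₂_of_le (r + k) hr ?_)
      (iSup₂_le fun r hr => le_iSup₂_of_le (r - k) (by simpa using hr) ?_)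
    · simp [Function.comp_def, shiftZ_iterate]
    · simp [Function.comp_def, shiftZ_iterate]

theorem measurable_shiftZ_iterate_windowAlg (k : ℕ) (s t : Set ℤ) :
    Measurable[windowAlg s t, windowAlg {z | z + k ∈ s} {z | z + k ∈ t}]
      (shiftZ^[k] : (ℤ → Λ × Λ') → ℤ → Λ × Λ') :=
  measurable_iff_comap_le.2 (comap_shiftZ_windowAlg k s t).le

theorem measurable_comp_shiftZ_windowAlg {X : (ℤ → Λ × Λ') → ℝ} {s t s' t' : Set ℤ} (k : ℕ)
    (hX : Measurable[windowAlg s t] X) (hs : ∀ z ∈ s, z + k ∈ s') (ht : ∀ z ∈ t, z + k ∈ t') :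
    Measurable[windowAlg s' t'] fun ω => X (shiftZ^[k] ω) :=
  (hX.mono (windowAlg_mono hs ht) le_rfl).comp (measurable_shiftZ_iterate_windowAlg k s' t')

variable {ν : Measure (ℤ → Λ × Λ')} [IsProbabilityMeasure ν]

theorem condExp_shiftZ (hS : MeasurePreserving shiftZ ν ν) {X : (ℤ → Λ × Λ') → ℝ}
    (hX : Integrable X ν) (k : ℕ) (s t : Set ℤ) :
    ν[fun ω => X (shiftZ^[k] ω)|windowAlg s t] =ᵐ[ν]
      fun ω => (ν[X|windowAlg {z | z + k ∈ s} {z | z + k ∈ t}]) (shiftZ^[k] ω) := by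
  have h := condExp_comp_measurePreserving (hS.iterate k)
    (windowAlg_le {z | z + k ∈ s} {z | z + k ∈ t}) hX
  rw [comap_shiftZ_windowAlg] at h
  exact h.symm

theorem ae_cesaroNull_condExp_sub (hS : MeasurePreserving shiftZ ν ν) {τ : ℕ → ℕ} {q : ℝ}
    (hdom : DominatedTimes ν shiftZ τ q) {X : (ℤ → Λ × Λ') → ℝ} (hX : Measurable X)
    (hXb : ∀ ω, |X ω| ≤ 1) {s' t' : ℕ → Set ℤ} {s t : Set ℤ}
    (hs : Monotone fun k => {z : ℤ | z + τ k ∈ s' k})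
    (ht : Monotone fun k => {z : ℤ | z + τ k ∈ t' k})
    (hsU : ⋃ k, {z : ℤ | z + τ k ∈ s' k} = s) (htU : ⋃ k, {z : ℤ | z + τ k ∈ t' k} = t) :
    ∀ᵐ ω ∂ν, CesaroNull fun k =>
      (ν[fun ω => X (shiftZ^[τ k] ω)|windowAlg (s' k) (t' k)]) ω -
        (ν[X|windowAlg s t]) (shiftZ^[τ k] ω) := by
  have hXi : Integrable X ν := Integrable.of_bound hX.aestronglyMeasurable 1
    (ae_of_all _ (by simpa using hXb))
  set m : ℕ → MeasurableSpace (ℤ → Λ × Λ') := fun k =>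
    windowAlg {z : ℤ | z + τ k ∈ s' k} {z : ℤ | z + τ k ∈ t' k} with hm
  have hmono : Monotone m := fun i j hij => windowAlg_mono (hs hij) (ht hij)
  have hle : ∀ k, m k ≤ MeasurableSpace.pi := fun k => windowAlg_le _ _
  have hsup : ⨆ k, m k = windowAlg s t := by rw [hm, iSup_windowAlg, hsU, htU]
  have hlim := tendsto_ae_condExp (μ := ν) (ℱ := ⟨m, hmono, hle⟩) X
  have h1 := ae_cesaroNull_sub_of_ae_tendsto hS hdom (f := fun k => ν[X|m k])
    (g := ν[X|windowAlg s t])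
    (fun k => stronglyMeasurable_condExp.measurable.mono (hle k) le_rfl)
    (stronglyMeasurable_condExp.measurable.mono (windowAlg_le _ _) le_rfl)
    (fun k => ae_abs_condExp_le (ae_of_all _ hXb)) (ae_abs_condExp_le (ae_of_all _ hXb))
    (by rw [← hsup]; exact hlim)
  filter_upwards [h1, ae_all_iff.2 fun k => condExp_shiftZ hS hXi (τ k) (s' k) (t' k)]
    with ω h2 h3
  simpa only [h3] using h2

end Windows

theorem integral_abs_condExp_sub_le {Ω : Type*} {m m' m0 : MeasurableSpace Ω} {μ : Measure Ω}
    [IsProbabilityMeasure μ] (hmm' : m ≤ m') (hm' : m' ≤ m0) (X : Ω → ℝ) {g : Ω → ℝ}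
    (hg : StronglyMeasurable[m] g) (hgi : Integrable g μ) :
    ∫ ω, |(μ[X|m]) ω - g ω| ∂μ ≤ ∫ ω, |(μ[X|m']) ω - g ω| ∂μ := by
  have h3 : μ[μ[X|m'] - g|m] =ᵐ[μ] μ[X|m] - g := by
    refine (condExp_sub integrable_condExp hgi m).trans ?_
    refine EventuallyEq.sub (condExp_condExp_of_le hmm' hm') ?_
    rw [condExp_of_stronglyMeasurable (hmm'.trans hm') hg hgi]
  refine le_trans (le_of_eq (integral_congr_ae ?_)) (integral_abs_condExp_le (m := m) (μ[X|m'] - g))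
  filter_upwards [h3] with ω h4
  rw [h4]
  rfl

theorem integral_comp_of_measurePreserving {Ω Ω' : Type*} [MeasurableSpace Ω]
    [MeasurableSpace Ω'] {μ : Measure Ω} {μ' : Measure Ω'} {T : Ω → Ω'}
    (hT : MeasurePreserving T μ μ') {f : Ω' → ℝ} (hf : AEStronglyMeasurable f μ') :
    ∫ ω, f (T ω) ∂μ = ∫ ω, f ω ∂μ' := by
  rw [← hT.map_eq] at hf ⊢
  exact (integral_map hT.measurable.aemeasurable hf).symm

section Merging

variable {Λ Λ' : Type*} [MeasurableSpace Λ] [MeasurableSpace Λ']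

/-- The coordinates of index `≤ 0`, read backwards. -/
def pastZ {A : Type*} (ω : ℤ → A) : ℕ → A := fun j => ω (-(j : ℤ))

/-- The coordinates of index `≥ 1`. -/
def futureZ {A : Type*} (ω : ℤ → A) : ℕ → A := fun j => ω ((j : ℤ) + 1)

theorem measurable_pastZ {A : Type*} [MeasurableSpace A] :
    Measurable (pastZ : (ℤ → A) → ℕ → A) :=
  measurable_pi_lambda _ fun _ => measurable_pi_apply _

theorem measurable_futureZ {A : Type*} [MeasurableSpace A] :
    Measurable (futureZ : (ℤ → A) → ℕ → A) :=
  measurable_pi_lambda _ fun _ => measurable_pi_apply _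

theorem futureZ_shiftZ_iterate {A : Type*} (k : ℕ) (ω : ℤ → A) (j : ℕ) :
    futureZ (shiftZ^[k] ω) j = futureZ ω (j + k) := by
  simp only [futureZ, shiftZ_iterate]
  congr 1
  push_cast
  ring

theorem comap_pastZ : (MeasurableSpace.pi : MeasurableSpace (ℕ → Λ × Λ')).comap pastZ =
    windowAlg (Set.Iic 0) (Set.Iic 0) := by
  simp only [MeasurableSpace.pi, Prod.instMeasurableSpace, MeasurableSpace.prod, windowAlg, FalgZ,
    GalgZ, MeasurableSpace.comap_sup, MeasurableSpace.comap_iSup, MeasurableSpace.comap_comp,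
    iSup_sup_eq]
  congr 1
  · refine le_antisymm (iSup_le fun j => le_iSup₂_of_le (-(j : ℤ)) (by simp) le_rfl)
      (iSup₂_le fun r hr => le_iSup_of_le (-r).toNat ?_)
    have : -((-r).toNat : ℤ) = r := by
      rw [Set.mem_Iic] at hr
      omega
    simp only [Function.comp_def, pastZ, this, le_refl]
  · refine le_antisymm (iSup_le fun j => le_iSup₂_of_le (-(j : ℤ)) (by simp) le_rfl)
      (iSup₂_le fun r hr => le_iSup_of_le (-r).toNat ?_)
    have : -((-r).toNat : ℤ) = r := by
      rw [Set.mem_Iic] at hr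
      omega
    simp only [Function.comp_def, pastZ, this, le_refl]

theorem comap_futureZ_fst (k : ℕ) :
    (⨆ r ∈ Set.Iio k, (inferInstance : MeasurableSpace Λ).comap fun x : ℕ → Λ => x r).comap
      (fun (ω : ℤ → Λ × Λ') j => (futureZ ω j).1) = windowAlg (Set.Icc 1 (k : ℤ)) ∅ := by
  rw [windowAlg_empty_right]
  simp only [MeasurableSpace.comap_iSup, MeasurableSpace.comap_comp, FalgZ]
  refine le_antisymm (iSup₂_le fun r hr => le_iSup₂_of_le ((r : ℤ) + 1) ?_ le_rfl)
    (iSup₂_le fun r hr => le_iSup₂_of_le (r - 1).toNat ?_ ?_)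
  · rw [Set.mem_Iio] at hr
    rw [Set.mem_Icc]
    omega
  · rw [Set.mem_Icc] at hr
    rw [Set.mem_Iio]
    omega
  · have : ((r - 1).toNat : ℤ) + 1 = r := by
      rw [Set.mem_Icc] at hr
      omega
    simp only [Function.comp_def, futureZ, this, le_refl]

variable {ν : Measure (ℤ → Λ × Λ')} [IsProbabilityMeasure ν]

theorem tendsto_integral_abs_condExp_window_sub (hS : MeasurePreserving shiftZ ν ν)
    (hac : ν.map (fun ω => (pastZ ω, futureZ ω)) ≪ (ν.map pastZ).prod (ν.map futureZ))
    {X : (ℤ → Λ × Λ') → ℝ} {w : ℕ} (hX : Measurable[windowAlg (Set.Icc 1 (w : ℤ)) ∅] X)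
    (hXb : ∀ ω, |X ω| ≤ 1) :
    Tendsto (fun Q : ℕ => ∫ ω, |(ν[X|windowAlg (Set.Iic 0) (Set.Iic (-(Q : ℤ)))]) ω -
      (ν[X|windowAlg (Set.Iic 0) ∅]) ω| ∂ν) atTop (𝓝 0) := by
  have hXm : Measurable X := hX.mono (windowAlg_le _ _) le_rfl
  have hXi : Integrable X ν := Integrable.of_bound hXm.aestronglyMeasurable 1
    (ae_of_all _ (by simpa using hXb))
  set f : (ℤ → Λ × Λ') → ℕ → Λ := fun ω j => (futureZ ω j).1 with hf
  set H : ℕ → MeasurableSpace (ℕ → Λ) := fun k =>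
    ⨆ r ∈ Set.Iio k, (inferInstance : MeasurableSpace Λ).comap fun x : ℕ → Λ => x r with hH
  have hfm : Measurable f := measurable_pi_lambda _ fun _ =>
    measurable_fst.comp (measurable_pi_apply _)
  have hHle : ∀ k, H k ≤ MeasurableSpace.pi := fun k =>
    iSup₂_le fun r _ => (measurable_pi_apply r).comap_le
  have hHmono : Monotone H := fun i j hij => biSup_mono fun r hr => lt_of_lt_of_le hr hij
  have hHsup : ⨆ k, H k = MeasurableSpace.pi :=
    le_antisymm (iSup_le hHle) (iSup_le fun r => le_iSup_of_le (r + 1)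
      (le_iSup₂_of_le r (by simp) le_rfl))
  have hXf : Measurable[MeasurableSpace.pi.comap f] X := by
    refine hX.mono ?_ le_rfl
    rw [← comap_futureZ_fst]
    exact MeasurableSpace.comap_mono (hHle w)
  obtain ⟨Z, hZm, hZ⟩ := hXf.exists_eq_measurable_comp
  set Z' : (ℕ → Λ) → ℝ := fun x => max (-1) (min 1 (Z x)) with hZ'
  have hZ'm : Measurable Z' := measurable_const.max (measurable_const.min hZm)
  have hZ'b : ∀ x, |Z' x| ≤ 1 := fun x => abs_le.2 ⟨le_max_left _ _,
    max_le (by norm_num) (min_le_left _ _)⟩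
  have hXZ : ∀ ω, X ω = Z' (f ω) := fun ω => by
    have h1 := abs_le.1 (hXb ω)
    have h2 : X ω = Z (f ω) := congrFun hZ ω
    simp only [hZ']
    rw [← h2, min_eq_right h1.2, max_eq_right h1.1]
  have hac' : ν.map (fun ω => (pastZ ω, f ω)) ≪ (ν.map pastZ).prod (ν.map f) := by
    have hg : Measurable fun (x : ℕ → Λ × Λ') j => (x j).1 := measurable_pi_lambda _ fun _ =>
      measurable_fst.comp (measurable_pi_apply _)
    have h1 := hac.map (measurable_id.prodMap hg)
    rw [Measure.map_map (measurable_id.prodMap hg) (measurable_pastZ.prodMk measurable_futureZ)]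
      at h1
    rw [← Measure.map_prod_map _ _ measurable_id hg, Measure.map_id,
      Measure.map_map hg measurable_futureZ] at h1
    exact h1
  have key := tendsto_integral_abs_condExp_sup_sub measurable_pastZ hfm hac' hHle hHmono hHsup
    (X := fun k x => Z' fun j => x (j + k))
    (fun k => hZ'm.comp (measurable_pi_lambda _ fun _ => measurable_pi_apply _))
    (fun k x => hZ'b _)
  have hXk : ∀ k : ℕ, (fun ω => Z' fun j => f ω (j + k)) = fun ω => X (shiftZ^[k] ω) := by
    intro k
    ext ω
    rw [hXZ]
    congr 1
    ext j
    rw [hf]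
    simp only [futureZ_shiftZ_iterate]
  have hset : ∀ k : ℕ, (windowAlg (Set.Iic 0) (Set.Iic 0) ⊔ windowAlg (Set.Icc 1 (k : ℤ)) ∅ :
      MeasurableSpace (ℤ → Λ × Λ')) = windowAlg (Set.Iic (k : ℤ)) (Set.Iic 0) := by
    intro k
    rw [windowAlg_sup, Set.union_empty]
    congr 2
    ext z
    simp only [Set.mem_union, Set.mem_Iic, Set.mem_Icc]
    omega
  have key' : Tendsto (fun k : ℕ => ∫ ω, |(ν[fun ω => X (shiftZ^[k] ω)|windowAlg (Set.Iic (k : ℤ))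
      (Set.Iic 0)]) ω - (ν[fun ω => X (shiftZ^[k] ω)|windowAlg (Set.Icc 1 (k : ℤ)) ∅]) ω| ∂ν)
      atTop (𝓝 0) := by
    refine key.congr fun k => ?_
    rw [hXk k, comap_pastZ, hH, hf, comap_futureZ_fst, hset]
  refine squeeze_zero (fun Q => integral_nonneg fun _ => abs_nonneg _) (fun Q => ?_)
    (by simpa only [mul_zero] using key'.const_mul 2)
  set XQ : (ℤ → Λ × Λ') → ℝ := fun ω => X (shiftZ^[Q] ω) with hXQ
  have hA := condExp_shiftZ hS hXi Q (Set.Iic (Q : ℤ)) (Set.Iic 0)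
  have hD := condExp_shiftZ hS hXi Q (Set.Iic (Q : ℤ)) ∅
  have e1 : {z : ℤ | z + Q ∈ Set.Iic (Q : ℤ)} = Set.Iic 0 := by
    ext z
    simp
  have e2 : {z : ℤ | z + Q ∈ Set.Iic (0 : ℤ)} = Set.Iic (-(Q : ℤ)) := by
    ext z
    simp only [Set.mem_Iic, Set.mem_ofPred_eq]
    omega
  have e3 : {z : ℤ | z + Q ∈ (∅ : Set ℤ)} = ∅ := by simp
  rw [e1, e2] at hA
  rw [e1, e3] at hD
  set γ := ν[X|windowAlg (Set.Iic 0) (Set.Iic (-(Q : ℤ)))] with hγ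
  set g := ν[X|windowAlg (Set.Iic 0) ∅] with hg
  have hsub : Integrable (fun ω => |γ ω - g ω|) ν :=
    (integrable_condExp.sub integrable_condExp).abs
  have h1 : ∫ ω, |γ ω - g ω| ∂ν = ∫ ω, |(ν[XQ|windowAlg (Set.Iic (Q : ℤ)) (Set.Iic 0)]) ω -
      (ν[XQ|windowAlg (Set.Iic (Q : ℤ)) ∅]) ω| ∂ν := by
    rw [← integral_comp_of_measurePreserving (hS.iterate Q) hsub.aestronglyMeasurable]
    refine integral_congr_ae ?_
    filter_upwards [hA, hD] with ω h1 h2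
    rw [h1, h2]
  set mA : MeasurableSpace (ℤ → Λ × Λ') := windowAlg (Set.Iic (Q : ℤ)) (Set.Iic 0) with hmA
  set mB : MeasurableSpace (ℤ → Λ × Λ') := windowAlg (Set.Icc 1 (Q : ℤ)) ∅ with hmB
  set mD : MeasurableSpace (ℤ → Λ × Λ') := windowAlg (Set.Iic (Q : ℤ)) ∅ with hmD
  have hDA : mD ≤ mA := windowAlg_mono le_rfl (Set.empty_subset _)
  have hBD : mB ≤ mD := windowAlg_mono Set.Icc_subset_Iic_self le_rfl
  have h2 : ∫ ω, |(ν[XQ|mD]) ω - (ν[XQ|mB]) ω| ∂ν ≤ ∫ ω, |(ν[XQ|mA]) ω - (ν[XQ|mB]) ω| ∂ν := 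
    integral_abs_condExp_sub_le hDA (windowAlg_le _ _) XQ (stronglyMeasurable_condExp.mono hBD)
      integrable_condExp
  have iA : Integrable (ν[XQ|mA]) ν := integrable_condExp
  have iB : Integrable (ν[XQ|mB]) ν := integrable_condExp
  have iD : Integrable (ν[XQ|mD]) ν := integrable_condExp
  rw [h1, two_mul]
  refine le_trans ?_ (add_le_add_right h2 (∫ ω, |(ν[XQ|mA]) ω - (ν[XQ|mB]) ω| ∂ν))
  refine (integral_mono (iA.sub iD).abs ((iA.sub iB).abs.add (iD.sub iB).abs) fun ω => ?_).trans_eq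
    (integral_add (iA.sub iB).abs (iD.sub iB).abs)
  have := abs_sub_le ((ν[XQ|mA]) ω) ((ν[XQ|mB]) ω) ((ν[XQ|mD]) ω)
  rw [abs_sub_comm ((ν[XQ|mB]) ω)] at this
  exact this

theorem condExp_iInf_window_ae_eq (hS : MeasurePreserving shiftZ ν ν)
    (hac : ν.map (fun ω => (pastZ ω, futureZ ω)) ≪ (ν.map pastZ).prod (ν.map futureZ))
    {X : (ℤ → Λ × Λ') → ℝ} {w : ℕ} (hX : Measurable[windowAlg (Set.Icc 1 (w : ℤ)) ∅] X)
    (hXb : ∀ ω, |X ω| ≤ 1) :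
    ν[X|⨅ (k : ℕ) (_ : 1 ≤ k), windowAlg (Set.Iic 0) (Set.Iic (-(k : ℤ)))] =ᵐ[ν]
      ν[X|windowAlg (Set.Iic 0) ∅] := by
  set mT : MeasurableSpace (ℤ → Λ × Λ') :=
    ⨅ (k : ℕ) (_ : 1 ≤ k), windowAlg (Set.Iic 0) (Set.Iic (-(k : ℤ))) with hmT
  set g := ν[X|windowAlg (Set.Iic 0) ∅] with hg
  have hle1 : ∀ k : ℕ, 1 ≤ k → mT ≤ windowAlg (Set.Iic 0) (Set.Iic (-(k : ℤ))) := fun k hk =>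
    iInf₂_le k hk
  have hTle : mT ≤ MeasurableSpace.pi := (hle1 1 le_rfl).trans (windowAlg_le _ _)
  have hgT : StronglyMeasurable[mT] g := stronglyMeasurable_condExp.mono
    (le_iInf₂ fun k _ => windowAlg_mono le_rfl (Set.empty_subset _))
  have hgi : Integrable g ν := integrable_condExp
  have key := tendsto_integral_abs_condExp_window_sub hS hac hX hXb
  have hbound : ∫ ω, |(ν[X|mT]) ω - g ω| ∂ν ≤ 0 := by
    refine ge_of_tendsto key ?_
    filter_upwards [eventually_ge_atTop 1] with Q hQ
    exact integral_abs_condExp_sub_le (hle1 Q hQ) (windowAlg_le _ _) X hgT hgi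
  have hzero := (integral_eq_zero_iff_of_nonneg (fun _ => abs_nonneg _)
    ((integrable_condExp (m := mT) (f := X)).sub hgi).abs).1
    (le_antisymm hbound (integral_nonneg fun _ => abs_nonneg _))
  filter_upwards [hzero] with ω h
  exact sub_eq_zero.1 (abs_eq_zero.1 h)

end Merging

/-- Times growing by at most one at each step, such that both the times and their delays are
unbounded, and which do not stay constant for longer than a fixed time. -/
structure IsSlowTime (l : ℕ → ℕ) : Prop where
  zero : l 0 = 0
  mono : Monotone l
  succ_le : ∀ k, l (k + 1) ≤ l k + 1
  tendsto : Tendsto l atTop atTop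
  delay : Tendsto (fun k => k - l k) atTop atTop
  exists_lt : ∃ q, ∀ k, l k < l (k + q)

namespace IsSlowTime

variable {l : ℕ → ℕ}

theorem add_le (hl : IsSlowTime l) (k i : ℕ) : l (k + i) ≤ l k + i := by
  induction i with
  | zero => simp
  | succ i ih =>
    have := hl.succ_le (k + i)
    rw [← add_assoc]
    omega

theorem le_self (hl : IsSlowTime l) (k : ℕ) : l k ≤ k := by
  have := hl.add_le 0 k
  rw [hl.zero] at this
  simpa using this

theorem sub_mono (hl : IsSlowTime l) {i j : ℕ} (hij : i ≤ j) : (i : ℤ) - l i ≤ j - l j := by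
  obtain ⟨k, rfl⟩ := Nat.exists_eq_add_of_le hij
  have := hl.add_le i k
  omega

theorem exists_add_le (hl : IsSlowTime l) (n : ℕ) : ∃ s, ∀ k, l k + n ≤ l (k + s) := by
  obtain ⟨q, hq⟩ := hl.exists_lt
  refine ⟨q * n, fun k => ?_⟩
  induction n with
  | zero => simp
  | succ n ih =>
    have := hq (k + q * n)
    rw [Nat.mul_succ, ← add_assoc k]
    omega

theorem dominatedTimes (hl : IsSlowTime l) {Ω : Type*} [MeasurableSpace Ω] {μ : Measure Ω}
    [IsProbabilityMeasure μ] {S : Ω → Ω} (hS : Ergodic S μ) :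
    ∃ q, DominatedTimes μ S l q := by
  obtain ⟨q, hq⟩ := hl.exists_lt
  exact ⟨q, hS.dominatedTimes hl.mono hl.le_self hq⟩

theorem exists_forall_le_sub (hl : IsSlowTime l) (n : ℕ) : ∃ k₀, ∀ k ≥ k₀, l k + n ≤ k := by
  obtain ⟨k₀, hk⟩ := eventually_atTop.1 (hl.delay.eventually_ge_atTop n)
  refine ⟨k₀, fun k hk' => ?_⟩
  have := hk k hk'
  have := hl.le_self k
  omega

end IsSlowTime

section Decoupling

variable {Λ Λ' : Type*} [MeasurableSpace Λ] [MeasurableSpace Λ']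
  {ν : Measure (ℤ → Λ × Λ')} [IsProbabilityMeasure ν] {l : ℕ → ℕ}

/-- Given both pasts, the events seen by the first coordinate from time `k` and by the second
coordinate from time `l k` decouple on average. -/
theorem ae_cesaroNull_condExp_mul_sub (hS : Ergodic shiftZ ν)
    (hac : ν.map (fun ω => (pastZ ω, futureZ ω)) ≪ (ν.map pastZ).prod (ν.map futureZ))
    (hl : IsSlowTime l) {X B : (ℤ → Λ × Λ') → ℝ} {w w' : ℕ}
    (hX : Measurable[windowAlg (Set.Icc 1 (w : ℤ)) ∅] X) (hXb : ∀ ω, |X ω| ≤ 1)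
    (hB : Measurable[windowAlg ∅ (Set.Icc 1 (w' : ℤ))] B) (hBb : ∀ ω, |B ω| ≤ 1) :
    ∀ᵐ ω ∂ν, CesaroNull fun k =>
      (ν[fun ω => X (shiftZ^[k] ω) * B (shiftZ^[l k] ω)|
        windowAlg (Set.Icc 1 (k : ℤ)) (Set.Icc 1 (l k : ℤ))]) ω -
      (ν[X|windowAlg (Set.Iic 0) ∅]) (shiftZ^[k] ω) *
        (ν[B|windowAlg Set.univ (Set.Iic 0)]) (shiftZ^[l k] ω) := by
  have hMP := hS.toMeasurePreserving
  have hXm : Measurable X := hX.mono (windowAlg_le _ _) le_rfl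
  have hBm : Measurable B := hB.mono (windowAlg_le _ _) le_rfl
  obtain ⟨q, hdom⟩ := hl.dominatedTimes hS
  have hdom1 := hS.dominatedTimes_id
  set H : ℕ → MeasurableSpace (ℤ → Λ × Λ') := fun k =>
    windowAlg (Set.Icc 1 (k : ℤ)) (Set.Icc 1 (l k : ℤ)) with hH
  have hHle : ∀ k, H k ≤ MeasurableSpace.pi := fun k => windowAlg_le _ _
  have hHmono : Monotone H := fun i j hij => windowAlg_mono
    (Set.Icc_subset_Icc_right (by exact_mod_cast hij))
    (Set.Icc_subset_Icc_right (by exact_mod_cast hl.mono hij))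
  set Xk : ℕ → (ℤ → Λ × Λ') → ℝ := fun k ω => X (shiftZ^[k] ω) with hXk
  set Bk : ℕ → (ℤ → Λ × Λ') → ℝ := fun k ω => B (shiftZ^[l k] ω) with hBk
  have hXkm : ∀ k : ℕ, Measurable[windowAlg (Set.Icc (1 + (k : ℤ)) (w + k)) ∅] (Xk k) := fun k =>
    measurable_comp_shiftZ_windowAlg k hX (fun z hz => by
      simp only [Set.mem_Icc] at hz ⊢
      omega) (by simp)
  have hBkm : ∀ k : ℕ, Measurable[windowAlg ∅ (Set.Icc (1 + (l k : ℤ)) (w' + l k))] (Bk k) := fun k =>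
    measurable_comp_shiftZ_windowAlg (l k) hB (by simp) (fun z hz => by
      simp only [Set.mem_Icc] at hz ⊢
      omega)
  set h : ℕ → (ℤ → Λ × Λ') → ℝ := fun k => ν[fun ω => Xk k ω * Bk k ω|H k] with hh
  set e : ℕ → (ℤ → Λ × Λ') → ℝ := fun k => ν[Bk k|H k] with he
  set φ : ℕ → (ℤ → Λ × Λ') → ℝ := fun k => ν[Xk k|windowAlg (Set.Icc 1 (k : ℤ)) ∅] with hφ
  set g := ν[X|windowAlg (Set.Iic 0) ∅] with hg
  set f := ν[B|windowAlg Set.univ (Set.Iic 0)] with hf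
  set γ : ℕ → (ℤ → Λ × Λ') → ℝ := fun Q =>
    ν[X|windowAlg (Set.Iic 0) (Set.Iic (-(Q : ℤ)))] with hγ
  have hXBb : ∀ k ω, |Xk k ω * Bk k ω| ≤ 1 := fun k ω => by
    rw [abs_mul]
    exact mul_le_one₀ (hXb _) (abs_nonneg _) (hBb _)
  have hhb : ∀ᵐ ω ∂ν, ∀ k, |h k ω| ≤ 1 := ae_all_iff.2 fun k =>
    ae_abs_condExp_le (ae_of_all _ (hXBb k))
  have heb : ∀ᵐ ω ∂ν, ∀ k, |e k ω| ≤ 1 := ae_all_iff.2 fun k =>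
    ae_abs_condExp_le (ae_of_all _ fun ω => hBb _)
  have hφb : ∀ᵐ ω ∂ν, ∀ k, |φ k ω| ≤ 1 := ae_all_iff.2 fun k =>
    ae_abs_condExp_le (ae_of_all _ fun ω => hXb _)
  have hgb : ∀ᵐ ω ∂ν, |g ω| ≤ 1 := ae_abs_condExp_le (ae_of_all _ hXb)
  have hφg : ∀ᵐ ω ∂ν, CesaroNull fun k => φ k ω - g (shiftZ^[k] ω) := by
    refine ae_cesaroNull_condExp_sub hMP hdom1 hXm hXb (s' := fun k => Set.Icc 1 (k : ℤ))
      (t' := fun _ => ∅) (s := Set.Iic 0) (t := ∅) ?_ (fun i j _ => le_rfl) ?_ (by simp)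
    · intro i j hij z hz
      simp only [Set.mem_Icc, Set.mem_ofPred_eq] at hz ⊢
      omega
    · ext z
      simp only [Set.mem_iUnion, Set.mem_Icc, Set.mem_ofPred_eq, Set.mem_Iic]
      exact ⟨fun ⟨k, hk⟩ => by omega, fun hz => ⟨(1 - z).toNat, by omega⟩⟩
  have hef : ∀ᵐ ω ∂ν, CesaroNull fun k => e k ω - f (shiftZ^[l k] ω) := by
    refine ae_cesaroNull_condExp_sub hMP hdom hBm hBb (s' := fun k => Set.Icc 1 (k : ℤ))
      (t' := fun k => Set.Icc 1 (l k : ℤ)) (s := Set.univ) (t := Set.Iic 0) ?_ ?_ ?_ ?_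
    · intro i j hij z hz
      have h1 := hl.sub_mono hij
      have h2 := hl.mono hij
      simp only [Set.mem_Icc, Set.mem_ofPred_eq] at hz ⊢
      omega
    · intro i j hij z hz
      have h2 := hl.mono hij
      simp only [Set.mem_Icc, Set.mem_ofPred_eq] at hz ⊢
      omega
    · refine Set.eq_univ_of_forall fun z => Set.mem_iUnion.2 ?_
      obtain ⟨k₀, hk₀⟩ := hl.exists_forall_le_sub z.toNat
      obtain ⟨k, hk, hk'⟩ := ((eventually_ge_atTop k₀).and
        (hl.tendsto.eventually_ge_atTop (1 - z).toNat)).exists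
      have := hk₀ k hk
      refine ⟨k, ?_⟩
      simp only [Set.mem_Icc, Set.mem_ofPred_eq]
      omega
    · ext z
      simp only [Set.mem_iUnion, Set.mem_Icc, Set.mem_ofPred_eq, Set.mem_Iic]
      refine ⟨fun ⟨k, hk⟩ => by omega, fun hz => ?_⟩
      obtain ⟨k, hk⟩ := (hl.tendsto.eventually_ge_atTop (1 - z).toNat).exists
      exact ⟨k, by omega⟩
  set v : ℕ → (ℤ → Λ × Λ') → ℝ := fun k ω => (h k ω - φ k ω * e k ω) / 2 with hv
  have hvb : ∀ᵐ ω ∂ν, ∀ k, |v k ω| ≤ 1 := by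
    filter_upwards [hhb, heb, hφb] with ω h1 h2 h3 k
    have h4 : |φ k ω * e k ω| ≤ 1 := by
      rw [abs_mul]
      exact mul_le_one₀ (h3 k) (abs_nonneg _) (h2 k)
    have h5 := abs_sub (h k ω) (φ k ω * e k ω)
    rw [hv, abs_div, abs_two]
    linarith [h1 k]
  have hφm : ∀ k, StronglyMeasurable[H k] (φ k) := fun k =>
    stronglyMeasurable_condExp.mono (windowAlg_mono le_rfl (Set.empty_subset _))
  have hvm : ∀ k, StronglyMeasurable[H k] (v k) := fun k =>
    ((stronglyMeasurable_condExp.sub ((hφm k).mul stronglyMeasurable_condExp))).div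
      stronglyMeasurable_const
  obtain ⟨s₀, hs₀⟩ := hl.exists_add_le w'
  set s := s₀ + w with hs
  have hls : ∀ k, l k + w' ≤ l (k + s) := fun k => (hs₀ k).trans (hl.mono (by omega))
  have hXs : ∀ k, StronglyMeasurable[H (k + s)] (Xk k) := fun k =>
    ((hXkm k).mono (windowAlg_mono (fun z hz => by
      simp only [Set.mem_Icc] at hz ⊢
      push_cast
      omega) (Set.empty_subset _)) le_rfl).stronglyMeasurable
  have hBs : ∀ k, StronglyMeasurable[H (k + s)] (Bk k) := fun k =>
    ((hBkm k).mono (windowAlg_mono (Set.empty_subset _) (fun z hz => by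
      have := hls k
      simp only [Set.mem_Icc] at hz ⊢
      omega)) le_rfl).stronglyMeasurable
  have t1 : ∀ᵐ ω ∂ν, Tendsto (cavg fun k => (Xk k ω * Bk k ω - h k ω) * v k ω) atTop (𝓝 0) :=
    ae_tendsto_cavg_sub_condExp hHle hHmono s 0 (fun k => (hXs k).mul (hBs k))
      (fun k => ae_of_all _ (hXBb k)) (fun k _ => hvm k) (ae_all_iff.1 hvb)
  have t2 : ∀ᵐ ω ∂ν, Tendsto (cavg fun k => (Bk k ω - e k ω) * (φ k ω * v k ω)) atTop (𝓝 0) :=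
    ae_tendsto_cavg_sub_condExp hHle hHmono s 0 hBs
      (fun k => ae_of_all _ fun ω => hBb _) (fun k _ => (hφm k).mul (hvm k)) (by
        refine ae_all_iff.1 ?_
        filter_upwards [hφb, hvb] with ω h1 h2 k
        rw [abs_mul]
        exact mul_le_one₀ (h1 k) (abs_nonneg _) (h2 k))
  have t3 : ∀ Q : ℕ, ∀ᵐ ω ∂ν, Tendsto (cavg fun k => (Xk k ω - γ Q (shiftZ^[k] ω)) *
      (Bk k ω * v k ω)) atTop (𝓝 0) := by
    intro Q
    obtain ⟨k₀, hk₀⟩ := hl.exists_forall_le_sub (w' + Q)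
    have h1 := ae_tendsto_cavg_sub_condExp (μ := ν)
      (H := fun k : ℕ => windowAlg (Set.Iic (k : ℤ)) (Set.Iic (k - Q : ℤ)))
      (fun k => windowAlg_le _ _)
      (fun i j hij => windowAlg_mono (Set.Iic_subset_Iic.2 (by omega))
        (Set.Iic_subset_Iic.2 (by omega))) (Y := Xk) (V := fun k ω => Bk k ω * v k ω) w k₀
      (fun k => ((hXkm k).mono (windowAlg_mono (fun z hz => by
        simp only [Set.mem_Icc, Set.mem_Iic] at hz ⊢
        push_cast
        omega) (Set.empty_subset _)) le_rfl).stronglyMeasurable)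
      (fun k => ae_of_all _ fun ω => hXb _)
      (fun k hk => by
        have hk1 := hk₀ k hk
        refine StronglyMeasurable.mul ?_ ?_
        · refine ((hBkm k).mono (windowAlg_mono (Set.empty_subset _) fun z hz => ?_)
            le_rfl).stronglyMeasurable
          simp only [Set.mem_Icc, Set.mem_Iic] at hz ⊢
          omega
        · refine (hvm k).mono (windowAlg_mono Set.Icc_subset_Iic_self fun z hz => ?_)
          simp only [Set.mem_Icc, Set.mem_Iic] at hz ⊢
          omega)
      (by
        refine ae_all_iff.1 ?_
        filter_upwards [hvb] with ω h2 k
        rw [abs_mul]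
        exact mul_le_one₀ (hBb _) (abs_nonneg _) (h2 k))
    have hXi : Integrable X ν := Integrable.of_bound hXm.aestronglyMeasurable 1
      (ae_of_all _ (by simpa using hXb))
    have h2 : ∀ᵐ ω ∂ν, ∀ k : ℕ, (ν[Xk k|windowAlg (Set.Iic (k : ℤ)) (Set.Iic (k - Q : ℤ))]) ω =
        γ Q (shiftZ^[k] ω) := ae_all_iff.2 fun k => by
      have h3 := condExp_shiftZ hMP hXi k (Set.Iic (k : ℤ)) (Set.Iic (k - Q : ℤ))
      have e1 : {z : ℤ | z + k ∈ Set.Iic (k : ℤ)} = Set.Iic 0 := by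
        ext z
        simp
      have e2 : {z : ℤ | z + k ∈ Set.Iic (k - Q : ℤ)} = Set.Iic (-(Q : ℤ)) := by
        ext z
        simp only [Set.mem_Iic, Set.mem_ofPred_eq]
        omega
      rw [e1, e2] at h3
      exact h3
    filter_upwards [h1, h2] with ω h3 h4
    simpa only [h4] using h3
  have hsq : ∀ᵐ ω ∂ν, Tendsto (cavg fun k => 2 * v k ω ^ 2) atTop (𝓝 0) := by
    refine ae_tendsto_zero_of_dominatedTimes hdom1
      (x := fun ω => cavg fun k => 2 * v k ω ^ 2)
      (fun ω N => cavg_nonneg (fun k => by positivity) N)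
      (w := fun Q ω N => cavg (fun k => (Bk k ω - e k ω) * (φ k ω * v k ω)) N
        - cavg (fun k => (Xk k ω * Bk k ω - h k ω) * v k ω) N
        + cavg (fun k => (Xk k ω - γ Q (shiftZ^[k] ω)) * (Bk k ω * v k ω)) N
        + cavg (fun k => |φ k ω - g (shiftZ^[k] ω)|) N) (fun Q => ?_)
      (ψ := fun Q ω => |γ Q ω - g ω|) (fun Q => ?_) (fun Q ω => abs_nonneg _) (fun Q => ?_)
      (tendsto_integral_abs_condExp_window_sub hMP hac hX hXb) (fun Q => ?_)
    · filter_upwards [t1, t2, t3 Q, hφg] with ω h1 h2 h3 h4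
      simpa using ((h2.sub h1).add h3).add h4
    · exact ((stronglyMeasurable_condExp.mono (windowAlg_le _ _)).measurable.sub
        (stronglyMeasurable_condExp.mono (windowAlg_le _ _)).measurable).abs
    · exact ((integrable_condExp (μ := ν)).sub integrable_condExp).abs
    · filter_upwards [hvb] with ω h1 N
      rw [← cavg_sub, ← cavg_add, ← cavg_add, ← cavg_add]
      refine cavg_mono (fun k => ?_) N
      have h2 : |Bk k ω * v k ω| ≤ 1 := by
        rw [abs_mul]
        exact mul_le_one₀ (hBb _) (abs_nonneg _) (h1 k)
      have h3 : (γ Q (shiftZ^[k] ω) - φ k ω) * (Bk k ω * v k ω) ≤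
          |φ k ω - g (shiftZ^[k] ω)| + |γ Q (shiftZ^[k] ω) - g (shiftZ^[k] ω)| := by
        refine (le_abs_self _).trans ?_
        rw [abs_mul]
        refine (mul_le_of_le_one_right (abs_nonneg _) h2).trans ?_
        have := abs_sub_le (γ Q (shiftZ^[k] ω)) (g (shiftZ^[k] ω)) (φ k ω)
        rw [abs_sub_comm (g (shiftZ^[k] ω))] at this
        linarith
      have h4 : 2 * v k ω ^ 2 = (Bk k ω - e k ω) * (φ k ω * v k ω)
          - (Xk k ω * Bk k ω - h k ω) * v k ω
          + (Xk k ω - γ Q (shiftZ^[k] ω)) * (Bk k ω * v k ω)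
          + (γ Q (shiftZ^[k] ω) - φ k ω) * (Bk k ω * v k ω) := by
        simp only [hv]
        ring
      linarith
  filter_upwards [hsq, hφg, hef, heb, iterate_ae hMP hgb] with ω h1 h2 h3 h4 h5
  have h6 : CesaroNull fun k => v k ω := by
    refine cesaroNull_of_sq ?_
    have := h1.const_mul (1 / 2)
    rw [mul_zero] at this
    refine this.congr fun N => ?_
    rw [← cavg_const_mul]
    congr 1
    ext k
    ring
  have h7 := ((h6.const_mul 2).add (h2.mul_bounded h4)).add (h3.mul_bounded h5)
  refine h7.of_abs_le fun k => le_of_eq ?_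
  congr 1
  simp only [hv]
  ring

end Decoupling

theorem CesaroNull.prod_sub_prod {ι : Type*} (s : Finset ι) {a b : ι → ℕ → ℝ}
    (ha : ∀ i k, |a i k| ≤ 1) (hb : ∀ i k, |b i k| ≤ 1)
    (h : ∀ i, CesaroNull fun k => a i k - b i k) :
    CesaroNull fun k => ∏ i ∈ s, a i k - ∏ i ∈ s, b i k := by
  classical
  induction s using Finset.induction_on with
  | empty => simpa using cesaroNull_zero
  | insert i s his ih =>
    have hprod : ∀ k, |∏ i ∈ s, a i k| ≤ 1 := fun k => by
      rw [Finset.abs_prod]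
      exact Finset.prod_le_one (fun _ _ => abs_nonneg _) fun i _ => ha i k
    refine (((h i).mul_bounded hprod).add (ih.mul_bounded (hb i))).of_abs_le fun k => le_of_eq ?_
    rw [Finset.prod_insert his, Finset.prod_insert his]
    congr 1
    ring

section Tail

variable {Λ Λ' : Type*} [MeasurableSpace Λ] [MeasurableSpace Λ']
  {ν : Measure (ℤ → Λ × Λ')} [IsProbabilityMeasure ν]

/-- The σ-algebra generated by all coordinates of index at most `z`. -/
@[reducible] def pastAlg (z : ℤ) : MeasurableSpace (ℤ → Λ × Λ') :=
  windowAlg (Set.Iic z) (Set.Iic z)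

theorem pastAlg_le (z : ℤ) : (pastAlg z : MeasurableSpace (ℤ → Λ × Λ')) ≤ MeasurableSpace.pi :=
  windowAlg_le _ _

theorem pastAlg_mono {y z : ℤ} (h : y ≤ z) :
    (pastAlg y : MeasurableSpace (ℤ → Λ × Λ')) ≤ pastAlg z :=
  windowAlg_mono (Set.Iic_subset_Iic.2 h) (Set.Iic_subset_Iic.2 h)

theorem measurable_comp_shiftZ_pastAlg {G : (ℤ → Λ × Λ') → ℝ} {y z : ℤ} (k : ℕ)
    (hG : Measurable[pastAlg y] G) (h : y + k ≤ z) :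
    Measurable[pastAlg z] fun ω => G (shiftZ^[k] ω) :=
  measurable_comp_shiftZ_windowAlg k hG (fun x hx => by
    simp only [Set.mem_Iic] at hx ⊢
    omega) (fun x hx => by
    simp only [Set.mem_Iic] at hx ⊢
    omega)

/-- `G'` is the limit of the conditional expectations of `G` given the remote past. -/
structure IsTailLimit (ν : Measure (ℤ → Λ × Λ')) (G G' : (ℤ → Λ × Λ') → ℝ) : Prop where
  measurable : ∀ Q : ℕ, Measurable[pastAlg (-(Q : ℤ))] G'
  abs_le : ∀ ω, |G' ω| ≤ 1
  integral_eq : ∫ ω, G' ω ∂ν = ∫ ω, G ω ∂ν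
  tendsto : Tendsto (fun Q : ℕ => ∫ ω, |(ν[G|pastAlg (-(Q : ℤ))]) ω - G' ω| ∂ν) atTop (𝓝 0)

theorem exists_isTailLimit {G : (ℤ → Λ × Λ') → ℝ} (hG : Measurable G) (hGb : ∀ ω, |G ω| ≤ 1) :
    ∃ G', IsTailLimit ν G G' := by
  obtain ⟨G', h1, h2, h3, h4⟩ := exists_tendsto_condExp_antitone (μ := ν)
    (m := fun Q : ℕ => pastAlg (-(Q : ℤ))) (fun Q => pastAlg_le _)
    (fun i j hij => pastAlg_mono (by omega)) hG hGb
  exact ⟨G', h1, h2, h3, h4⟩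

theorem IsTailLimit.measurable_pi {G G' : (ℤ → Λ × Λ') → ℝ} (h : IsTailLimit ν G G') :
    Measurable G' := (h.measurable 0).mono (pastAlg_le _) le_rfl

theorem ae_tendsto_cavg_sub_tailLimit (hS : MeasurePreserving shiftZ ν ν) {τ : ℕ → ℕ}
    (hτ : Monotone τ) (hτs : ∀ n, ∃ s, ∀ k, τ k + n ≤ τ (k + s)) {q : ℝ}
    (hdom : DominatedTimes ν shiftZ τ q) {G G' : (ℤ → Λ × Λ') → ℝ} {w : ℕ}
    (hG : Measurable[pastAlg (w : ℤ)] G) (hGb : ∀ ω, |G ω| ≤ 1) (hG' : IsTailLimit ν G G')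
    {ψ : ℕ → (ℤ → Λ × Λ') → ℝ} (hψb : ∀ k ω, |ψ k ω| ≤ 1)
    (hψ : ∀ Q : ℕ, ∃ k₀, ∀ k ≥ k₀, Measurable[pastAlg (τ k - Q : ℤ)] (ψ k)) :
    ∀ᵐ ω ∂ν, Tendsto (cavg fun k => (G (shiftZ^[τ k] ω) - G' (shiftZ^[τ k] ω)) * ψ k ω)
      atTop (𝓝 0) := by
  have hGm : Measurable G := hG.mono (pastAlg_le _) le_rfl
  have hGi : Integrable G ν := Integrable.of_bound hGm.aestronglyMeasurable 1
    (ae_of_all _ (by simpa using hGb))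
  have hG'i : Integrable G' ν := Integrable.of_bound hG'.measurable_pi.aestronglyMeasurable 1
    (ae_of_all _ (by simpa using hG'.abs_le))
  set GQ : ℕ → (ℤ → Λ × Λ') → ℝ := fun Q => ν[G|pastAlg (-(Q : ℤ))] with hGQ
  have h1 : ∀ Q : ℕ, ∀ᵐ ω ∂ν, Tendsto
      (cavg fun k => (G (shiftZ^[τ k] ω) - GQ Q (shiftZ^[τ k] ω)) * ψ k ω) atTop (𝓝 0) := by
    intro Q
    obtain ⟨s, hs⟩ := hτs (w + Q)
    obtain ⟨k₀, hk₀⟩ := hψ Q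
    have h2 := ae_tendsto_cavg_sub_condExp (μ := ν)
      (H := fun k : ℕ => pastAlg (τ k - Q : ℤ)) (fun k => pastAlg_le _)
      (fun i j hij => pastAlg_mono (by have := hτ hij; omega))
      (Y := fun k ω => G (shiftZ^[τ k] ω)) (V := ψ) s k₀
      (fun k => (measurable_comp_shiftZ_pastAlg (τ k) hG
        (by have := hs k; omega)).stronglyMeasurable)
      (fun k => ae_of_all _ fun ω => hGb _) (fun k hk => (hk₀ k hk).stronglyMeasurable)
      (fun k => ae_of_all _ (hψb k))
    have h3 : ∀ᵐ ω ∂ν, ∀ k : ℕ, (ν[fun ω => G (shiftZ^[τ k] ω)|pastAlg (τ k - Q : ℤ)]) ω =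
        GQ Q (shiftZ^[τ k] ω) := ae_all_iff.2 fun k => by
      have h4 := condExp_shiftZ hS hGi (τ k) (Set.Iic (τ k - Q : ℤ)) (Set.Iic (τ k - Q : ℤ))
      have e2 : {z : ℤ | z + τ k ∈ Set.Iic (τ k - Q : ℤ)} = Set.Iic (-(Q : ℤ)) := by
        ext z
        simp only [Set.mem_Iic, Set.mem_ofPred_eq]
        omega
      rw [e2] at h4
      exact h4
    filter_upwards [h2, h3] with ω h4 h5
    simpa only [h5] using h4
  have key : ∀ᵐ ω ∂ν, Tendsto (fun N => |cavg (fun k =>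
      (G (shiftZ^[τ k] ω) - G' (shiftZ^[τ k] ω)) * ψ k ω) N|) atTop (𝓝 0) := by
    refine ae_tendsto_zero_of_dominatedTimes hdom (fun ω N => abs_nonneg _)
      (w := fun Q ω N => |cavg (fun k => (G (shiftZ^[τ k] ω) - GQ Q (shiftZ^[τ k] ω)) * ψ k ω) N|)
      (fun Q => ?_) (ψ := fun Q ω => |GQ Q ω - G' ω|) (fun Q => ?_) (fun Q ω => abs_nonneg _)
      (fun Q => ?_) hG'.tendsto (fun Q => ae_of_all _ fun ω N => ?_)
    · filter_upwards [h1 Q] with ω h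
      simpa using h.abs
    · exact ((stronglyMeasurable_condExp.mono (pastAlg_le _)).measurable.sub
        hG'.measurable_pi).abs
    · exact ((integrable_condExp (μ := ν)).sub hG'i).abs
    · have e1 : (fun k => (G (shiftZ^[τ k] ω) - G' (shiftZ^[τ k] ω)) * ψ k ω) = fun k =>
          (G (shiftZ^[τ k] ω) - GQ Q (shiftZ^[τ k] ω)) * ψ k ω +
          (GQ Q (shiftZ^[τ k] ω) - G' (shiftZ^[τ k] ω)) * ψ k ω := by
        ext k
        ring
      rw [e1, cavg_add]
      refine (abs_add_le _ _).trans (add_le_add_right ((abs_cavg_le _ N).trans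
        (cavg_mono (fun k => ?_) N)) _)
      rw [abs_mul]
      exact mul_le_of_le_one_right (abs_nonneg _) (hψb k ω)
  filter_upwards [key] with ω h
  exact (tendsto_zero_iff_abs_tendsto_zero _).2 h

/-- Products of window observables may be replaced by products of their tail limits. -/
theorem ae_tendsto_cavg_mul_sub_tailLimit (hS : Ergodic shiftZ ν) {l : ℕ → ℕ}
    (hl : IsSlowTime l) {c : ℕ → ℝ} (hc : ∀ k, |c k| ≤ 1) {F F' G G' : (ℤ → Λ × Λ') → ℝ}
    {w w' : ℕ} (hF : Measurable[pastAlg (w' : ℤ)] F) (hFb : ∀ ω, |F ω| ≤ 1)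
    (hF' : IsTailLimit ν F F') (hG : Measurable[pastAlg (w : ℤ)] G) (hGb : ∀ ω, |G ω| ≤ 1)
    (hG' : IsTailLimit ν G G') :
    ∀ᵐ ω ∂ν, Tendsto (cavg fun k => c k * F (shiftZ^[l k] ω) * G (shiftZ^[k] ω) -
      c k * F' (shiftZ^[l k] ω) * G' (shiftZ^[k] ω)) atTop (𝓝 0) := by
  obtain ⟨q, hdom⟩ := hl.dominatedTimes hS
  have h1 := ae_tendsto_cavg_sub_tailLimit hS.toMeasurePreserving (τ := fun k => k)
    (fun i j h => h) (fun n => ⟨n, fun k => le_rfl⟩) hS.dominatedTimes_id hG hGb hG'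
    (ψ := fun k ω => c k * F (shiftZ^[l k] ω))
    (fun k ω => by
      rw [abs_mul]
      exact mul_le_one₀ (hc k) (abs_nonneg _) (hFb _))
    (fun Q => by
      obtain ⟨k₀, hk₀⟩ := hl.exists_forall_le_sub (w' + Q)
      refine ⟨k₀, fun k hk => ?_⟩
      have := hk₀ k hk
      exact (measurable_comp_shiftZ_pastAlg (l k) hF (by omega)).const_mul _)
  have h2 := ae_tendsto_cavg_sub_tailLimit hS.toMeasurePreserving hl.mono hl.exists_add_le hdom
    hF hFb hF' (ψ := fun k ω => c k * G' (shiftZ^[k] ω))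
    (fun k ω => by
      rw [abs_mul]
      exact mul_le_one₀ (hc k) (abs_nonneg _) (hG'.abs_le _))
    (fun Q => ⟨0, fun k _ => by
      have := hl.le_self k
      exact (measurable_comp_shiftZ_pastAlg k (hG'.measurable (k + Q)) (by omega)).const_mul _⟩)
  filter_upwards [h1, h2] with ω h3 h4
  have h5 := h3.add h4
  rw [add_zero] at h5
  refine h5.congr fun N => ?_
  rw [← cavg_add]
  congr 1
  ext k
  ring

end Tail

section Period

variable {Ω : Type*} {mT m0 : MeasurableSpace Ω} {μ : Measure Ω} [IsProbabilityMeasure μ]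

/-- A measure-preserving map acts on a σ-algebra whose nontrivial events have probability bounded
from below as a periodic map. -/
theorem exists_period_of_le_sq {S : Ω → Ω} (hS : MeasurePreserving S μ μ) (hT : mT ≤ m0)
    (hSm : Measurable[mT, mT] S) {C : ℝ}
    (hC : ∀ E, MeasurableSet[mT] E → μ.real E ≤ C * μ.real E * μ.real E) :
    ∃ p ≥ 1, ∀ E, MeasurableSet[mT] E → μ.real (E \ S^[p] ⁻¹' E) = 0 := by
  have hC1 : 1 ≤ C := by simpa using hC Set.univ MeasurableSet.univ
  have hC0 : 0 < C := lt_of_lt_of_le one_pos hC1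
  have hlow : ∀ E, MeasurableSet[mT] E → μ.real E ≠ 0 → C⁻¹ ≤ μ.real E := by
    intro E hE h0
    have h1 : 0 < μ.real E := lt_of_le_of_ne measureReal_nonneg h0.symm
    have h2 := hC E hE
    rw [inv_le_iff_one_le_mul₀ hC0]
    by_contra! h3
    nlinarith
  have hit : ∀ k, Measurable[mT, mT] S^[k] := fun k => by
    induction k with
    | zero => exact measurable_id
    | succ k ih => exact ih.comp hSm
  have hpre : ∀ k E, MeasurableSet[mT] E → μ.real (S^[k] ⁻¹' E) = μ.real E := fun k E hE =>
    (hS.iterate k).measureReal_preimage (hT _ hE).nullMeasurableSet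
  refine ⟨(⌊C⌋₊).factorial, Nat.factorial_pos _, fun E hE => ?_⟩
  set p := (⌊C⌋₊).factorial with hp
  by_contra hne
  have hE' : MeasurableSet[mT] (E \ S^[p] ⁻¹' E) := hE.diff (hit p hE)
  set V : Set ℝ := {x | ∃ A, MeasurableSet[mT] A ∧ A ⊆ E \ S^[p] ⁻¹' E ∧ μ.real A ≠ 0 ∧
    x = μ.real A} with hV
  have hVne : V.Nonempty := ⟨_, _, hE', le_rfl, hne, rfl⟩
  have hVb : BddBelow V := ⟨0, by
    rintro x ⟨A, _, _, _, rfl⟩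
    exact measureReal_nonneg⟩
  obtain ⟨_, ⟨A, hA, hAE, hA0, rfl⟩, hAlt⟩ := exists_lt_of_csInf_lt hVne
    (lt_add_of_pos_right (sInf V) (inv_pos.2 hC0))
  have hatom : ∀ D, MeasurableSet[mT] D → μ.real (A ∩ D) ≠ 0 → μ.real (A \ D) = 0 := by
    intro D hD h0
    by_contra h1
    have h2 : sInf V ≤ μ.real (A ∩ D) := csInf_le hVb
      ⟨_, hA.inter hD, Set.inter_subset_left.trans hAE, h0, rfl⟩
    have h3 := hlow _ (hA.diff hD) h1
    have h4 := measureReal_inter_add_sdiff (μ := μ) (s := A) (hT _ hD)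
    linarith
  have hrec : ∃ i j, i < j ∧ j ≤ ⌊C⌋₊ ∧ μ (S^[i] ⁻¹' A ∩ S^[j] ⁻¹' A) ≠ 0 := by
    by_contra! hnot
    have hd : Set.Pairwise (↑(Finset.range (⌊C⌋₊ + 1)) : Set ℕ)
        (Function.onFun (AEDisjoint μ) fun i => S^[i] ⁻¹' A) := by
      intro i hi j hj hij
      simp only [Finset.coe_range, Set.mem_Iio] at hi hj
      rcases lt_or_gt_of_ne hij with h | h
      · exact hnot i j h (by omega)
      · exact AEDisjoint.symm (hnot j i h (by omega))
    have h1 := measure_biUnion_finset₀ hd fun i _ => (hT _ (hit i hA)).nullMeasurableSet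
    have h2 : ∑ i ∈ Finset.range (⌊C⌋₊ + 1), μ.real (S^[i] ⁻¹' A) ≤ 1 := by
      have h3 : μ (⋃ i ∈ Finset.range (⌊C⌋₊ + 1), S^[i] ⁻¹' A) ≤ 1 := prob_le_one
      rw [h1] at h3
      have h4 := ENNReal.toReal_mono ENNReal.one_ne_top h3
      rw [ENNReal.toReal_sum fun _ _ => measure_ne_top _ _] at h4
      simpa [Measure.real] using h4
    simp only [hpre _ A hA, Finset.sum_const, Finset.card_range, nsmul_eq_mul] at h2
    have h3 := hlow A hA hA0
    have h4 : C < (⌊C⌋₊ + 1 : ℕ) := by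
      push_cast
      exact Nat.lt_floor_add_one C
    have h5 : (1 : ℝ) < (⌊C⌋₊ + 1 : ℕ) * C⁻¹ := by
      rw [← div_eq_mul_inv, one_lt_div hC0]
      exact h4
    have h6 := mul_le_mul_of_nonneg_left h3 (Nat.cast_nonneg (α := ℝ) (⌊C⌋₊ + 1))
    linarith
  obtain ⟨i, j, hij, hjC, hpos⟩ := hrec
  set d := j - i with hd
  have hAd : μ.real (A \ S^[d] ⁻¹' A) = 0 := by
    refine hatom _ (hit d hA) fun h0 => hpos ?_
    have h1 : S^[i] ⁻¹' A ∩ S^[j] ⁻¹' A = S^[i] ⁻¹' (A ∩ S^[d] ⁻¹' A) := by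
      rw [Set.preimage_inter, ← Set.preimage_comp, ← Function.iterate_add, hd,
        Nat.sub_add_cancel hij.le]
    rw [h1, (hS.iterate i).measure_preimage (hT _ (hA.inter (hit d hA))).nullMeasurableSet]
    exact (measureReal_eq_zero_iff).1 h0
  have hmul : ∀ n, μ.real (A \ S^[d * n] ⁻¹' A) = 0 := by
    intro n
    induction n with
    | zero => simp
    | succ n ih =>
      have h1 : A \ S^[d * (n + 1)] ⁻¹' A ⊆
          (A \ S^[d] ⁻¹' A) ∪ S^[d] ⁻¹' (A \ S^[d * n] ⁻¹' A) := by
        rintro x ⟨hx1, hx2⟩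
        by_cases hx : x ∈ S^[d] ⁻¹' A
        · refine Or.inr ⟨hx, fun h => hx2 ?_⟩
          rw [Set.mem_preimage, Nat.mul_succ, Function.iterate_add_apply]
          exact h
        · exact Or.inl ⟨hx1, hx⟩
      refine le_antisymm ((measureReal_mono h1).trans ((measureReal_union_le _ _).trans ?_))
        measureReal_nonneg
      rw [hAd, hpre d _ (hA.diff (hit _ hA)), ih, add_zero]
  obtain ⟨n, hn⟩ : d ∣ p := Nat.dvd_factorial (by omega) (by omega)
  have h1 := hmul n
  rw [← hn] at h1
  have h2 : A \ S^[p] ⁻¹' A = A := by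
    ext x
    exact ⟨fun h => h.1, fun hx => ⟨hx, fun hx' => (hAE hx).2 (hAE hx').1⟩⟩
  rw [h2] at h1
  exact hA0 h1

theorem ae_comp_iterate_eq {S : Ω → Ω} {p : ℕ}
    (hp : ∀ E, MeasurableSet[mT] E → μ.real (E \ S^[p] ⁻¹' E) = 0) {G : Ω → ℝ}
    (hG : Measurable[mT] G) : ∀ᵐ ω ∂μ, G (S^[p] ω) = G ω := by
  have h1 : ∀ E, MeasurableSet[mT] E → ∀ᵐ ω ∂μ, ω ∈ E → S^[p] ω ∈ E := by
    intro E hE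
    have := (measureReal_eq_zero_iff).1 (hp E hE)
    rw [ae_iff]
    convert this using 2
    ext ω
    simp
  have h2 : ∀ᵐ ω ∂μ, ∀ r : ℚ, (G ω < r → G (S^[p] ω) < r) ∧ (r < G ω → r < G (S^[p] ω)) :=
    ae_all_iff.2 fun r => (h1 _ (hG measurableSet_Iio)).and (h1 _ (hG measurableSet_Ioi))
  filter_upwards [h2] with ω h
  rcases lt_trichotomy (G (S^[p] ω)) (G ω) with hlt | heq | hlt
  · obtain ⟨r, hr1, hr2⟩ := exists_rat_btwn hlt
    exact absurd ((h r).2 hr2) (not_lt.2 hr1.le)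
  · exact heq
  · obtain ⟨r, hr1, hr2⟩ := exists_rat_btwn hlt
    exact absurd ((h r).1 hr1) (not_lt.2 hr2.le)

end Period

/-- The average over a period of a periodic observable of an ergodic map is almost surely its
mean. -/
theorem Ergodic.ae_sum_range_eq_integral {Ω : Type*} [MeasurableSpace Ω] {μ : Measure Ω}
    [IsProbabilityMeasure μ] {S : Ω → Ω} (hS : Ergodic S μ) {p : ℕ} (hp : 1 ≤ p) {G : Ω → ℝ}
    (hG : Measurable G) (hGi : Integrable G μ) (hper : ∀ᵐ ω ∂μ, G (S^[p] ω) = G ω) :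
    ∀ᵐ ω ∂μ, (p : ℝ)⁻¹ * ∑ j ∈ Finset.range p, G (S^[j] ω) = ∫ ω, G ω ∂μ := by
  set A : Ω → ℝ := fun ω => (p : ℝ)⁻¹ * ∑ j ∈ Finset.range p, G (S^[j] ω) with hA
  have hMP := hS.toMeasurePreserving
  have hinv : A ∘ S =ᵐ[μ] A := by
    filter_upwards [hper] with ω h
    have h1 : ∑ j ∈ Finset.range p, G (S^[j] (S ω)) = ∑ j ∈ Finset.range p, G (S^[j] ω) := by
      have h2 := Finset.sum_range_succ (fun j => G (S^[j] ω)) p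
      have h3 := Finset.sum_range_succ' (fun j => G (S^[j] ω)) p
      simp only [Function.iterate_succ_apply, Function.iterate_zero, id] at h3
      rw [h] at h2
      linarith
    simp only [hA, Function.comp_apply, h1]
  have hAm : Measurable A := (Finset.measurable_sum _ fun j _ =>
    hG.comp (hMP.iterate j).measurable).const_mul _
  obtain ⟨c, hc⟩ := hS.ae_eq_const_of_ae_eq_comp₀ hAm.nullMeasurable hinv
  have hGj : ∀ j, Integrable (fun ω => G (S^[j] ω)) μ := fun j =>
    ((hMP.iterate j).integrable_comp hGi.aestronglyMeasurable).2 hGi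
  have h1 : ∫ ω, A ω ∂μ = ∫ ω, G ω ∂μ := by
    rw [hA, integral_const_mul, integral_finsetSum _ fun j _ => hGj j]
    simp only [fun j => integral_comp_of_measurePreserving (hMP.iterate j)
      hGi.aestronglyMeasurable]
    have : (p : ℝ) ≠ 0 := by positivity
    simp [this]
  have h2 : ∫ ω, A ω ∂μ = c := by
    rw [integral_congr_ae hc]
    simp
  filter_upwards [hc] with ω h
  rw [← h1, h2]
  exact h

section QuasiIndependence

variable {Λ Λ' : Type*} [MeasurableSpace Λ] [MeasurableSpace Λ']
  {ν : Measure (ℤ → Λ × Λ')} [IsProbabilityMeasure ν]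

theorem comap_futureZ : (MeasurableSpace.pi : MeasurableSpace (ℕ → Λ × Λ')).comap futureZ =
    windowAlg (Set.Ici 1) (Set.Ici 1) := by
  simp only [MeasurableSpace.pi, Prod.instMeasurableSpace, MeasurableSpace.prod, windowAlg, FalgZ,
    GalgZ, MeasurableSpace.comap_sup, MeasurableSpace.comap_iSup, MeasurableSpace.comap_comp,
    iSup_sup_eq]
  congr 1
  · refine le_antisymm (iSup_le fun j => le_iSup₂_of_le ((j : ℤ) + 1) (by simp) le_rfl)
      (iSup₂_le fun r hr => le_iSup_of_le (r - 1).toNat ?_)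
    have : ((r - 1).toNat : ℤ) + 1 = r := by
      rw [Set.mem_Ici] at hr
      omega
    simp only [Function.comp_def, futureZ, this, le_refl]
  · refine le_antisymm (iSup_le fun j => le_iSup₂_of_le ((j : ℤ) + 1) (by simp) le_rfl)
      (iSup₂_le fun r hr => le_iSup_of_le (r - 1).toNat ?_)
    have : ((r - 1).toNat : ℤ) + 1 = r := by
      rw [Set.mem_Ici] at hr
      omega
    simp only [Function.comp_def, futureZ, this, le_refl]

theorem windowAlg_univ : (windowAlg Set.univ Set.univ : MeasurableSpace (ℤ → Λ × Λ')) =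
    MeasurableSpace.pi := by
  simp only [MeasurableSpace.pi, Prod.instMeasurableSpace, MeasurableSpace.prod, windowAlg, FalgZ,
    GalgZ, MeasurableSpace.comap_sup, MeasurableSpace.comap_comp,
    iSup_sup_eq, Set.mem_univ, iSup_pos]
  rfl

theorem measureReal_inter_le {C : ℝ≥0}
    (hle : ν.map (fun ω => (pastZ ω, futureZ ω)) ≤
      (C : ℝ≥0∞) • (ν.map pastZ).prod (ν.map futureZ))
    {E F : Set (ℤ → Λ × Λ')} (hE : MeasurableSet[pastAlg 0] E)
    (hF : MeasurableSet[windowAlg (Set.Ici 1) (Set.Ici 1)] F) :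
    ν.real (E ∩ F) ≤ C * ν.real E * ν.real F := by
  rw [pastAlg, ← comap_pastZ] at hE
  rw [← comap_futureZ] at hF
  obtain ⟨E, hE, rfl⟩ := hE
  obtain ⟨F, hF, rfl⟩ := hF
  have h1 := hle (E ×ˢ F)
  rw [Measure.map_apply (measurable_pastZ.prodMk measurable_futureZ) (hE.prod hF),
    Measure.smul_apply, Measure.prod_prod, Measure.map_apply measurable_pastZ hE,
    Measure.map_apply measurable_futureZ hF, smul_eq_mul] at h1
  have h2 := ENNReal.toReal_mono (by finiteness) h1
  simp only [ENNReal.toReal_mul, ENNReal.coe_toReal] at h2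
  rw [mul_assoc]
  exact h2

theorem measureReal_inter_le_of_shift (hS : MeasurePreserving shiftZ ν ν) {C : ℝ≥0}
    (hle : ν.map (fun ω => (pastZ ω, futureZ ω)) ≤
      (C : ℝ≥0∞) • (ν.map pastZ).prod (ν.map futureZ)) (k : ℕ)
    {E F : Set (ℤ → Λ × Λ')} (hE : MeasurableSet[pastAlg (-(k : ℤ))] E)
    (hF : MeasurableSet[windowAlg (Set.Ici (1 - k : ℤ)) (Set.Ici (1 - k : ℤ))] F) :
    ν.real (E ∩ F) ≤ C * ν.real E * ν.real F := by
  have hE0 : MeasurableSet[pastAlg 0] (shiftZ^[k] ⁻¹' E) := by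
    refine measurable_shiftZ_iterate_windowAlg k (Set.Iic 0) (Set.Iic 0) ?_
    convert hE using 2 <;> (ext z; simp only [Set.mem_Iic, Set.mem_ofPred_eq]; omega)
  have hF0 : MeasurableSet[windowAlg (Set.Ici 1) (Set.Ici 1)] (shiftZ^[k] ⁻¹' F) := by
    refine measurable_shiftZ_iterate_windowAlg k (Set.Ici 1) (Set.Ici 1) ?_
    convert hF using 2 <;> (ext z; simp only [Set.mem_Ici, Set.mem_ofPred_eq]; omega)
  have hEm : MeasurableSet E := pastAlg_le _ _ hE
  have hFm : MeasurableSet F := windowAlg_le _ _ _ hF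
  have h := measureReal_inter_le hle hE0 hF0
  rwa [← Set.preimage_inter, (hS.iterate k).measureReal_preimage (hEm.inter hFm).nullMeasurableSet,
    (hS.iterate k).measureReal_preimage hEm.nullMeasurableSet,
    (hS.iterate k).measureReal_preimage hFm.nullMeasurableSet] at h

theorem measureReal_le_sq_of_tail (hS : MeasurePreserving shiftZ ν ν) {C : ℝ≥0}
    (hle : ν.map (fun ω => (pastZ ω, futureZ ω)) ≤
      (C : ℝ≥0∞) • (ν.map pastZ).prod (ν.map futureZ))
    {E : Set (ℤ → Λ × Λ')} (hE : ∀ Q : ℕ, MeasurableSet[pastAlg (-(Q : ℤ))] E) :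
    ν.real E ≤ C * ν.real E * ν.real E := by
  have hEm : MeasurableSet E := pastAlg_le _ _ (hE 0)
  have hsup : (⨆ k : ℕ, windowAlg (Set.Ici (1 - k : ℤ)) (Set.Ici (1 - k : ℤ)) :
      MeasurableSpace (ℤ → Λ × Λ')) = MeasurableSpace.pi := by
    rw [iSup_windowAlg, ← windowAlg_univ]
    have : ⋃ k : ℕ, Set.Ici (1 - k : ℤ) = Set.univ := Set.eq_univ_of_forall fun z =>
      Set.mem_iUnion.2 ⟨(1 - z).toNat, by rw [Set.mem_Ici]; omega⟩
    rw [this]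
  refine le_of_forall_pos_le_add fun δ hδ => ?_
  have hCE : 0 ≤ (C : ℝ) * ν.real E := by positivity
  obtain ⟨k, F, hF, hEF⟩ := exists_measurableSet_symmDiff_lt (μ := ν)
    (m := fun k : ℕ => windowAlg (Set.Ici (1 - k : ℤ)) (Set.Ici (1 - k : ℤ)))
    (fun i j hij => windowAlg_mono (Set.Ici_subset_Ici.2 (by omega))
      (Set.Ici_subset_Ici.2 (by omega))) (fun k => windowAlg_le _ _) (s := E)
    (by rw [hsup]; exact hEm) (ε := δ / (1 + C * ν.real E)) (by positivity)
  have hFm : MeasurableSet F := windowAlg_le _ _ _ hF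
  have h1 := measureReal_inter_le_of_shift hS hle k (hE k) hF
  have h2 : ν.real F ≤ ν.real E + ν.real (symmDiff E F) :=
    (measureReal_mono (fun x hx => by
      by_cases h : x ∈ E
      · exact Or.inl h
      · exact Or.inr (Or.inr ⟨hx, h⟩))).trans (measureReal_union_le _ _)
  have h3 : ν.real E ≤ ν.real (E ∩ F) + ν.real (symmDiff E F) :=
    (measureReal_mono (fun x hx => by
      by_cases h : x ∈ F
      · exact Or.inl ⟨hx, h⟩
      · exact Or.inr (Or.inl ⟨hx, h⟩))).trans (measureReal_union_le _ _)
  have h4 := mul_le_mul_of_nonneg_left h2 hCE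
  rw [lt_div_iff₀ (by positivity)] at hEF
  nlinarith

/-- Under quasi-independence of past and future, tail limits are periodic along orbits, with a
common period. -/
theorem exists_period_tailLimit (hS : MeasurePreserving shiftZ ν ν) {C : ℝ≥0}
    (hle : ν.map (fun ω => (pastZ ω, futureZ ω)) ≤
      (C : ℝ≥0∞) • (ν.map pastZ).prod (ν.map futureZ)) :
    ∃ p ≥ 1, ∀ G G' : (ℤ → Λ × Λ') → ℝ, IsTailLimit ν G G' →
      ∀ᵐ ω ∂ν, G' (shiftZ^[p] ω) = G' ω := by
  have hmem : ∀ E : Set (ℤ → Λ × Λ'),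
      MeasurableSet[⨅ Q : ℕ, pastAlg (-(Q : ℤ))] E ↔
        ∀ Q : ℕ, MeasurableSet[pastAlg (-(Q : ℤ))] E := fun E =>
    MeasurableSpace.measurableSet_iInf
  obtain ⟨p, hp, h⟩ := exists_period_of_le_sq (mT := ⨅ Q : ℕ, pastAlg (-(Q : ℤ))) hS
    ((iInf_le _ 0).trans (pastAlg_le _)) (fun E hE => by
      rw [hmem] at hE ⊢
      intro Q
      refine measurable_shiftZ_iterate_windowAlg 1 (Set.Iic (-(Q : ℤ))) (Set.Iic (-(Q : ℤ))) ?_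
      convert hE (Q + 1) using 2 <;>
        (ext z; simp only [Set.mem_Iic, Set.mem_ofPred_eq]; omega))
    (C := C) (fun E hE => measureReal_le_sq_of_tail hS hle ((hmem E).1 hE))
  refine ⟨p, hp, fun G G' hG' => ae_comp_iterate_eq h fun s hs => ?_⟩
  rw [hmem]
  exact fun Q => hG'.measurable Q hs

end QuasiIndependence

/-- The conditional expectation of a function bounded by `1` has a version bounded by `1`. -/
theorem exists_condExp_version {Ω : Type*} {m m0 : MeasurableSpace Ω} {μ : Measure Ω}
    [IsProbabilityMeasure μ] {X : Ω → ℝ} (hXb : ∀ ω, |X ω| ≤ 1) :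
    ∃ g : Ω → ℝ, Measurable[m] g ∧ (∀ ω, |g ω| ≤ 1) ∧ μ[X|m] =ᵐ[μ] g := by
  refine ⟨fun ω => max (-1) (min 1 ((μ[X|m]) ω)),
    measurable_const.max (measurable_const.min stronglyMeasurable_condExp.measurable), fun ω => ?_, ?_⟩
  · exact abs_le.2 ⟨le_max_left _ _, max_le (by norm_num) (min_le_left _ _)⟩
  · filter_upwards [ae_abs_condExp_le (m := m) (ae_of_all μ hXb)] with ω h
    have := abs_le.1 h
    rw [min_eq_right this.2, max_eq_right this.1]

section TwoTimes

variable {Λ Λ' : Type*} [MeasurableSpace Λ] [MeasurableSpace Λ']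
  {ν : Measure (ℤ → Λ × Λ')} [IsProbabilityMeasure ν]

/-- The averages of `c k * u (l k) * v k` converge to `L` times the product of the means of the
periodic sequences `u` and `v`. -/
def PeriodicallyEquidistributed (c : ℕ → ℝ) (l : ℕ → ℕ) (L : ℝ) : Prop :=
  ∀ p ≥ 1, ∀ u v : ℕ → ℝ, (∀ k, u (k + p) = u k) → (∀ k, v (k + p) = v k) →
    Tendsto (cavg fun k => c k * u (l k) * v k) atTop
      (𝓝 (L * ((p : ℝ)⁻¹ * ∑ j ∈ Finset.range p, u j) * ((p : ℝ)⁻¹ * ∑ j ∈ Finset.range p, v j)))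

theorem ae_tendsto_cavg_mul_of_window (hS : Ergodic shiftZ ν) {C : ℝ≥0}
    (hle : ν.map (fun ω => (pastZ ω, futureZ ω)) ≤
      (C : ℝ≥0∞) • (ν.map pastZ).prod (ν.map futureZ)) {l : ℕ → ℕ}
    (hl : IsSlowTime l) {c : ℕ → ℝ} (hc : ∀ k, |c k| ≤ 1) {L : ℝ}
    (hL : PeriodicallyEquidistributed c l L) {F G : (ℤ → Λ × Λ') → ℝ}
    {w w' : ℕ} (hF : Measurable[pastAlg (w' : ℤ)] F) (hFb : ∀ ω, |F ω| ≤ 1)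
    (hG : Measurable[pastAlg (w : ℤ)] G) (hGb : ∀ ω, |G ω| ≤ 1) :
    ∀ᵐ ω ∂ν, Tendsto (cavg fun k => c k * F (shiftZ^[l k] ω) * G (shiftZ^[k] ω)) atTop
      (𝓝 (L * (∫ ω, F ω ∂ν) * ∫ ω, G ω ∂ν)) := by
  have hMP := hS.toMeasurePreserving
  obtain ⟨p, hp, hper⟩ := exists_period_tailLimit hMP hle
  obtain ⟨F', hF'⟩ := exists_isTailLimit (ν := ν) (hF.mono (pastAlg_le _) le_rfl) hFb
  obtain ⟨G', hG'⟩ := exists_isTailLimit (ν := ν) (hG.mono (pastAlg_le _) le_rfl) hGb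
  have hint : ∀ {H H' : (ℤ → Λ × Λ') → ℝ}, IsTailLimit ν H H' → Integrable H' ν := fun h =>
    Integrable.of_bound h.measurable_pi.aestronglyMeasurable 1
      (ae_of_all _ (by simpa using h.abs_le))
  filter_upwards [ae_tendsto_cavg_mul_sub_tailLimit hS hl hc hF hFb hF' hG hGb hG',
    iterate_ae hMP (hper F F' hF'), iterate_ae hMP (hper G G' hG'),
    hS.ae_sum_range_eq_integral hp hF'.measurable_pi (hint hF') (hper F F' hF'),
    hS.ae_sum_range_eq_integral hp hG'.measurable_pi (hint hG') (hper G G' hG')]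
    with ω h1 h2 h3 h4 h5
  have h6 := hL p hp (fun k => F' (shiftZ^[k] ω)) (fun k => G' (shiftZ^[k] ω))
    (fun k => by
      rw [add_comm, Function.iterate_add_apply, h2])
    (fun k => by
      rw [add_comm, Function.iterate_add_apply, h3])
  rw [h4, h5, hF'.integral_eq, hG'.integral_eq] at h6
  have h7 := h1.add h6
  rw [zero_add] at h7
  refine h7.congr fun N => ?_
  rw [← cavg_add]
  congr 1
  ext k
  ring

/-- Joint ergodic averages along the times `l k` and `k`. -/
theorem ae_tendsto_cavg_mul (hS : Ergodic shiftZ ν) {C : ℝ≥0}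
    (hle : ν.map (fun ω => (pastZ ω, futureZ ω)) ≤
      (C : ℝ≥0∞) • (ν.map pastZ).prod (ν.map futureZ)) {l : ℕ → ℕ}
    (hl : IsSlowTime l) {c : ℕ → ℝ} (hc : ∀ k, |c k| ≤ 1) {L : ℝ}
    (hL : PeriodicallyEquidistributed c l L) {F G : (ℤ → Λ × Λ') → ℝ}
    {w : ℕ} (hF : Measurable F) (hFb : ∀ ω, |F ω| ≤ 1)
    (hG : Measurable[pastAlg (w : ℤ)] G) (hGb : ∀ ω, |G ω| ≤ 1) :
    ∀ᵐ ω ∂ν, Tendsto (cavg fun k => c k * F (shiftZ^[l k] ω) * G (shiftZ^[k] ω)) atTop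
      (𝓝 (L * (∫ ω, F ω ∂ν) * ∫ ω, G ω ∂ν)) := by
  obtain ⟨q, hdom⟩ := hl.dominatedTimes hS
  choose f hfm hfb hfe using fun Q : ℕ =>
    exists_condExp_version (m := pastAlg (Q : ℤ)) (μ := ν) hFb
  have hFi : Integrable F ν := Integrable.of_bound hF.aestronglyMeasurable 1
    (ae_of_all _ (by simpa using hFb))
  have hfm' : ∀ Q, Measurable (f Q) := fun Q => (hfm Q).mono (pastAlg_le _) le_rfl
  have hfi : ∀ Q, Integrable (f Q) ν := fun Q => integrable_condExp.congr (hfe Q)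
  have hfF : ∀ Q, ∫ ω, f Q ω ∂ν = ∫ ω, F ω ∂ν := fun Q => by
    rw [← integral_congr_ae (hfe Q), integral_condExp (pastAlg_le _)]
  have hsup : (⨆ k : ℕ, pastAlg (k : ℤ) : MeasurableSpace (ℤ → Λ × Λ')) =
      MeasurableSpace.pi := by
    rw [iSup_windowAlg, ← windowAlg_univ]
    have : ⋃ k : ℕ, Set.Iic (k : ℤ) = Set.univ := Set.eq_univ_of_forall fun z =>
      Set.mem_iUnion.2 ⟨z.toNat, by rw [Set.mem_Iic]; omega⟩
    rw [this]
  have hlim := tendsto_integral_abs_condExp_sub (μ := ν)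
    (m := fun k : ℕ => pastAlg (k : ℤ)) (fun i j hij => pastAlg_mono (by exact_mod_cast hij))
    (fun k => pastAlg_le _) F
  rw [hsup, condExp_of_stronglyMeasurable le_rfl hF.stronglyMeasurable hFi] at hlim
  have key : ∀ᵐ ω ∂ν, Tendsto (fun N =>
      |cavg (fun k => c k * F (shiftZ^[l k] ω) * G (shiftZ^[k] ω)) N -
        L * (∫ ω, F ω ∂ν) * ∫ ω, G ω ∂ν|) atTop (𝓝 0) := by
    refine ae_tendsto_zero_of_dominatedTimes hdom (fun ω N => abs_nonneg _)
      (w := fun Q ω N => |cavg (fun k => c k * f Q (shiftZ^[l k] ω) * G (shiftZ^[k] ω)) N -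
        L * (∫ ω, F ω ∂ν) * ∫ ω, G ω ∂ν|)
      (fun Q => ?_) (ψ := fun Q ω => |f Q ω - F ω|) (fun Q => ((hfm' Q).sub hF).abs)
      (fun Q ω => abs_nonneg _) (fun Q => ((hfi Q).sub hFi).abs) ?_
      (fun Q => ae_of_all _ fun ω N => ?_)
    · filter_upwards [ae_tendsto_cavg_mul_of_window hS hle hl hc hL (hfm Q) (hfb Q) hG hGb]
        with ω h
      rw [hfF] at h
      have := (h.sub_const (L * (∫ ω, F ω ∂ν) * ∫ ω, G ω ∂ν)).abs
      simpa using this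
    · refine hlim.congr fun Q => integral_congr_ae ?_
      filter_upwards [hfe Q] with ω h
      rw [h]
    · have e1 : (fun k => c k * F (shiftZ^[l k] ω) * G (shiftZ^[k] ω)) = fun k =>
          c k * f Q (shiftZ^[l k] ω) * G (shiftZ^[k] ω) -
            c k * (f Q (shiftZ^[l k] ω) - F (shiftZ^[l k] ω)) * G (shiftZ^[k] ω) := by
        ext k
        ring
      rw [e1, cavg_sub, sub_right_comm]
      refine (abs_sub _ _).trans (add_le_add_right ((abs_cavg_le _ N).trans
        (cavg_mono (fun k => ?_) N)) _)
      rw [abs_mul, abs_mul]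
      exact (mul_le_of_le_one_right (by positivity) (hGb _)).trans
        (mul_le_of_le_one_left (abs_nonneg _) (hc k))
  filter_upwards [key] with ω h
  rw [← tendsto_sub_nhds_zero_iff]
  exact (tendsto_zero_iff_abs_tendsto_zero _).2 h

end TwoTimes

section Rotation

variable {α : ℝ}

theorem eventually_cavg_fract_le (hα : Irrational α) {a b : ℝ} (hab : a ≤ b) (x : ℝ) {ε : ℝ}
    (hε : 0 < ε) :
    ∀ᶠ N in atTop, cavg (fun k => (Set.Ico a b).indicator (1 : ℝ → ℝ) (Int.fract (x + k * α))) N ≤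
      b - a + ε := by
  have : IsProbabilityMeasure (volume : Measure UnitAddCircle) := ⟨UnitAddCircle.measure_univ⟩
  have herg : Ergodic (fun y : UnitAddCircle => (α : UnitAddCircle) + y) volume := by
    rw [AddCircle.ergodic_add_left, ← AddCircle.denseRange_zsmul_iff,
      AddCircle.denseRange_zsmul_coe_iff]
    simpa using hα
  set B : Set UnitAddCircle :=
    Metric.closedBall (((a + b) / 2 : ℝ) : UnitAddCircle) ((b - a) / 2 + ε / 4) with hB
  have hBm : MeasurableSet B := Metric.isClosed_closedBall.measurableSet
  have hvol : volume.real B ≤ b - a + ε / 2 := by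
    rw [Measure.real, hB, AddCircle.volume_closedBall]
    refine ENNReal.toReal_le_of_le_ofReal (by linarith) (ENNReal.ofReal_le_ofReal ?_)
    refine (min_le_right _ _).trans (le_of_eq (by ring))
  have hiter : ∀ (k : ℕ) (y : UnitAddCircle),
      (fun y : UnitAddCircle => (α : UnitAddCircle) + y)^[k] y = ((k * α : ℝ) : UnitAddCircle) + y := by
    intro k y
    rw [add_left_iterate]
    simp
  have hae := ae_eventually_cavg_le herg (f := B.indicator 1) (measurable_one.indicator hBm)
    ((integrable_const 1).indicator hBm)
  obtain ⟨y, hy, hxy⟩ := (Measure.dense_of_ae hae).exists_dist_lt ((x : ℝ) : UnitAddCircle)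
    (by positivity : 0 < ε / 4)
  filter_upwards [hy (ε / 2) (by positivity)] with N hN
  rw [integral_indicator_one hBm] at hN
  refine (cavg_mono (fun k => ?_) N).trans (hN.trans (by linarith))
  rw [hiter]
  by_cases h : Int.fract (x + k * α) ∈ Set.Ico a b
  · have hmem : ((k * α : ℝ) : UnitAddCircle) + y ∈ B := by
      have h1 : ((x + k * α : ℝ) : UnitAddCircle) = ((Int.fract (x + k * α) : ℝ) : UnitAddCircle) := by
        rw [Int.fract]
        simp
      have h2 : dist ((x + k * α : ℝ) : UnitAddCircle) (((a + b) / 2 : ℝ) : UnitAddCircle) ≤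
          (b - a) / 2 := by
        rw [h1, dist_eq_norm, ← AddCircle.coe_sub]
        refine QuotientAddGroup.norm_mk_le_norm.trans ?_
        rw [Real.norm_eq_abs, abs_le]
        constructor <;> linarith [h.1, h.2]
      have h3 : dist (((k * α : ℝ) : UnitAddCircle) + y) ((x + k * α : ℝ) : UnitAddCircle) <
          ε / 4 := by
        rw [AddCircle.coe_add, add_comm (x : UnitAddCircle), dist_add_left, dist_comm]
        exact hxy
      rw [hB, Metric.mem_closedBall]
      linarith [dist_triangle (((k * α : ℝ) : UnitAddCircle) + y)
        ((x + k * α : ℝ) : UnitAddCircle) (((a + b) / 2 : ℝ) : UnitAddCircle)]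
    rw [Set.indicator_of_mem hmem, Set.indicator_of_mem h]
    rfl
  · rw [Set.indicator_of_notMem h]
    exact Set.indicator_nonneg (fun _ _ => zero_le_one) _

/-- The orbits of the rotation by `α` visit `A` with frequency equal to its length. -/
def RotationEquidistributed (α : ℝ) (A : Set ℝ) : Prop :=
  ∀ x : ℝ, Tendsto (cavg fun k => A.indicator (1 : ℝ → ℝ) (Int.fract (x + k * α))) atTop
    (𝓝 (volume.real A))

theorem rotationEquidistributed_Ico (hα : Irrational α) {a b : ℝ} (ha : 0 ≤ a) (hab : a ≤ b)
    (hb : b ≤ 1) : RotationEquidistributed α (Set.Ico a b) := by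
  intro x
  rw [Real.volume_real_Ico_of_le hab, tendsto_order]
  constructor
  · intro y hy
    have hε : 0 < (b - a - y) / 3 := by linarith
    filter_upwards [eventually_cavg_fract_le hα ha x hε, eventually_cavg_fract_le hα hb x hε,
      eventually_gt_atTop 0] with N h1 h2 hN
    have hN' : (N : ℝ) ≠ 0 := by positivity
    have h3 : cavg (fun _ => 1) N = 1 := by
      simp [cavg, hN']
    have h4 : (fun _ : ℕ => (1 : ℝ)) = fun k : ℕ =>
        ((Set.Ico 0 a).indicator (1 : ℝ → ℝ) (Int.fract (x + k * α)) +
          (Set.Ico b 1).indicator (1 : ℝ → ℝ) (Int.fract (x + k * α))) +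
          (Set.Ico a b).indicator (1 : ℝ → ℝ) (Int.fract (x + k * α)) := by
      ext k
      have h5 := Int.fract_nonneg (x + k * α)
      have h6 := Int.fract_lt_one (x + k * α)
      simp only [Set.indicator_apply, Set.mem_Ico, h5, h6, true_and, and_true, Pi.one_apply]
      split_ifs <;> first | (norm_num; done) | (exfalso; grind)
    rw [h4, cavg_add, cavg_add] at h3
    linarith
  · intro y hy
    filter_upwards [eventually_cavg_fract_le hα hab x (ε := (y - (b - a)) / 2) (by linarith)]
      with N h
    linarith

theorem rotationEquidistributed_Ico_inter (hα : Irrational α) (s : Finset (ℝ × ℝ)) :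
    ∀ a b : ℝ, Set.Ico a b ⊆ Set.Ico 0 1 →
      RotationEquidistributed α (Set.Ico a b ∩ ⋃ p ∈ s, Set.Ico p.1 p.2) := by
  classical
  have hempty : RotationEquidistributed α ∅ := fun x => by
    simp only [Set.indicator_empty, measureReal_empty]
    exact tendsto_const_nhds.congr fun N => by simp [cavg]
  have hIco : ∀ a b : ℝ, Set.Ico a b ⊆ Set.Ico 0 1 → RotationEquidistributed α (Set.Ico a b) := by
    intro a b h
    rcases lt_or_ge a b with hab | hab
    · rw [Set.Ico_subset_Ico_iff hab] at h
      exact rotationEquidistributed_Ico hα h.1 hab.le h.2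
    · rw [Set.Ico_eq_empty (not_lt.2 hab)]
      exact hempty
  induction s using Finset.induction_on with
  | empty => simpa using fun _ _ _ => hempty
  | insert p s hps ih =>
    intro a b h x
    set U := ⋃ p ∈ s, Set.Ico p.1 p.2 with hU
    have hUm : MeasurableSet U := Finset.measurableSet_biUnion _ fun _ _ => measurableSet_Ico
    have h1 : Set.Ico a b ∩ Set.Ico p.1 p.2 = Set.Ico (max a p.1) (min b p.2) := Set.Ico_inter_Ico
    have h2 : Set.Ico (max a p.1) (min b p.2) ⊆ Set.Ico 0 1 :=
      h1 ▸ Set.inter_subset_left.trans h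
    rw [Finset.set_biUnion_insert, Set.inter_union_distrib_left, h1]
    have hsplit : Set.Ico a b ∩ (U ∩ Set.Ico p.1 p.2) = Set.Ico (max a p.1) (min b p.2) ∩ U := by
      rw [← h1]
      ext y
      simp only [Set.mem_inter_iff]
      tauto
    have hi : Set.Ico (max a p.1) (min b p.2) ∩ (Set.Ico a b ∩ U) =
        Set.Ico (max a p.1) (min b p.2) ∩ U := by
      rw [← h1]
      ext y
      simp only [Set.mem_inter_iff]
      tauto
    have hfin : ∀ c d : ℝ, ∀ V : Set ℝ, volume (Set.Ico c d ∩ V) ≠ ⊤ := fun c d V =>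
      ((measure_mono Set.inter_subset_left).trans_lt measure_Ico_lt_top).ne
    have hvol : volume.real (Set.Ico (max a p.1) (min b p.2) ∪ Set.Ico a b ∩ U) =
        volume.real (Set.Ico (max a p.1) (min b p.2)) + volume.real (Set.Ico a b ∩ U) -
          volume.real (Set.Ico (max a p.1) (min b p.2) ∩ U) := by
      have := measureReal_union_add_inter (μ := volume) (s := Set.Ico (max a p.1) (min b p.2))
        (t := Set.Ico a b ∩ U) (measurableSet_Ico.inter hUm) measure_Ico_lt_top.ne (hfin _ _ _)
      rw [hi] at this
      linarith
    rw [hvol]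
    refine (((hIco _ _ h2 x).add (ih a b h x)).sub (ih _ _ h2 x)).congr fun N => ?_
    rw [← cavg_add, ← cavg_sub]
    congr 1
    ext k
    rw [← hi, ← Set.indicator_union_add_inter_apply 1 (Set.Ico (max a p.1) (min b p.2))
      (Set.Ico a b ∩ U)]
    ring

/-- Equidistribution of irrational rotations with respect to finite unions of intervals. -/
theorem rotationEquidistributed_of_isFinUnionIntervals (hα : Irrational α) {I : Set ℝ}
    (hI : IsFinUnionIntervals I) (hI01 : I ⊆ Set.Ico 0 1) : RotationEquidistributed α I := by
  obtain ⟨s, rfl⟩ := hI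
  have := rotationEquidistributed_Ico_inter hα s 0 1 le_rfl
  rwa [Set.inter_eq_right.2 hI01] at this

end Rotation

theorem abs_sum_range_sub_sum_range_le {f : ℕ → ℝ} {B : ℝ} (hf : ∀ k, |f k| ≤ B) {i j : ℕ}
    (hij : i ≤ j) :
    |∑ k ∈ Finset.range j, f k - ∑ k ∈ Finset.range i, f k| ≤ (j - i : ℕ) * B := by
  rw [← Finset.sum_Ico_eq_sub _ hij]
  refine (Finset.abs_sum_le_sum_abs _ _).trans ((Finset.sum_le_sum fun k _ => hf k).trans ?_)
  simp

/-- Cesàro averages may be computed along residue classes. -/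
theorem tendsto_cavg_of_residues {p : ℕ} (hp : 1 ≤ p) {f : ℕ → ℝ} {B : ℝ}
    (hf : ∀ k, |f k| ≤ B) {A : ℕ → ℝ}
    (h : ∀ i < p, Tendsto (cavg fun s => f (i + p * s)) atTop (𝓝 (A i))) :
    Tendsto (cavg f) atTop (𝓝 ((p : ℝ)⁻¹ * ∑ i ∈ Finset.range p, A i)) := by
  have hB : 0 ≤ B := (abs_nonneg _).trans (hf 0)
  have hp0 : (0 : ℝ) < p := by positivity
  have hdiv : Tendsto (fun N : ℕ => N / p) atTop atTop :=
    Nat.tendsto_div_const_atTop (by omega)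
  have hsum : ∀ M : ℕ, ∑ k ∈ Finset.range (p * M), f k =
      ∑ i ∈ Finset.range p, ∑ s ∈ Finset.range M, f (i + p * s) := by
    intro M
    rw [Finset.sum_comm]
    induction M with
    | zero => simp
    | succ M ih =>
      rw [Nat.mul_succ, Finset.sum_range_add, ih, Finset.sum_range_succ]
      simp only [add_comm]
  have hratio : Tendsto (fun N : ℕ => (N : ℝ)⁻¹ * ((N / p : ℕ) : ℝ)) atTop (𝓝 (p : ℝ)⁻¹) := by
    rw [← tendsto_sub_nhds_zero_iff]
    refine squeeze_zero_norm' ?_ tendsto_inv_atTop_nhds_zero_nat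
    filter_upwards [eventually_gt_atTop 0] with N hN
    have hN0 : (0 : ℝ) < N := by positivity
    have h1 : (p : ℝ) * ((N / p : ℕ) : ℝ) + ((N % p : ℕ) : ℝ) = N := by
      exact_mod_cast Nat.div_add_mod N p
    have h2 : ((N % p : ℕ) : ℝ) ≤ p := by exact_mod_cast (Nat.mod_lt N (by omega)).le
    have h3 : (N : ℝ)⁻¹ * ((N / p : ℕ) : ℝ) - (p : ℝ)⁻¹ =
        -((N : ℝ)⁻¹ * (((N % p : ℕ) : ℝ) * (p : ℝ)⁻¹)) := by
      field_simp
      linarith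
    rw [h3, norm_neg, Real.norm_of_nonneg (by positivity)]
    refine mul_le_of_le_one_right (by positivity) ?_
    rw [← div_eq_mul_inv, div_le_one hp0]
    exact h2
  have hmain : Tendsto (fun N : ℕ => (N : ℝ)⁻¹ * ((N / p : ℕ) : ℝ) *
      ∑ i ∈ Finset.range p, cavg (fun s => f (i + p * s)) (N / p)) atTop
      (𝓝 ((p : ℝ)⁻¹ * ∑ i ∈ Finset.range p, A i)) :=
    hratio.mul (tendsto_finsetSum _ fun i hi => (h i (Finset.mem_range.1 hi)).comp hdiv)
  have herr : Tendsto (fun N : ℕ => cavg f N - (N : ℝ)⁻¹ * ((N / p : ℕ) : ℝ) *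
      ∑ i ∈ Finset.range p, cavg (fun s => f (i + p * s)) (N / p)) atTop (𝓝 0) := by
    have hlim := (tendsto_inv_atTop_nhds_zero_nat (𝕜 := ℝ)).mul_const (2 * (p * B))
    rw [zero_mul] at hlim
    refine squeeze_zero_norm' ?_ hlim
    filter_upwards [eventually_ge_atTop p] with N hN
    set M := N / p with hM
    have hM1 : 1 ≤ M := (Nat.one_le_div_iff (by omega)).2 hN
    have hMN := Nat.div_add_mod N p
    have hmod := Nat.mod_lt N (show 0 < p by omega)
    rw [← hM] at hMN
    have h1 : (M : ℝ) * ∑ i ∈ Finset.range p, cavg (fun s => f (i + p * s)) M =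
        ∑ k ∈ Finset.range (p * (M + 1)), f k - ∑ k ∈ Finset.range p, f k := by
      have hM0 : (M : ℝ) ≠ 0 := by positivity
      rw [hsum, Finset.mul_sum, ← Finset.sum_sub_distrib]
      refine Finset.sum_congr rfl fun i _ => ?_
      rw [cavg, ← mul_assoc, mul_inv_cancel₀ hM0, one_mul, sum_Icc_one_eq,
        Finset.sum_range_succ' (fun s => f (i + p * s))]
      simp
    have h2 : ∑ k ∈ Finset.Icc 1 N, f k =
        ∑ k ∈ Finset.range (N + 1), f k - ∑ k ∈ Finset.range 1, f k := by
      rw [sum_Icc_one_eq, Finset.sum_range_succ']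
      simp
    have h3 := abs_sum_range_sub_sum_range_le hf (show N + 1 ≤ p * (M + 1) by
      rw [Nat.mul_succ]
      omega)
    have h4 := abs_sum_range_sub_sum_range_le hf hp
    have h5 : ((p * (M + 1) - (N + 1) : ℕ) : ℝ) * B ≤ p * B := by
      refine mul_le_mul_of_nonneg_right ?_ hB
      rw [Nat.mul_succ]
      exact_mod_cast (by omega : p * M + p - (N + 1) ≤ p)
    have h6 : ((p - 1 : ℕ) : ℝ) * B ≤ p * B :=
      mul_le_mul_of_nonneg_right (by exact_mod_cast Nat.sub_le p 1) hB
    rw [mul_assoc, h1, cavg, h2, ← mul_sub, Real.norm_eq_abs, abs_mul, abs_of_nonneg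
      (by positivity : (0 : ℝ) ≤ (N : ℝ)⁻¹)]
    refine mul_le_mul_of_nonneg_left ?_ (by positivity)
    rw [abs_le] at h3 h4 ⊢
    constructor <;> linarith
  have := herr.add hmain
  rw [zero_add] at this
  exact this.congr fun N => by ring

section SlowTime

variable {α t : ℝ}

theorem coe_lk (hα : 0 ≤ α) (ht : 0 ≤ t) (k : ℕ) : (lk α t k : ℤ) = ⌊t + α * k⌋ :=
  Int.toNat_of_nonneg (Int.floor_nonneg.2 (by positivity))

theorem isSlowTime_lk (hα0 : 0 < α) (hα1 : α < 1) (ht : t ∈ Set.Ico (0 : ℝ) 1) :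
    IsSlowTime (lk α t) := by
  have hc := coe_lk hα0.le ht.1
  have hle : ∀ k : ℕ, (lk α t k : ℝ) ≤ t + α * k := fun k => by
    have := Int.floor_le (t + α * k)
    rw [← hc] at this
    exact_mod_cast this
  have hlt : ∀ k : ℕ, t + α * k < lk α t k + 1 := fun k => by
    have := Int.lt_floor_add_one (t + α * k)
    rw [← hc] at this
    exact_mod_cast this
  have hαk : Tendsto (fun k : ℕ => α * (k : ℝ)) atTop atTop :=
    tendsto_natCast_atTop_atTop.const_mul_atTop hα0
  have hαk' : Tendsto (fun k : ℕ => (1 - α) * (k : ℝ)) atTop atTop :=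
    tendsto_natCast_atTop_atTop.const_mul_atTop (by linarith)
  refine ⟨?_, fun i j hij => ?_, fun k => ?_, ?_, ?_, ?_⟩
  · have h : ⌊t⌋ = 0 := Int.floor_eq_zero_iff.2 ht
    simp [lk, h]
  · refine Int.toNat_le_toNat (Int.floor_le_floor ?_)
    gcongr
  · have h1 := hle (k + 1)
    have h2 := hlt k
    push_cast at h1
    have h3 : (lk α t (k + 1) : ℝ) < lk α t k + 1 + 1 := by linarith
    have h4 : lk α t (k + 1) < lk α t k + 1 + 1 := by exact_mod_cast h3
    omega
  · refine tendsto_atTop.2 fun n => ?_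
    filter_upwards [hαk.eventually_ge_atTop (n : ℝ)] with k hk
    have h2 := hlt k
    have h3 : (n : ℝ) < lk α t k + 1 := by linarith [ht.1]
    have h4 : n < lk α t k + 1 := by exact_mod_cast h3
    omega
  · refine tendsto_atTop.2 fun n => ?_
    filter_upwards [hαk'.eventually_ge_atTop ((n : ℝ) + 1)] with k hk
    have h2 := hle k
    have h3 : (lk α t k : ℝ) + n ≤ k := by linarith [ht.2]
    have h4 : lk α t k + n ≤ k := by exact_mod_cast h3
    omega
  · obtain ⟨q, hq⟩ := exists_nat_gt (2 / α)
    refine ⟨q, fun k => ?_⟩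
    rw [div_lt_iff₀ hα0] at hq
    have h1 := hle k
    have h2 := hlt (k + q)
    push_cast at h2
    have h3 : (lk α t k : ℝ) < lk α t (k + q) := by nlinarith
    exact_mod_cast h3

/-- Periodic sequences sampled along `lk α t k` and along `k`, weighted by the visits of the
rotation to `I`, average to the product of the length of `I` and of the means. -/
theorem periodicallyEquidistributed_lk (hirr : Irrational α) (hα0 : 0 < α)
    (ht : t ∈ Set.Ico (0 : ℝ) 1) {I : Set ℝ} (hI : IsFinUnionIntervals I)
    (hI01 : I ⊆ Set.Ico 0 1) :
    PeriodicallyEquidistributed (fun k => I.indicator (1 : ℝ → ℝ) (Int.fract (t + k * α)))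
      (lk α t) (volume.real I) := by
  classical
  intro p hp u v hu hv
  have hp0 : (0 : ℝ) < p := by positivity
  have hpre : ∀ j : ℕ, j < p →
      RotationEquidistributed α ((fun y : ℝ => p * y - j) ⁻¹' I) := by
    intro j hj
    refine rotationEquidistributed_of_isFinUnionIntervals hirr ?_ fun y hy => ?_
    · obtain ⟨s, rfl⟩ := hI
      refine ⟨s.image fun q => ((q.1 + j) / p, (q.2 + j) / p), ?_⟩
      ext y
      simp only [Set.mem_preimage, Set.mem_iUnion, Finset.mem_image, Set.mem_Ico, exists_prop]
      constructor
      · rintro ⟨q, hq, h1, h2⟩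
        refine ⟨_, ⟨q, hq, rfl⟩, ?_, ?_⟩
        · rw [div_le_iff₀ hp0]
          linarith
        · rw [lt_div_iff₀ hp0]
          linarith
      · rintro ⟨_, ⟨q, hq, rfl⟩, h1, h2⟩
        rw [div_le_iff₀ hp0] at h1
        rw [lt_div_iff₀ hp0] at h2
        exact ⟨q, hq, by linarith, by linarith⟩
    · obtain ⟨h1, h2⟩ := hI01 hy
      have h3 : (j : ℝ) + 1 ≤ p := by exact_mod_cast hj
      have h4 : (0 : ℝ) ≤ j := Nat.cast_nonneg j
      constructor <;> nlinarith
  have hvol : ∀ j : ℕ, volume.real ((fun y : ℝ => p * y - j) ⁻¹' I) =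
      (p : ℝ)⁻¹ * volume.real I := by
    intro j
    have h1 : (fun y : ℝ => p * y - j) ⁻¹' I =
        (fun y => (p : ℝ) * y) ⁻¹' ((fun y => y + -(j : ℝ)) ⁻¹' I) := by
      ext y
      simp [sub_eq_add_neg]
    rw [Measure.real, h1, Real.volume_preimage_mul_left hp0.ne', measure_preimage_add_right,
      ENNReal.toReal_mul, ENNReal.toReal_ofReal (abs_nonneg _), abs_of_pos (by positivity)]
    rfl
  have hper : ∀ {g : ℕ → ℝ}, (∀ k, g (k + p) = g k) → ∀ i s : ℕ, g (i + p * s) = g i := by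
    intro g hg i s
    induction s with
    | zero => simp
    | succ s ih => rw [Nat.mul_succ, ← add_assoc, hg, ih]
  have hform : ∀ k : ℕ, I.indicator (1 : ℝ → ℝ) (Int.fract (t + k * α)) * u (lk α t k) =
      ∑ j ∈ Finset.range p, u j * ((fun y : ℝ => p * y - j) ⁻¹' I).indicator (1 : ℝ → ℝ)
        (Int.fract ((t + k * α) / p)) := by
    intro k
    set x := (t + k * α) / p with hx
    have hpx : t + k * α = p * x := by
      rw [hx]
      field_simp
    set j := lk α t k % p with hj
    have hjp : j < p := Nat.mod_lt _ (by omega)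
    have hdm : p * (lk α t k / p) + j = lk α t k := Nat.div_add_mod _ _
    set e := lk α t k / p with he
    have hfl : (lk α t k : ℤ) = ⌊t + k * α⌋ := by rw [coe_lk hα0.le ht.1, mul_comm]
    have hfl' : ((p * e + j : ℕ) : ℤ) = ⌊(p : ℝ) * x⌋ := by rw [hdm, hfl, hpx]
    have hb := Int.floor_eq_iff.1 hfl'.symm
    push_cast at hb
    have hj1 : (j : ℝ) + 1 ≤ p := by exact_mod_cast hjp
    have hflx : ⌊x⌋ = (e : ℤ) := by
      rw [Int.floor_eq_iff]
      push_cast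
      have : (0 : ℝ) ≤ j := Nat.cast_nonneg j
      constructor
      · exact le_of_mul_le_mul_left (by linarith : (p : ℝ) * e ≤ p * x) hp0
      · exact lt_of_mul_lt_mul_left (by linarith : (p : ℝ) * x < p * (e + 1)) hp0.le
    have hfx : Int.fract x = x - e := by rw [Int.fract, hflx]; simp
    have hft : Int.fract (t + k * α) = p * Int.fract x - j := by
      rw [hfx, hpx, Int.fract, ← hfl']
      push_cast
      ring
    rw [Finset.sum_eq_single_of_mem j (Finset.mem_range.2 hjp)]
    · rw [← hdm, add_comm (p * e), hper hu, mul_comm]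
      congr 1
      simp only [Set.indicator_apply, Set.mem_preimage, hft, Pi.one_apply]
    · intro i hi hij
      rw [Set.indicator_of_notMem, mul_zero]
      intro hmem
      obtain ⟨h1, h2⟩ := hI01 hmem
      have h3 := Int.fract_nonneg (t + k * α)
      have h4 := Int.fract_lt_one (t + k * α)
      rw [hft] at h3 h4
      have h5 : (i : ℝ) < j + 1 := by linarith
      have h6 : (j : ℝ) < i + 1 := by linarith
      have h7 : i < j + 1 := by exact_mod_cast h5
      have h8 : j < i + 1 := by exact_mod_cast h6
      omega
  have hbu : ∀ {g : ℕ → ℝ}, (∀ k, g (k + p) = g k) →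
      ∀ k, |g k| ≤ ∑ i ∈ Finset.range p, |g i| := by
    intro g hg k
    rw [← Nat.mod_add_div k p, hper hg]
    exact Finset.single_le_sum (f := fun i => |g i|) (fun i _ => abs_nonneg _)
      (Finset.mem_range.2 (Nat.mod_lt _ (by omega)))
  have hres := tendsto_cavg_of_residues hp
    (f := fun k => I.indicator (1 : ℝ → ℝ) (Int.fract (t + k * α)) * u (lk α t k) * v k)
    (B := 1 * (∑ i ∈ Finset.range p, |u i|) * ∑ i ∈ Finset.range p, |v i|) (fun k => by
      rw [abs_mul, abs_mul]
      refine mul_le_mul (mul_le_mul ?_ (hbu hu _) (abs_nonneg _) zero_le_one) (hbu hv _)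
        (abs_nonneg _) (by positivity)
      simp only [Set.indicator_apply]
      split_ifs <;> simp)
    (A := fun i => (∑ j ∈ Finset.range p, u j * ((p : ℝ)⁻¹ * volume.real I)) * v i)
    (fun i hi => ?_)
  · convert hres using 2
    rw [← Finset.mul_sum, ← Finset.sum_mul]
    ring
  · have h1 : Tendsto (fun N => (∑ j ∈ Finset.range p, u j * cavg (fun s =>
        ((fun y : ℝ => p * y - j) ⁻¹' I).indicator (1 : ℝ → ℝ)
          (Int.fract ((t + i * α) / p + s * α))) N) * v i) atTop
        (𝓝 ((∑ j ∈ Finset.range p, u j * ((p : ℝ)⁻¹ * volume.real I)) * v i)) := by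
      refine (tendsto_finsetSum _ fun j hj => ?_).mul_const _
      rw [← hvol j]
      exact (hpre j (Finset.mem_range.1 hj) _).const_mul _
    refine h1.congr fun N => ?_
    simp only [cavg, Finset.mul_sum, Finset.sum_mul]
    rw [Finset.sum_comm]
    refine Finset.sum_congr rfl fun s _ => ?_
    rw [hform, hper hv]
    simp only [Finset.mul_sum, Finset.sum_mul]
    refine Finset.sum_congr rfl fun j _ => ?_
    have : (t + ((i + p * s : ℕ) : ℝ) * α) / p = (t + i * α) / p + s * α := by
      push_cast
      field_simp
      ring
    rw [this]
    ring

end SlowTime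

section OneSided

variable {A : Type*}

theorem shiftN_iterate (k : ℕ) (ω : ℕ → A) (i : ℕ) : shiftN^[k] ω i = ω (i + k) := by
  induction k generalizing i with
  | zero => rfl
  | succ k ih =>
    rw [Function.iterate_succ_apply', shiftN, ih]
    congr 1
    omega

theorem mem_cylinder_append {u v : List A} {ω : ℕ → A} :
    ω ∈ cylinder (u ++ v) ↔ ω ∈ cylinder u ∧ shiftN^[u.length] ω ∈ cylinder v := by
  simp only [_root_.cylinder, Set.mem_ofPred_eq, Fin.forall_iff, List.get_eq_getElem, shiftN_iterate,
    List.length_append]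
  constructor
  · refine fun h => ⟨fun i hi => ?_, fun i hi => ?_⟩
    · rw [h i (by omega), List.getElem_append_left]
    · rw [h (i + u.length) (by omega), List.getElem_append_right (by omega)]
      simp
  · rintro ⟨h1, h2⟩ i hi
    by_cases hiu : i < u.length
    · rw [h1 i hiu, List.getElem_append_left]
    · rw [List.getElem_append_right (by omega), ← h2 _ (by omega)]
      congr 1
      omega

theorem prepend_shiftN_iterate {a : List A} {ω : ℕ → A} (h : ω ∈ cylinder a) :
    prepend a (shiftN^[a.length] ω) = ω := by
  ext i
  rw [prepend]
  split_ifs with hi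
  · exact (h ⟨i, hi⟩).symm
  · rw [shiftN_iterate]
    congr 1
    omega

theorem birkhoff_add (φ : (ℕ → A) → ℝ) (i j : ℕ) (ω : ℕ → A) :
    birkhoff φ (i + j) ω = birkhoff φ i ω + birkhoff φ j (shiftN^[i] ω) := by
  simp only [birkhoff, Finset.sum_range_add, ← Function.iterate_add_apply, add_comm]

theorem shiftN_iterate_mem_SFT {M : A → A → Prop} {ω : ℕ → A} (h : ω ∈ SFT M) (k : ℕ) :
    shiftN^[k] ω ∈ SFT M := fun i => by
  simp only [shiftN_iterate]
  rw [add_right_comm]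
  exact h (i + k)

theorem measurableSet_cylinder [MeasurableSpace A] [MeasurableSingletonClass A] (a : List A) :
    MeasurableSet (cylinder a) := by
  have : cylinder a = ⋂ i : Fin a.length, (fun ω : ℕ → A => ω i) ⁻¹' {a.get i} := by
    ext ω
    simp [_root_.cylinder]
  rw [this]
  exact MeasurableSet.iInter fun i => measurable_pi_apply _ (measurableSet_singleton _)

theorem measurableSet_SFT [MeasurableSpace A] [MeasurableSingletonClass A] [Countable A]
    (M : A → A → Prop) : MeasurableSet (SFT M) := by
  have : SFT M = ⋂ k : ℕ, (fun ω : ℕ → A => (ω k, ω (k + 1))) ⁻¹' {q | M q.1 q.2} := by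
    ext ω
    simp [SFT]
  rw [this]
  exact MeasurableSet.iInter fun k =>
    (measurable_pi_apply _).prodMk (measurable_pi_apply _) (Set.to_countable _).measurableSet

/-- The exponential weight `exp (-j P + S_j φ)`. -/
noncomputable def gibbsWeight (φ : (ℕ → A) → ℝ) (P : ℝ) (j : ℕ) (ω : ℕ → A) : ℝ :=
  Real.exp (-(j : ℝ) * P + birkhoff φ j ω)

theorem gibbsWeight_add (φ : (ℕ → A) → ℝ) (P : ℝ) (i j : ℕ) (ω : ℕ → A) :
    gibbsWeight φ P (i + j) ω = gibbsWeight φ P i ω * gibbsWeight φ P j (shiftN^[i] ω) := by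
  simp only [gibbsWeight, birkhoff_add, ← Real.exp_add]
  congr 1
  push_cast
  ring

theorem gibbsWeight_pos (φ : (ℕ → A) → ℝ) (P : ℝ) (j : ℕ) (ω : ℕ → A) :
    0 < gibbsWeight φ P j ω := Real.exp_pos _

/-- Two-sided comparison of the measure of cylinders with the weights, with constant `K`. -/
def IsGibbsWith [MeasurableSpace A] (Y : Set (ℕ → A)) (μ : Measure (ℕ → A)) (φ : (ℕ → A) → ℝ)
    (P K : ℝ) : Prop :=
  ∀ (a : List A), ∀ ω ∈ cylinder a, ω ∈ Y →
    gibbsWeight φ P a.length ω ≤ K * μ.real (cylinder a) ∧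
      μ.real (cylinder a) ≤ K * gibbsWeight φ P a.length ω

theorem HasGibbsProperty.exists_isGibbsWith [MeasurableSpace A] {Y : Set (ℕ → A)}
    {μ : Measure (ℕ → A)} {φ : (ℕ → A) → ℝ} {P : ℝ} (h : HasGibbsProperty Y μ φ P) :
    ∃ K > 0, IsGibbsWith Y μ φ P K := by
  obtain ⟨K, hK, h⟩ := h
  refine ⟨K, hK, fun a ω ha hY => ?_⟩
  have h1 := h a (shiftN^[a.length] ω)
  rw [prepend_shiftN_iterate ha] at h1
  obtain ⟨h2, h3⟩ := h1 hY
  exact ⟨(inv_mul_le_iff₀ hK).1 h2, h3⟩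

variable [MeasurableSpace A] {M : A → A → Prop} {μ : Measure (ℕ → A)} [IsProbabilityMeasure μ]
  {φ : (ℕ → A) → ℝ} {P K : ℝ}

theorem measureReal_eq_zero_of_inter_SFT_eq_empty [MeasurableSingletonClass A] [Countable A]
    (hμ : μ (SFT M) = 1) {E : Set (ℕ → A)} (hE : ¬(E ∩ SFT M).Nonempty) : μ.real E = 0 := by
  rw [Set.not_nonempty_iff_eq_empty, ← Set.disjoint_iff_inter_eq_empty] at hE
  have h1 := (prob_compl_eq_zero_iff (measurableSet_SFT M)).2 hμ
  rw [measureReal_eq_zero_iff]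
  exact measure_mono_null hE.subset_compl_right h1

theorem IsGibbsWith.measureReal_append_le [MeasurableSingletonClass A] [Countable A]
    (h : IsGibbsWith (SFT M) μ φ P K) (hK : 0 < K) (hμ : μ (SFT M) = 1) (u v : List A) :
    μ.real (cylinder (u ++ v)) ≤ K ^ 3 * (μ.real (cylinder u) * μ.real (cylinder v)) := by
  by_cases hne : (cylinder (u ++ v) ∩ SFT M).Nonempty
  · obtain ⟨ω, hω, hY⟩ := hne
    obtain ⟨hu, hv⟩ := mem_cylinder_append.1 hω
    have h1 := (h _ ω hω hY).2
    have h2 := (h u ω hu hY).1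
    have h3 := (h v _ hv (shiftN_iterate_mem_SFT hY _)).1
    rw [List.length_append, gibbsWeight_add] at h1
    calc _ ≤ K * ((K * μ.real (cylinder u)) * (K * μ.real (cylinder v))) :=
          h1.trans (mul_le_mul_of_nonneg_left (mul_le_mul h2 h3 (gibbsWeight_pos ..).le
            (by positivity)) hK.le)
      _ = _ := by ring
  · rw [measureReal_eq_zero_of_inter_SFT_eq_empty hμ hne]
    positivity

theorem IsHolder.exists_abs_le {Y : Set (ℕ → A)} (hY : Y.Nonempty) {ρ : ℝ}
    (h : IsHolder Y φ ρ) : ∃ B, 0 ≤ B ∧ ∀ ω ∈ Y, |φ ω| ≤ B := by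
  obtain ⟨K, hK, h⟩ := h
  obtain ⟨ω₀, hω₀⟩ := hY
  refine ⟨K + |φ ω₀|, by positivity, fun ω hω => ?_⟩
  have h1 := h ω hω ω₀ hω₀ 0 (by simp)
  rw [pow_zero, mul_one] at h1
  calc |φ ω| = |(φ ω - φ ω₀) + φ ω₀| := by rw [sub_add_cancel]
    _ ≤ _ := (abs_add_le _ _).trans (by linarith)

/-- Two points of an irreducible subshift can be joined by a short word. -/
theorem IrreducibleTransition.exists_joining [Finite A] (hM : IrreducibleTransition M) :
    ∃ L : ℕ, ∀ (w : ℕ) (ω₁ ω₂ : ℕ → A), 1 ≤ w → ω₁ ∈ SFT M → ω₂ ∈ SFT M →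
      ∃ s < L, ∃ ω ∈ SFT M, (∀ i < w, ω i = ω₁ i) ∧ shiftN^[w + s] ω = ω₂ := by
  choose k hk p hp0 hpk hp using hM
  obtain ⟨L, hL⟩ := (Set.finite_range fun q : A × A => k q.1 q.2).bddAbove
  refine ⟨L, fun w ω₁ ω₂ hw h1 h2 => ?_⟩
  set a := ω₁ (w - 1) with ha
  set b := ω₂ 0 with hb
  have hkL : k a b ≤ L := hL ⟨(a, b), rfl⟩
  have hk1 := hk a b
  set q := p a b with hq
  refine ⟨k a b - 1, by omega, fun i => if i < w then ω₁ i else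
    if i < w + (k a b - 1) then q (i - w + 1) else ω₂ (i - (w + (k a b - 1))), ?_, ?_, ?_⟩
  · intro i
    dsimp only
    by_cases hi : i + 1 < w
    · rw [if_pos (by omega), if_pos hi]
      exact h1 i
    by_cases hi2 : i < w
    · have hiw : i = w - 1 := by omega
      rw [if_pos hi2, if_neg hi, hiw, ← ha]
      have h0 := hp a b 0 (by omega)
      rw [hp0] at h0
      split_ifs with h
      · convert h0 using 2
        omega
      · have hk2 : k a b = 1 := by omega
        have h3 := hpk a b
        rw [hk2] at h3
        rw [h3] at h0
        convert h0 using 1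
        rw [hb]
        congr 1
        omega
    rw [if_neg hi2, if_neg hi]
    by_cases hi3 : i + 1 < w + (k a b - 1)
    · rw [if_pos (by omega), if_pos hi3]
      convert hp a b (i - w + 1) (by omega) using 2
      omega
    by_cases hi4 : i < w + (k a b - 1)
    · rw [if_pos hi4, if_neg hi3]
      convert hp a b (i - w + 1) (by omega) using 1
      have e1 : i - w + 1 + 1 = k a b := by omega
      have e2 : i + 1 - (w + (k a b - 1)) = 0 := by omega
      rw [e1, hpk, e2]
    · rw [if_neg hi4, if_neg hi3]
      have e1 : i + 1 - (w + (k a b - 1)) = i - (w + (k a b - 1)) + 1 := by omega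
      rw [e1]
      exact h2 _
  · intro i hi
    exact if_pos hi
  · ext i
    rw [shiftN_iterate, if_neg (by omega), if_neg (by omega)]
    congr 1
    omega

theorem gibbsWeight_ge {B : ℝ} (hB0 : 0 ≤ B) (hB : ∀ ω ∈ SFT M, |φ ω| ≤ B) {s L : ℕ}
    (hs : s ≤ L) {ω : ℕ → A} (hω : ω ∈ SFT M) :
    Real.exp (-(L * (|P| + B))) ≤ gibbsWeight φ P s ω := by
  refine Real.exp_le_exp.2 ?_
  have h1 : |birkhoff φ s ω| ≤ s * B := by
    refine (Finset.abs_sum_le_sum_abs _ _).trans ((Finset.sum_le_sum fun i _ =>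
      hB _ (shiftN_iterate_mem_SFT hω i)).trans ?_)
    simp
  have h2 : (s : ℝ) * (|P| + B) ≤ L * (|P| + B) :=
    mul_le_mul_of_nonneg_right (by exact_mod_cast hs) (by positivity)
  have h3 : (s : ℝ) * P ≤ s * |P| := mul_le_mul_of_nonneg_left (le_abs_self P) (by positivity)
  have h4 := (abs_le.1 h1).1
  nlinarith

theorem IsGibbsWith.exists_le_measureReal_append [MeasurableSingletonClass A] [Finite A]
    (h : IsGibbsWith (SFT M) μ φ P K) (hK : 0 < K) (hμ : μ (SFT M) = 1)
    (hM : IrreducibleTransition M) {ρ : ℝ} (hφ : IsHolder (SFT M) φ ρ) :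
    ∃ L : ℕ, ∃ c > 0, ∀ u v : List A, u ≠ [] → ∃ x : List A, (x.length < L ∨ x = []) ∧
      c * (μ.real (cylinder u) * μ.real (cylinder v)) ≤ μ.real (cylinder (u ++ (x ++ v))) := by
  have hne : (SFT M).Nonempty := nonempty_of_measure_ne_zero (by rw [hμ]; exact one_ne_zero)
  obtain ⟨B, hB0, hB⟩ := hφ.exists_abs_le hne
  obtain ⟨L, hL⟩ := hM.exists_joining
  refine ⟨L, (K ^ 3)⁻¹ * Real.exp (-(L * (|P| + B))), by positivity, fun u v hu => ?_⟩
  by_cases hu' : (cylinder u ∩ SFT M).Nonempty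
  swap
  · refine ⟨[], Or.inr rfl, ?_⟩
    rw [measureReal_eq_zero_of_inter_SFT_eq_empty hμ hu', zero_mul, mul_zero]
    exact measureReal_nonneg
  by_cases hv' : (cylinder v ∩ SFT M).Nonempty
  swap
  · refine ⟨[], Or.inr rfl, ?_⟩
    rw [measureReal_eq_zero_of_inter_SFT_eq_empty hμ hv', mul_zero, mul_zero]
    exact measureReal_nonneg
  obtain ⟨ω₁, hu₁, hY₁⟩ := hu'
  obtain ⟨ω₂, hv₂, hY₂⟩ := hv'
  obtain ⟨s, hs, ω, hY, hω₁, hω₂⟩ := hL u.length ω₁ ω₂ (List.length_pos_iff.2 hu) hY₁ hY₂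
  set x : List A := List.ofFn fun j : Fin s => ω (u.length + j) with hx
  have hxl : x.length = s := by simp [hx]
  have hωu : ω ∈ cylinder u := fun i => (hω₁ i i.2).trans (hu₁ i)
  have hωx : shiftN^[u.length] ω ∈ cylinder x := fun i => by
    rw [shiftN_iterate]
    simp [hx, add_comm]
  have hωv : shiftN^[x.length] (shiftN^[u.length] ω) = ω₂ := by
    rw [← Function.iterate_add_apply, hxl, add_comm, hω₂]
  have hmem : ω ∈ cylinder (u ++ (x ++ v)) := by
    rw [mem_cylinder_append, mem_cylinder_append, hωv]
    exact ⟨hωu, hωx, hv₂⟩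
  refine ⟨x, Or.inl (by rwa [hxl]), ?_⟩
  have h1 := (h _ ω hmem hY).1
  rw [List.length_append, List.length_append, gibbsWeight_add, gibbsWeight_add, hωv] at h1
  have h2 := (h u ω hωu hY).2
  have h3 := (h v ω₂ hv₂ hY₂).2
  have h4 := gibbsWeight_ge (P := P) hB0 hB (s := x.length) (L := L) (hxl.trans_le hs.le)
    (shiftN_iterate_mem_SFT hY u.length)
  set e := Real.exp (-(L * (|P| + B))) with he
  have he0 : 0 < e := Real.exp_pos _
  have h5 : μ.real (cylinder u) * (e * μ.real (cylinder v)) ≤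
      (K * gibbsWeight φ P u.length ω) * (gibbsWeight φ P x.length (shiftN^[u.length] ω) *
        (K * gibbsWeight φ P v.length ω₂)) := by
    have := gibbsWeight_pos φ P u.length ω
    have := gibbsWeight_pos φ P x.length (shiftN^[u.length] ω)
    gcongr
  rw [mul_assoc, inv_mul_le_iff₀ (by positivity)]
  nlinarith [mul_le_mul_of_nonneg_left h1 (by positivity : (0 : ℝ) ≤ K ^ 2)]

end OneSided

section FiniteAtoms

variable {X : Type*} [m0 : MeasurableSpace X] {D : ℕ → Type*} [∀ n, Fintype (D n)]
  [∀ n, MeasurableSpace (D n)] [∀ n, MeasurableSingletonClass (D n)] {Q : ∀ n, X → D n}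

theorem measureReal_preimage_eq_sum {E : Type*} [Fintype E] [MeasurableSpace E]
    [MeasurableSingletonClass E] {μ : Measure X} [IsFiniteMeasure μ] {q : X → E}
    (hq : Measurable q) (U : Finset E) :
    μ.real (q ⁻¹' U) = ∑ d ∈ U, μ.real (q ⁻¹' {d}) := by
  have h : ∀ s : Set E, μ.real (q ⁻¹' s) = (μ.map q).real s := fun s =>
    (map_measureReal_apply hq (Set.toFinite s).measurableSet).symm
  simp only [h, sum_measureReal_singleton]

/-- Domination of measures can be checked on the atoms of a generating sequence of finite
partitions. -/
theorem measure_le_smul_of_atoms {μ₁ μ₂ : Measure X} [IsProbabilityMeasure μ₁]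
    [IsProbabilityMeasure μ₂] (hmono : Monotone fun n => MeasurableSpace.comap (Q n) inferInstance)
    (hQ : ⨆ n, MeasurableSpace.comap (Q n) inferInstance = m0) {C : ℝ≥0}
    (h : ∀ n d, μ₁.real (Q n ⁻¹' {d}) ≤ C * μ₂.real (Q n ⁻¹' {d})) :
    μ₁ ≤ (C : ℝ≥0∞) • μ₂ := by
  have hle : ∀ n, MeasurableSpace.comap (Q n) inferInstance ≤ m0 := fun n =>
    (le_iSup (fun n => MeasurableSpace.comap (Q n) inferInstance) n).trans hQ.le
  have hQm : ∀ n, Measurable (Q n) := fun n => measurable_iff_comap_le.2 (hle n)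
  set μ : Measure X := (2⁻¹ : ℝ≥0) • (μ₁ + μ₂) with hμ
  have hμr : ∀ s, μ.real s = 2⁻¹ * (μ₁.real s + μ₂.real s) := fun s => by
    rw [hμ, measureReal_nnreal_smul_apply, measureReal_add_apply]
    simp
  have : IsProbabilityMeasure μ := ⟨by
    rw [hμ]
    simp only [Measure.smul_apply, Measure.add_apply, measure_univ, ENNReal.smul_def]
    rw [one_add_one_eq_two, smul_eq_mul, ENNReal.coe_inv two_ne_zero]
    exact ENNReal.inv_mul_cancel (by simp) (by simp)⟩
  refine Measure.le_iff.2 fun s hs => ?_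
  have key : μ₁.real s ≤ C * μ₂.real s := by
    refine le_of_forall_pos_le_add fun δ hδ => ?_
    obtain ⟨n, s', ⟨U, hU, rfl⟩, hlt⟩ := exists_measurableSet_symmDiff_lt (μ := μ) hmono hle
      (hQ.symm ▸ hs) (show 0 < δ / (2 * (1 + C)) by positivity)
    have h1 : μ₁.real (Q n ⁻¹' U) ≤ C * μ₂.real (Q n ⁻¹' U) := by
      classical
      have h1 := measureReal_preimage_eq_sum (μ := μ₁) (hQm n) (Set.toFinite U).toFinset
      have h2 := measureReal_preimage_eq_sum (μ := μ₂) (hQm n) (Set.toFinite U).toFinset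
      rw [Set.Finite.coe_toFinset] at h1 h2
      rw [h1, h2, Finset.mul_sum]
      exact Finset.sum_le_sum fun d _ => h n d
    rw [hμr, lt_div_iff₀ (by positivity)] at hlt
    have h2 : ∀ (μ' : Measure X) [IsProbabilityMeasure μ'] (A B : Set X),
        μ'.real A ≤ μ'.real B + μ'.real (symmDiff A B) := fun μ' _ A B => by
      have : A ⊆ B ∪ symmDiff A B := fun x hx => by
        by_cases hB : x ∈ B
        · exact Or.inl hB
        · exact Or.inr (Or.inl ⟨hx, hB⟩)
      exact (measureReal_mono this).trans (measureReal_union_le _ _)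
    have h3 := h2 μ₁ s (Q n ⁻¹' U)
    have h4 := h2 μ₂ (Q n ⁻¹' U) s
    rw [symmDiff_comm] at h4
    have h5 : 0 ≤ μ₁.real (symmDiff s (Q n ⁻¹' U)) := measureReal_nonneg
    have h6 : 0 ≤ μ₂.real (symmDiff s (Q n ⁻¹' U)) := measureReal_nonneg
    have h7 : (C : ℝ) * μ₂.real (Q n ⁻¹' U) ≤ C * (μ₂.real s + μ₂.real (symmDiff s (Q n ⁻¹' U))) :=
      mul_le_mul_of_nonneg_left h4 C.2
    have h8 : 0 ≤ (C : ℝ) * μ₁.real (symmDiff s (Q n ⁻¹' U)) := mul_nonneg C.2 h5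
    nlinarith
  rw [Measure.smul_apply, smul_eq_mul, ← ofReal_measureReal, ← ofReal_measureReal (μ := μ₂),
    ← ENNReal.ofReal_coe_nnreal, ← ENNReal.ofReal_mul C.coe_nonneg]
  exact ENNReal.ofReal_le_ofReal key

/-- A mixing-type lower bound on the atoms of a generating sequence of finite partitions implies
ergodicity. -/
theorem ergodic_of_atoms {ν : Measure X} [IsProbabilityMeasure ν] {S : X → X}
    (hS : MeasurePreserving S ν ν)
    (hmono : Monotone fun n => MeasurableSpace.comap (Q n) inferInstance)
    (hQ : ⨆ n, MeasurableSpace.comap (Q n) inferInstance = m0) {c : ℝ} (hc : 0 < c) (L : ℕ)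
    (w : ℕ → ℕ)
    (h : ∀ n d d', c * (ν.real (Q n ⁻¹' {d}) * ν.real (Q n ⁻¹' {d'})) ≤
      ∑ l ∈ Finset.range L, ν.real (Q n ⁻¹' {d} ∩ S^[w n + l] ⁻¹' (Q n ⁻¹' {d'}))) :
    Ergodic S ν := by
  have hle : ∀ n, MeasurableSpace.comap (Q n) inferInstance ≤ m0 := fun n =>
    (le_iSup (fun n => MeasurableSpace.comap (Q n) inferInstance) n).trans hQ.le
  have hQm : ∀ n, Measurable (Q n) := fun n => measurable_iff_comap_le.2 (hle n)
  have hwin : ∀ n (U V : Finset (D n)), c * (ν.real (Q n ⁻¹' U) * ν.real (Q n ⁻¹' V)) ≤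
      ∑ l ∈ Finset.range L, ν.real (Q n ⁻¹' U ∩ S^[w n + l] ⁻¹' (Q n ⁻¹' V)) := by
    intro n U V
    have h1 : ∀ l, ν.real (Q n ⁻¹' U ∩ S^[w n + l] ⁻¹' (Q n ⁻¹' V)) =
        ∑ d ∈ U, ∑ d' ∈ V, ν.real (Q n ⁻¹' {d} ∩ S^[w n + l] ⁻¹' (Q n ⁻¹' {d'})) := fun l => by
      have h2 := measureReal_preimage_eq_sum (μ := ν) (q := fun x => (Q n x, Q n (S^[w n + l] x)))
        ((hQm n).prodMk ((hQm n).comp (hS.iterate _).measurable)) (U ×ˢ V)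
      rw [Finset.sum_product] at h2
      convert h2 using 2
      · ext x
        simp
      · refine Finset.sum_congr rfl fun d' _ => ?_
        congr 1
        ext x
        simp
    rw [measureReal_preimage_eq_sum (hQm n), measureReal_preimage_eq_sum (hQm n),
      Finset.sum_mul_sum]
    simp only [h1, Finset.mul_sum]
    rw [Finset.sum_comm]
    simp_rw [Finset.sum_comm (s := Finset.range L)]
    rw [Finset.sum_comm]
    exact Finset.sum_le_sum fun d _ => Finset.sum_le_sum fun d' _ => h n d d'
  refine ⟨hS, ⟨fun E hE hinv => ?_⟩⟩
  have hit : ∀ k, S^[k] ⁻¹' E = E := fun k => by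
    rw [Set.preimage_iterate_eq]
    exact Function.iterate_fixed hinv k
  have hp1 : ν.real Eᶜ = 1 - ν.real E := probReal_compl_eq_one_sub hE
  have key : c * (ν.real E * ν.real Eᶜ) ≤ 0 := by
    refine le_of_forall_pos_le_add fun δ hδ => ?_
    obtain ⟨n, s', ⟨U, hU, rfl⟩, hlt⟩ := exists_measurableSet_symmDiff_lt (μ := ν) hmono hle
      (hQ.symm ▸ hE) (show 0 < min 1 (δ / (2 * L + 3 * c)) by positivity)
    set ε := ν.real (symmDiff E (Q n ⁻¹' U)) with hε
    have hε0 : 0 ≤ ε := measureReal_nonneg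
    obtain ⟨hε1, hεδ⟩ := lt_min_iff.1 hlt
    rw [lt_div_iff₀ (by positivity)] at hεδ
    classical
    have h1 := hwin n (Set.toFinite U).toFinset (Set.toFinite U).toFinsetᶜ
    simp only [Set.Finite.coe_toFinset, Finset.coe_compl, Set.preimage_compl] at h1
    set V := Q n ⁻¹' U with hV
    have hVm : MeasurableSet V := hQm n hU
    have h2 : ∀ l, ν.real (V ∩ (S^[w n + l] ⁻¹' V)ᶜ) ≤ 2 * ε := fun l => by
      have hsub : V ∩ (S^[w n + l] ⁻¹' V)ᶜ ⊆ symmDiff E V ∪ S^[w n + l] ⁻¹' (symmDiff E V) := by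
        rintro x ⟨hx, hx'⟩
        have hiff : S^[w n + l] x ∈ E ↔ x ∈ E := by
          rw [← Set.mem_preimage, hit]
        by_cases hxE : x ∈ E
        · exact Or.inr (Or.inl ⟨hiff.2 hxE, hx'⟩)
        · exact Or.inl (Or.inr ⟨hx, hxE⟩)
      refine (measureReal_mono hsub).trans ((measureReal_union_le _ _).trans ?_)
      rw [(hS.iterate _).measureReal_preimage (hE.symmDiff hVm).nullMeasurableSet]
      linarith
    have h3 := Finset.sum_le_sum fun l (_ : l ∈ Finset.range L) => h2 l
    rw [Finset.sum_const, Finset.card_range, nsmul_eq_mul] at h3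
    have hE1 : ν.real E ≤ ν.real V + ε := by
      have : E ⊆ V ∪ symmDiff E V := fun x hx => by
        by_cases hB : x ∈ V
        · exact Or.inl hB
        · exact Or.inr (Or.inl ⟨hx, hB⟩)
      exact (measureReal_mono this).trans (measureReal_union_le _ _)
    have hE2 : ν.real V ≤ ν.real E + ε := by
      have : V ⊆ E ∪ symmDiff E V := fun x hx => by
        by_cases hB : x ∈ E
        · exact Or.inl hB
        · exact Or.inr (Or.inr ⟨hx, hB⟩)
      exact (measureReal_mono this).trans (measureReal_union_le _ _)
    rw [probReal_compl_eq_one_sub hVm] at h1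
    rw [hp1]
    have h01 : ν.real V ≤ 1 := measureReal_le_one
    have h02 : 0 ≤ ν.real V := measureReal_nonneg
    have h03 : ν.real E ≤ 1 := measureReal_le_one
    have h04 : ν.real E * (1 - ν.real E) ≤ (ν.real V + ε) * (1 - ν.real V + ε) :=
      mul_le_mul hE1 (by linarith) (by linarith) (by linarith)
    have h05 : ν.real E * (1 - ν.real E) ≤ ν.real V * (1 - ν.real V) + 2 * ε := by nlinarith
    nlinarith [mul_le_mul_of_nonneg_left h05 hc.le]
  have h0 : ν.real E * ν.real Eᶜ = 0 :=
    le_antisymm (nonpos_of_mul_nonpos_right key hc) (by positivity)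
  rw [eventuallyConst_set']
  rcases mul_eq_zero.1 h0 with h1 | h1
  · exact Or.inl (ae_eq_empty.2 ((measureReal_eq_zero_iff).1 h1))
  · exact Or.inr (ae_eq_univ.2 ((measureReal_eq_zero_iff).1 h1))

end FiniteAtoms

section TwoSided

variable {A : Type*}

/-- The sequences in which the word `u` occurs at position `i`. -/
def cylinderZ (i : ℤ) (u : List A) : Set (ℤ → A) :=
  {ω | ∀ j : Fin u.length, ω (i + (j : ℕ)) = u.get j}

theorem preimage_futureZ_cylinder (u : List A) : futureZ ⁻¹' cylinder u = cylinderZ 1 u := by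
  ext ω
  simp [_root_.cylinder, cylinderZ, futureZ, add_comm]

theorem preimage_shiftZ_iterate_cylinderZ (k : ℕ) (i : ℤ) (u : List A) :
    shiftZ^[k] ⁻¹' cylinderZ i u = cylinderZ (i + k) u := by
  ext ω
  simp only [cylinderZ, Set.mem_preimage, Set.mem_ofPred_eq, shiftZ_iterate, add_right_comm]

theorem cylinderZ_append (i : ℤ) (u v : List A) :
    cylinderZ i (u ++ v) = cylinderZ i u ∩ cylinderZ (i + u.length) v := by
  ext ω
  simp only [cylinderZ, Set.mem_inter_iff, Set.mem_ofPred_eq, Fin.forall_iff,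
    List.get_eq_getElem, List.length_append]
  constructor
  · refine fun h => ⟨fun j hj => ?_, fun j hj => ?_⟩
    · rw [h j (by omega), List.getElem_append_left]
    · have := h (u.length + j) (by omega)
      rw [List.getElem_append_right (by omega)] at this
      push_cast at this
      rw [add_assoc, this]
      simp
  · rintro ⟨h1, h2⟩ j hj
    by_cases hju : j < u.length
    · rw [h1 j hju, List.getElem_append_left]
    · rw [List.getElem_append_right (by omega), ← h2 _ (by omega)]
      congr 1
      omega

theorem mem_cylinderZ_ofFn {n : ℕ} {i : ℤ} {d : Fin n → A} {ω : ℤ → A} :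
    ω ∈ cylinderZ i (List.ofFn d) ↔ ∀ j : Fin n, ω (i + (j : ℕ)) = d j := by
  simp only [cylinderZ, Set.mem_ofPred_eq, Fin.forall_iff, List.get_eq_getElem,
    List.length_ofFn, List.getElem_ofFn]

variable [MeasurableSpace A] [MeasurableSingletonClass A] {ν : Measure (ℤ → A)}

theorem measurableSet_cylinderZ (i : ℤ) (u : List A) : MeasurableSet (cylinderZ i u) := by
  have : cylinderZ i u = ⋂ j : Fin u.length, (fun ω : ℤ → A => ω (i + (j : ℕ))) ⁻¹' {u.get j} := by
    ext ω
    simp [cylinderZ]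
  rw [this]
  exact MeasurableSet.iInter fun j => measurable_pi_apply _ (measurableSet_singleton _)

theorem measureReal_cylinderZ (hS : MeasurePreserving shiftZ ν ν) (i : ℤ) (u : List A) :
    ν.real (cylinderZ i u) = (ν.map futureZ).real (cylinder u) := by
  have hk : ∀ (k : ℕ) (i : ℤ), ν.real (cylinderZ (i + k) u) = ν.real (cylinderZ i u) := by
    intro k i
    rw [← preimage_shiftZ_iterate_cylinderZ]
    exact (hS.iterate k).measureReal_preimage (measurableSet_cylinderZ i u).nullMeasurableSet
  rw [map_measureReal_apply measurable_futureZ (measurableSet_cylinder u),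
    preimage_futureZ_cylinder]
  rcases le_total i 1 with h | h
  · rw [← hk (1 - i).toNat i]
    congr 2
    omega
  · rw [← hk (i - 1).toNat 1]
    congr 2
    omega

/-- Quasi-multiplicativity from above of the one-sided marginal bounds the joint law of past and
future by the product law. -/
theorem map_past_future_le_prod [Fintype A] [IsProbabilityMeasure ν]
    (hS : MeasurePreserving shiftZ ν ν) {C : ℝ≥0}
    (hC : ∀ u v : List A, (ν.map futureZ).real (cylinder (u ++ v)) ≤
      C * ((ν.map futureZ).real (cylinder u) * (ν.map futureZ).real (cylinder v))) :
    ν.map (fun ω => (pastZ ω, futureZ ω)) ≤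
      (C : ℝ≥0∞) • (ν.map pastZ).prod (ν.map futureZ) := by
  have hpf : Measurable fun ω : ℤ → A => (pastZ ω, futureZ ω) :=
    measurable_pastZ.prodMk measurable_futureZ
  have := Measure.isProbabilityMeasure_map (μ := ν) hpf.aemeasurable
  have := Measure.isProbabilityMeasure_map (μ := ν) (measurable_pastZ (A := A)).aemeasurable
  have := Measure.isProbabilityMeasure_map (μ := ν) (measurable_futureZ (A := A)).aemeasurable
  let R : ∀ n, (ℕ → A) → Fin n → A := fun n p j => p j
  have hR : ∀ n, Measurable (R n) := fun n => measurable_pi_lambda _ fun j => measurable_pi_apply _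
  let Q : ∀ n, (ℕ → A) × (ℕ → A) → (Fin n → A) × (Fin n → A) := fun n q => (R n q.1, R n q.2)
  have hQ : ∀ n, Measurable (Q n) := fun n =>
    ((hR n).comp measurable_fst).prodMk ((hR n).comp measurable_snd)
  refine measure_le_smul_of_atoms (Q := Q) ?_ ?_ ?_
  · intro n n' hn
    let r : (Fin n' → A) → Fin n → A := fun p j => p (Fin.castLE hn j)
    have hr : Measurable r := measurable_pi_lambda _ fun j => measurable_pi_apply _
    have e : Q n = (fun q => (r q.1, r q.2)) ∘ Q n' := rfl
    dsimp only
    rw [e, ← MeasurableSpace.comap_comp]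
    exact MeasurableSpace.comap_mono (measurable_iff_comap_le.1
      ((hr.comp measurable_fst).prodMk (hr.comp measurable_snd)))
  · refine le_antisymm (iSup_le fun n => (hQ n).comap_le) ?_
    have hcoord : ∀ i : ℕ, Measurable[⨆ n, MeasurableSpace.comap (Q n) inferInstance]
        (fun q : (ℕ → A) × (ℕ → A) => (q.1 i, q.2 i)) := fun i => by
      have h1 : Measurable[MeasurableSpace.comap (Q (i + 1)) inferInstance]
          (fun q : (ℕ → A) × (ℕ → A) => (q.1 i, q.2 i)) := by
        have h2 : Measurable fun q : (Fin (i + 1) → A) × (Fin (i + 1) → A) =>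
            (q.1 (Fin.last i), q.2 (Fin.last i)) :=
          ((measurable_pi_apply _).comp measurable_fst).prodMk
            ((measurable_pi_apply _).comp measurable_snd)
        exact h2.comp (comap_measurable (Q (i + 1)))
      exact h1.mono (le_iSup (fun n => MeasurableSpace.comap (Q n) inferInstance) _) le_rfl
    refine sup_le ?_ ?_
    · refine measurable_iff_comap_le.1 ?_
      exact @measurable_pi_lambda _ _ _ (_) _ _ fun i => measurable_fst.comp (hcoord i)
    · refine measurable_iff_comap_le.1 ?_
      exact @measurable_pi_lambda _ _ _ (_) _ _ fun i => measurable_snd.comp (hcoord i)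
  · rintro n ⟨d, d'⟩
    have e1 : pastZ ⁻¹' (R n ⁻¹' {d}) = cylinderZ (1 - n) (List.ofFn (d ∘ Fin.rev)) := by
      ext ω
      rw [mem_cylinderZ_ofFn]
      simp only [Set.mem_preimage, Set.mem_singleton_iff, funext_iff, R, pastZ]
      constructor
      · intro h j
        rw [Function.comp, ← h (Fin.rev j), Fin.val_rev]
        congr 1
        omega
      · intro h j
        have := h (Fin.rev j)
        rw [Function.comp, Fin.rev_rev] at this
        rw [← this, Fin.val_rev]
        congr 1
        omega
    have e2 : futureZ ⁻¹' (R n ⁻¹' {d'}) = cylinderZ 1 (List.ofFn d') := by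
      ext ω
      rw [mem_cylinderZ_ofFn]
      simp only [Set.mem_preimage, Set.mem_singleton_iff, funext_iff, R, futureZ, add_comm]
    have hs : Q n ⁻¹' {(d, d')} = (R n ⁻¹' {d}) ×ˢ (R n ⁻¹' {d'}) := by
      ext q
      simp [Q, Prod.ext_iff]
    have hd := hR n (measurableSet_singleton d)
    have hd' := hR n (measurableSet_singleton d')
    rw [map_measureReal_apply hpf (hQ n (measurableSet_singleton _)), hs, measureReal_prod_prod,
      map_measureReal_apply measurable_pastZ hd, map_measureReal_apply measurable_futureZ hd',
      Set.mk_preimage_prod, e1, e2, measureReal_cylinderZ hS, measureReal_cylinderZ hS]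
    have e3 : cylinderZ (1 - n) (List.ofFn (d ∘ Fin.rev)) ∩ cylinderZ 1 (List.ofFn d') =
        cylinderZ (1 - n) (List.ofFn (d ∘ Fin.rev) ++ List.ofFn d') := by
      rw [cylinderZ_append, List.length_ofFn, sub_add_cancel]
    rw [e3, measureReal_cylinderZ hS]
    exact hC _ _

/-- Quasi-multiplicativity from below of the one-sided marginal implies ergodicity. -/
theorem ergodic_shiftZ_of_quasiMultiplicative [Fintype A] [IsProbabilityMeasure ν]
    (hS : MeasurePreserving shiftZ ν ν) {c : ℝ} (hc : 0 < c) {L : ℕ}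
    (h : ∀ u v : List A, u ≠ [] → ∃ x : List A, (x.length < L ∨ x = []) ∧
      c * ((ν.map futureZ).real (cylinder u) * (ν.map futureZ).real (cylinder v)) ≤
        (ν.map futureZ).real (cylinder (u ++ (x ++ v)))) :
    Ergodic shiftZ ν := by
  let Q : ∀ n : ℕ, (ℤ → A) → Fin (2 * n + 1) → A := fun n ω j => ω (-n + (j : ℕ))
  have hQ : ∀ n, Measurable (Q n) := fun n => measurable_pi_lambda _ fun j => measurable_pi_apply _
  refine ergodic_of_atoms (Q := Q) hS ?_ ?_ hc (L + 1) (fun n => 2 * n + 1) ?_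
  · refine monotone_nat_of_le_succ fun n => ?_
    let r : (Fin (2 * (n + 1) + 1) → A) → Fin (2 * n + 1) → A := fun p j => p ⟨j + 1, by omega⟩
    have hr : Measurable r := measurable_pi_lambda _ fun j => measurable_pi_apply _
    have e : Q n = r ∘ Q (n + 1) := by
      ext ω j
      simp only [Q, r, Function.comp]
      congr 1
      push_cast
      ring
    rw [e, ← MeasurableSpace.comap_comp]
    exact MeasurableSpace.comap_mono (measurable_iff_comap_le.1 hr)
  · refine le_antisymm (iSup_le fun n => (hQ n).comap_le) ?_
    refine iSup_le fun z => measurable_iff_comap_le.1 ?_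
    have h1 : Measurable[MeasurableSpace.comap (Q z.natAbs) inferInstance]
        (fun ω : ℤ → A => ω z) := by
      have h2 : (fun ω : ℤ → A => ω z) =
          (fun p => p ⟨(z + z.natAbs).toNat, by omega⟩) ∘ Q z.natAbs := by
        ext ω
        simp only [Q, Function.comp]
        congr 1
        omega
      rw [h2]
      exact (measurable_pi_apply _).comp (comap_measurable (Q z.natAbs))
    exact h1.mono (le_iSup (fun n => MeasurableSpace.comap (Q n) inferInstance) _) le_rfl
  · intro n d d'
    have e : ∀ d : Fin (2 * n + 1) → A, Q n ⁻¹' {d} = cylinderZ (-n) (List.ofFn d) := fun d => by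
      ext ω
      rw [mem_cylinderZ_ofFn]
      simp only [Set.mem_preimage, Set.mem_singleton_iff, funext_iff, Q]
    simp only [e, preimage_shiftZ_iterate_cylinderZ, measureReal_cylinderZ hS]
    obtain ⟨x, hx, hle⟩ := h (List.ofFn d) (List.ofFn d') (by simp)
    refine hle.trans ?_
    have hxl : x.length < L + 1 := by
      rcases hx with hx | rfl
      · omega
      · simp
    refine le_trans ?_ (Finset.single_le_sum (fun _ _ => measureReal_nonneg)
      (Finset.mem_range.2 hxl))
    rw [← measureReal_cylinderZ hS (-n), cylinderZ_append, cylinderZ_append, List.length_ofFn]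
    refine measureReal_mono (Set.inter_subset_inter_right _ ?_)
    refine Set.inter_subset_right.trans_eq ?_
    congr 1
    push_cast
    ring

end TwoSided

section Averages

variable {Λ Λ' : Type*} [MeasurableSpace Λ] [MeasurableSpace Λ']
  {ν : Measure (ℤ → Λ × Λ')} [IsProbabilityMeasure ν]

theorem abs_prod_le_one {ι : Type*} (s : Finset ι) {f : ι → ℝ} (h : ∀ i, |f i| ≤ 1) :
    |∏ i ∈ s, f i| ≤ 1 := by
  rw [Finset.abs_prod]
  exact Finset.prod_le_one (fun _ _ => abs_nonneg _) fun i _ => h i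

theorem abs_mul_le_one {x y : ℝ} (hx : |x| ≤ 1) (hy : |y| ≤ 1) : |x * y| ≤ 1 := by
  rw [abs_mul]
  exact mul_le_one₀ hx (abs_nonneg _) hy

/-- Weighted averages of products of conditional expectations along two different speeds. -/
theorem ae_tendsto_cavg_prod_condExp (hS : Ergodic shiftZ ν) {C : ℝ≥0}
    (hle : ν.map (fun ω => (pastZ ω, futureZ ω)) ≤
      (C : ℝ≥0∞) • (ν.map pastZ).prod (ν.map futureZ)) {l : ℕ → ℕ}
    (hl : IsSlowTime l) {u : ℕ → ℝ} (hu : ∀ k, |u k| ≤ 1) {L : ℝ}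
    (hL : PeriodicallyEquidistributed u l L) {F G : (ℤ → Λ × Λ') → ℝ} {w₀ : ℕ}
    (hF : Measurable F) (hFb : ∀ ω, |F ω| ≤ 1)
    (hG : Measurable[windowAlg (Set.Icc 1 (w₀ : ℤ)) ∅] G) (hGb : ∀ ω, |G ω| ≤ 1)
    {ι : Type*} [Fintype ι] {X B : ι → (ℤ → Λ × Λ') → ℝ} {w w' : ι → ℕ}
    (hX : ∀ i, Measurable[windowAlg (Set.Icc 1 (w i : ℤ)) ∅] (X i)) (hXb : ∀ i ω, |X i ω| ≤ 1)
    (hB : ∀ i, Measurable[windowAlg ∅ (Set.Icc 1 (w' i : ℤ))] (B i)) (hBb : ∀ i ω, |B i ω| ≤ 1) :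
    ∀ᵐ ω ∂ν, Tendsto (cavg fun k => u k * G (shiftZ^[k] ω) * F (shiftZ^[l k] ω) *
        ∏ i, (ν[fun ω => X i (shiftZ^[k] ω) * B i (shiftZ^[l k] ω)|
          windowAlg (Set.Icc 1 (k : ℤ)) (Set.Icc 1 (l k : ℤ))]) ω) atTop
      (𝓝 (L * (∫ ω, F ω * ∏ i, (ν[B i|windowAlg Set.univ (Set.Iic 0)]) ω ∂ν) *
        ∫ ω, G ω * ∏ i, (ν[X i|⨅ (k : ℕ) (_ : 1 ≤ k),
          windowAlg (Set.Iic 0) (Set.Iic (-(k : ℤ)))]) ω ∂ν)) := by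
  have hac : ν.map (fun ω => (pastZ ω, futureZ ω)) ≪ (ν.map pastZ).prod (ν.map futureZ) :=
    (Measure.absolutelyContinuous_of_le hle).trans Measure.smul_absolutelyContinuous
  have hMP := hS.toMeasurePreserving
  choose g hgm hgb hge using fun i =>
    exists_condExp_version (m := windowAlg (Set.Iic 0) ∅) (μ := ν) (hXb i)
  choose f hfm hfb hfe using fun i =>
    exists_condExp_version (m := windowAlg Set.univ (Set.Iic 0)) (μ := ν) (hBb i)
  have hFint : ∫ ω, F ω * ∏ i, (ν[B i|windowAlg Set.univ (Set.Iic 0)]) ω ∂ν =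
      ∫ ω, F ω * ∏ i, f i ω ∂ν := by
    refine integral_congr_ae ?_
    filter_upwards [ae_all_iff.2 hfe] with ω h
    simp only [h]
  have hGint : ∫ ω, G ω * ∏ i, (ν[X i|⨅ (k : ℕ) (_ : 1 ≤ k),
      windowAlg (Set.Iic 0) (Set.Iic (-(k : ℤ)))]) ω ∂ν = ∫ ω, G ω * ∏ i, g i ω ∂ν := by
    refine integral_congr_ae ?_
    filter_upwards [ae_all_iff.2 fun i =>
      (condExp_iInf_window_ae_eq hMP hac (hX i) (hXb i)).trans (hge i)] with ω h
    simp only [h]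
  have hFm : Measurable fun ω => F ω * ∏ i, f i ω :=
    hF.mul (Finset.measurable_prod _ fun i _ => (hfm i).mono (windowAlg_le _ _) le_rfl)
  have hGm : Measurable[pastAlg (w₀ : ℤ)] fun ω => G ω * ∏ i, g i ω := by
    refine Measurable.mul (hG.mono (windowAlg_mono Set.Icc_subset_Iic_self
      (Set.empty_subset _)) le_rfl) (Finset.measurable_prod _ fun i _ => (hgm i).mono
        (windowAlg_mono (Set.Iic_subset_Iic.2 (by positivity)) (Set.empty_subset _)) le_rfl)
  rw [hFint, hGint]
  have hmain := ae_tendsto_cavg_mul hS hle hl hu hL hFm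
    (fun ω => abs_mul_le_one (hFb ω) (abs_prod_le_one _ fun i => hfb i ω)) hGm
    (fun ω => abs_mul_le_one (hGb ω) (abs_prod_le_one _ fun i => hgb i ω))
  have hnull : ∀ᵐ ω ∂ν, ∀ i, CesaroNull fun k =>
      (ν[fun ω => X i (shiftZ^[k] ω) * B i (shiftZ^[l k] ω)|
        windowAlg (Set.Icc 1 (k : ℤ)) (Set.Icc 1 (l k : ℤ))]) ω -
      (ν[X i|windowAlg (Set.Iic 0) ∅]) (shiftZ^[k] ω) *
        (ν[B i|windowAlg Set.univ (Set.Iic 0)]) (shiftZ^[l k] ω) := ae_all_iff.2 fun i =>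
    ae_cesaroNull_condExp_mul_sub hS hac hl (hX i) (hXb i) (hB i) (hBb i)
  have hg' : ∀ᵐ ω ∂ν, ∀ i (k : ℕ), (ν[X i|windowAlg (Set.Iic 0) ∅]) (shiftZ^[k] ω) =
      g i (shiftZ^[k] ω) := ae_all_iff.2 fun i => iterate_ae hMP (hge i)
  have hf' : ∀ᵐ ω ∂ν, ∀ i (k : ℕ), (ν[B i|windowAlg Set.univ (Set.Iic 0)]) (shiftZ^[k] ω) =
      f i (shiftZ^[k] ω) := ae_all_iff.2 fun i => iterate_ae hMP (hfe i)
  have heb : ∀ᵐ ω ∂ν, ∀ i (k : ℕ), |(ν[fun ω => X i (shiftZ^[k] ω) * B i (shiftZ^[l k] ω)|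
      windowAlg (Set.Icc 1 (k : ℤ)) (Set.Icc 1 (l k : ℤ))]) ω| ≤ 1 :=
    ae_all_iff.2 fun i => ae_all_iff.2 fun k => ae_abs_condExp_le
      (ae_of_all _ fun ω => abs_mul_le_one (hXb i _) (hBb i _))
  filter_upwards [hmain, hnull, hg', hf', heb] with ω h1 h2 h3 h4 h5
  simp only [h3, h4] at h2
  have h6 := ((CesaroNull.prod_sub_prod Finset.univ h5
    (fun i k => abs_mul_le_one (hgb i _) (hfb i _)) h2).mul_bounded
      (v := fun k => u k * G (shiftZ^[k] ω) * F (shiftZ^[l k] ω))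
      fun k => abs_mul_le_one (abs_mul_le_one (hu k) (hGb _)) (hFb _)).tendsto
  have h7 := h1.add h6
  rw [add_zero] at h7
  refine h7.congr fun N => ?_
  rw [← cavg_add]
  congr 1
  funext k
  rw [Finset.prod_mul_distrib]
  ring

end Averages

section Transfer

variable {Λ Λ' : Type*} [MeasurableSpace Λ] [MeasurableSpace Λ']

theorem comap_futureZ_FalgN_sup_GalgN (k l : ℕ) :
    (FalgN (Set.Iio k) ⊔ GalgN (Set.Iio l) : MeasurableSpace (ℕ → Λ × Λ')).comap futureZ =
      windowAlg (Set.Icc 1 (k : ℤ)) (Set.Icc 1 (l : ℤ)) := by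
  have hcast : ∀ r : ℤ, 1 ≤ r → (((r - 1).toNat : ℕ) : ℤ) + 1 = r := fun r hr => by omega
  simp only [windowAlg, FalgN, GalgN, FalgZ, GalgZ, MeasurableSpace.comap_sup,
    MeasurableSpace.comap_iSup, MeasurableSpace.comap_comp]
  congr 1
  · refine le_antisymm (iSup₂_le fun j hj => le_iSup₂_of_le ((j : ℤ) + 1) ?_ le_rfl)
      (iSup₂_le fun r hr => le_iSup₂_of_le (r - 1).toNat ?_ ?_)
    · rw [Set.mem_Iio] at hj
      exact ⟨by omega, by omega⟩
    · rw [Set.mem_Icc] at hr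
      rw [Set.mem_Iio]
      omega
    · simp only [Function.comp_def, futureZ, hcast r hr.1, le_refl]
  · refine le_antisymm (iSup₂_le fun j hj => le_iSup₂_of_le ((j : ℤ) + 1) ?_ le_rfl)
      (iSup₂_le fun r hr => le_iSup₂_of_le (r - 1).toNat ?_ ?_)
    · rw [Set.mem_Iio] at hj
      exact ⟨by omega, by omega⟩
    · rw [Set.mem_Icc] at hr
      rw [Set.mem_Iio]
      omega
    · simp only [Function.comp_def, futureZ, hcast r hr.1, le_refl]

theorem preimage_futureZ_cylF (c : List Λ) (k : ℕ) :
    futureZ ⁻¹' (cylF c k : Set (ℕ → Λ × Λ')) = shiftZ^[k] ⁻¹' AbarZ c := by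
  ext ω
  simp only [cylF, AbarZ, Set.mem_preimage, Set.mem_ofPred_eq, futureZ, shiftZ_iterate,
    Nat.cast_add, add_comm (k : ℤ), add_right_comm]

theorem preimage_futureZ_cylG (d : List Λ') (k : ℕ) :
    futureZ ⁻¹' (cylG d k : Set (ℕ → Λ × Λ')) = shiftZ^[k] ⁻¹' BbarZ d := by
  ext ω
  simp only [cylG, BbarZ, Set.mem_preimage, Set.mem_ofPred_eq, futureZ, shiftZ_iterate,
    Nat.cast_add, add_comm (k : ℤ), add_right_comm]

theorem measurable_indicator_one {Ω : Type*} {m : MeasurableSpace Ω} {s : Set Ω}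
    (hs : MeasurableSet[m] s) : Measurable[m] (s.indicator (1 : Ω → ℝ)) :=
  measurable_one.indicator hs

theorem measurable_indicator_AbarZ [MeasurableSingletonClass Λ] (c : List Λ) :
    Measurable[windowAlg (Set.Icc 1 (c.length : ℤ)) ∅]
      ((AbarZ c).indicator (1 : (ℤ → Λ × Λ') → ℝ)) := by
  have h : (AbarZ c : Set (ℤ → Λ × Λ')) =
      ⋂ j : Fin c.length, (fun ω => (ω ((j : ℕ) + 1 : ℤ)).1) ⁻¹' {c.get j} := by
    ext ω
    simp [AbarZ]
  refine measurable_indicator_one ?_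
  rw [h]
  refine @MeasurableSet.iInter _ _ (_) _ _ fun j => ?_
  have h1 : MeasurableSpace.comap (fun ω : ℤ → Λ × Λ' => (ω ((j : ℕ) + 1 : ℤ)).1) inferInstance ≤
      windowAlg (Set.Icc 1 (c.length : ℤ)) ∅ :=
    le_sup_of_le_left (le_iSup₂_of_le ((j : ℕ) + 1 : ℤ) ⟨by omega, by omega⟩ le_rfl)
  exact h1 _ ⟨_, measurableSet_singleton _, rfl⟩

theorem measurable_indicator_BbarZ [MeasurableSingletonClass Λ'] (d : List Λ') :
    Measurable[windowAlg ∅ (Set.Icc 1 (d.length : ℤ))]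
      ((BbarZ d).indicator (1 : (ℤ → Λ × Λ') → ℝ)) := by
  have h : (BbarZ d : Set (ℤ → Λ × Λ')) =
      ⋂ j : Fin d.length, (fun ω => (ω ((j : ℕ) + 1 : ℤ)).2) ⁻¹' {d.get j} := by
    ext ω
    simp [BbarZ]
  refine measurable_indicator_one ?_
  rw [h]
  refine @MeasurableSet.iInter _ _ (_) _ _ fun j => ?_
  have h1 : MeasurableSpace.comap (fun ω : ℤ → Λ × Λ' => (ω ((j : ℕ) + 1 : ℤ)).2) inferInstance ≤
      windowAlg ∅ (Set.Icc 1 (d.length : ℤ)) :=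
    le_sup_of_le_right (le_iSup₂_of_le ((j : ℕ) + 1 : ℤ) ⟨by omega, by omega⟩ le_rfl)
  exact h1 _ ⟨_, measurableSet_singleton _, rfl⟩

theorem measurableSet_cylF [MeasurableSingletonClass Λ] (c : List Λ) (k : ℕ) :
    MeasurableSet (cylF c k : Set (ℕ → Λ × Λ')) := by
  have h : (cylF c k : Set (ℕ → Λ × Λ')) =
      ⋂ j : Fin c.length, (fun ω => (ω (k + j)).1) ⁻¹' {c.get j} := by
    ext ω
    simp [cylF]
  rw [h]
  exact MeasurableSet.iInter fun j =>
    (measurable_fst.comp (measurable_pi_apply _)) (measurableSet_singleton _)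

theorem measurableSet_cylG [MeasurableSingletonClass Λ'] (d : List Λ') (k : ℕ) :
    MeasurableSet (cylG d k : Set (ℕ → Λ × Λ')) := by
  have h : (cylG d k : Set (ℕ → Λ × Λ')) =
      ⋂ j : Fin d.length, (fun ω => (ω (k + j)).2) ⁻¹' {d.get j} := by
    ext ω
    simp [cylG]
  rw [h]
  exact MeasurableSet.iInter fun j =>
    (measurable_snd.comp (measurable_pi_apply _)) (measurableSet_singleton _)

theorem FalgN_sup_GalgN_le (s t : Set ℕ) :
    (FalgN s ⊔ GalgN t : MeasurableSpace (ℕ → Λ × Λ')) ≤ MeasurableSpace.pi :=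
  sup_le (iSup₂_le fun r _ => ((measurable_fst.comp (measurable_pi_apply r))).comap_le)
    (iSup₂_le fun r _ => ((measurable_snd.comp (measurable_pi_apply r))).comap_le)

theorem abs_indicator_one_le {Ω : Type*} (s : Set Ω) (ω : Ω) :
    |s.indicator (1 : Ω → ℝ) ω| ≤ 1 := by
  by_cases h : ω ∈ s <;> simp [h]

theorem indicator_cylF_futureZ (c : List Λ) (k : ℕ) (ω : ℤ → Λ × Λ') :
    (cylF c k).indicator (1 : (ℕ → Λ × Λ') → ℝ) (futureZ ω) =
      (AbarZ c).indicator (1 : (ℤ → Λ × Λ') → ℝ) (shiftZ^[k] ω) := by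
  have h : futureZ ω ∈ (cylF c k : Set (ℕ → Λ × Λ')) ↔ shiftZ^[k] ω ∈ AbarZ c := by
    rw [← Set.mem_preimage, preimage_futureZ_cylF, Set.mem_preimage]
  by_cases h1 : shiftZ^[k] ω ∈ AbarZ c <;> simp [Set.indicator, h, h1]

theorem indicator_cylG_futureZ (d : List Λ') (k : ℕ) (ω : ℤ → Λ × Λ') :
    (cylG d k).indicator (1 : (ℕ → Λ × Λ') → ℝ) (futureZ ω) =
      (BbarZ d).indicator (1 : (ℤ → Λ × Λ') → ℝ) (shiftZ^[k] ω) := by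
  have h : futureZ ω ∈ (cylG d k : Set (ℕ → Λ × Λ')) ↔ shiftZ^[k] ω ∈ BbarZ d := by
    rw [← Set.mem_preimage, preimage_futureZ_cylG, Set.mem_preimage]
  by_cases h1 : shiftZ^[k] ω ∈ BbarZ d <;> simp [Set.indicator, h, h1]

theorem ae_of_ae_comp {Ω Ω' : Type*} [MeasurableSpace Ω] [MeasurableSpace Ω'] {μ : Measure Ω}
    {ν : Measure Ω'} {π : Ω' → Ω} (hπ : MeasurePreserving π ν μ) {p : Ω → Prop}
    (hp : MeasurableSet {x | p x}) (h : ∀ᵐ x ∂ν, p (π x)) : ∀ᵐ x ∂μ, p x := by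
  rw [← hπ.map_eq]
  exact (ae_map_iff hπ.measurable.aemeasurable hp).2 h

theorem condExp_cyl_comp_futureZ [MeasurableSingletonClass Λ] [MeasurableSingletonClass Λ']
    {μ : Measure (ℕ → Λ × Λ')} [IsProbabilityMeasure μ] {ν : Measure (ℤ → Λ × Λ')}
    [IsProbabilityMeasure ν] (hπ : MeasurePreserving futureZ ν μ) (a : List Λ) (b : List Λ')
    (k l : ℕ) :
    (fun ω => (μ[(cylF a k ∩ cylG b l).indicator (1 : (ℕ → Λ × Λ') → ℝ)|
        FalgN (Set.Iio k) ⊔ GalgN (Set.Iio l)]) (futureZ ω)) =ᵐ[ν]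
      ν[fun ω => (AbarZ a).indicator (1 : (ℤ → Λ × Λ') → ℝ) (shiftZ^[k] ω) *
          (BbarZ b).indicator (1 : (ℤ → Λ × Λ') → ℝ) (shiftZ^[l] ω)|
        windowAlg (Set.Icc 1 (k : ℤ)) (Set.Icc 1 (l : ℤ))] := by
  have hm : MeasurableSet (cylF a k ∩ cylG b l : Set (ℕ → Λ × Λ')) :=
    (measurableSet_cylF a k).inter (measurableSet_cylG b l)
  have hi : Integrable ((cylF a k ∩ cylG b l).indicator (1 : (ℕ → Λ × Λ') → ℝ)) μ :=
    (integrable_const (1 : ℝ)).indicator hm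
  have h := condExp_comp_measurePreserving hπ
    (FalgN_sup_GalgN_le (Set.Iio k) (Set.Iio l)) hi
  rw [comap_futureZ_FalgN_sup_GalgN] at h
  refine h.trans (EventuallyEq.of_eq ?_)
  congr 1
  funext ω
  rw [Set.inter_indicator_one, Pi.mul_apply, indicator_cylF_futureZ, indicator_cylG_futureZ]

end Transfer

theorem stmt1 (m n : ℕ) (hm : 2 ≤ m) (hmn : m < n)
    (α : ℝ) (hαdef : α = Real.log m / Real.log n) (hirr : Irrational α)
    (M : (Fin m × Fin n) → (Fin m × Fin n) → Prop)
    (Y : Set (ℕ → Fin m × Fin n)) (hY : Y = SFT M)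
    (htrans : IrreducibleTransition M)
    (ρ : ℝ) (hρ : ρ ∈ Set.Ioo (0 : ℝ) 1)
    (φ : (ℕ → Fin m × Fin n) → ℝ) (hHolder : IsHolder Y φ ρ)
    (μ : Measure (ℕ → Fin m × Fin n)) [IsProbabilityMeasure μ]
    (hinv : μ.map shiftN = μ) (hsupp : μ Y = 1)
    (P : ℝ) (hGibbs : HasGibbsProperty Y μ φ P)
    -- the natural extension `μ̂`: the shift-invariant measure on the two-sided
    -- shift space whose pushforward under `ω ↦ (ω_k)_{k ≥ 1}` is `μ`
    (μhat : Measure (ℤ → Fin m × Fin n)) [IsProbabilityMeasure μhat]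
    (hinvZ : μhat.map shiftZ = μhat)
    (hproj : μhat.map (fun ω (j : ℕ) => ω ((j : ℤ) + 1)) = μ)
    (t : ℝ) (ht : t ∈ Set.Ico (0 : ℝ) 1)
    (I : Set ℝ) (hI : IsFinUnionIntervals I) (hI01 : I ⊆ Set.Ico (0 : ℝ) 1)
    (c : List (Fin m)) (d : List (Fin n)) (r : ℕ)
    (a : Fin r → List (Fin m)) (b : Fin r → List (Fin n)) :
    ∀ᵐ ω ∂μ,
      Tendsto (fun N : ℕ => (N : ℝ)⁻¹ *
          ∑ k ∈ Finset.Icc 1 N,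
            Set.indicator I (1 : ℝ → ℝ) (Int.fract (t + k * α)) *
            Set.indicator (cylF c k) (1 : (ℕ → Fin m × Fin n) → ℝ) ω *
            Set.indicator (cylG d (lk α t k)) (1 : (ℕ → Fin m × Fin n) → ℝ) ω *
            ∏ i : Fin r,
              (μ[Set.indicator (cylF (a i) k ∩ cylG (b i) (lk α t k))
                    (1 : (ℕ → Fin m × Fin n) → ℝ) |
                  FalgN (Set.Iio k) ⊔ GalgN (Set.Iio (lk α t k))]) ω)
        atTop
        (𝓝 ((volume I).toReal *
          -- `E_{μ̂}[f̃]`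
          (∫ ω', Set.indicator (BbarZ d) (1 : (ℤ → Fin m × Fin n) → ℝ) ω' *
            ∏ i : Fin r,
              (μhat[Set.indicator (BbarZ (b i)) (1 : (ℤ → Fin m × Fin n) → ℝ) |
                  FalgZ Set.univ ⊔ GalgZ {z : ℤ | z ≤ 0}]) ω' ∂μhat) *
          -- `E_{μ̂}[g̃]`
          ∫ ω', Set.indicator (AbarZ c) (1 : (ℤ → Fin m × Fin n) → ℝ) ω' *
            ∏ i : Fin r,
              (μhat[Set.indicator (AbarZ (a i)) (1 : (ℤ → Fin m × Fin n) → ℝ) |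
                  ⨅ (k : ℕ) (_ : 1 ≤ k),
                    (FalgZ {z : ℤ | z ≤ 0} ⊔ GalgZ {z : ℤ | z ≤ -(k : ℤ)})]) ω' ∂μhat)) := by
  subst hY
  have hn0 : 0 < Real.log n := Real.log_pos (by exact_mod_cast (by omega : 1 < n))
  have hm0 : 0 < Real.log m := Real.log_pos (by exact_mod_cast (by omega : 1 < m))
  have hα0 : 0 < α := hαdef ▸ div_pos hm0 hn0
  have hα1 : α < 1 := by
    rw [hαdef, div_lt_one hn0]
    exact Real.log_lt_log (by exact_mod_cast (by omega : 0 < m)) (by exact_mod_cast hmn)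
  have hS : MeasurePreserving shiftZ μhat μhat := ⟨measurable_shiftZ, hinvZ⟩
  have hπ : MeasurePreserving futureZ μhat μ := ⟨measurable_futureZ, hproj⟩
  obtain ⟨K, hK, hG⟩ := hGibbs.exists_isGibbsWith
  obtain ⟨L, κ, hκ, hjoin⟩ := hG.exists_le_measureReal_append hK hsupp htrans hHolder
  have hle := map_past_future_le_prod hS (C := ⟨K ^ 3, by positivity⟩) (by
    rw [hπ.map_eq]
    exact hG.measureReal_append_le hK hsupp)
  have herg : Ergodic shiftZ μhat :=
    ergodic_shiftZ_of_quasiMultiplicative hS hκ (by rw [hπ.map_eq]; exact hjoin)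
  have hmain := ae_tendsto_cavg_prod_condExp herg hle (isSlowTime_lk hα0 hα1 ht)
    (fun k => abs_indicator_one_le I _)
    (periodicallyEquidistributed_lk hirr hα0 ht hI hI01)
    ((measurable_indicator_BbarZ d).mono (windowAlg_le _ _) le_rfl)
    (abs_indicator_one_le (BbarZ d)) (measurable_indicator_AbarZ c) (abs_indicator_one_le _)
    (fun i => measurable_indicator_AbarZ (a i)) (fun i => abs_indicator_one_le _)
    (fun i => measurable_indicator_BbarZ (b i)) (fun i => abs_indicator_one_le _)
  have hcond := ae_all_iff.2 fun k : ℕ => ae_all_iff.2 fun i : Fin r =>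
    condExp_cyl_comp_futureZ hπ (a i) (b i) k (lk α t k)
  refine ae_of_ae_comp hπ (measurableSet_tendsto _ fun N => ?_) ?_
  · have hcm : ∀ (k : ℕ) (i : Fin r), Measurable
        (μ[(cylF (a i) k ∩ cylG (b i) (lk α t k)).indicator (1 : (ℕ → Fin m × Fin n) → ℝ)|
          FalgN (Set.Iio k) ⊔ GalgN (Set.Iio (lk α t k))]) := fun k i =>
      stronglyMeasurable_condExp.measurable.mono (FalgN_sup_GalgN_le _ _) le_rfl
    exact measurable_const.mul (Finset.measurable_sum _ fun k _ =>
      ((measurable_const.mul (measurable_one.indicator (measurableSet_cylF c k))).mul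
        (measurable_one.indicator (measurableSet_cylG d _))).mul
          (Finset.measurable_prod _ fun i _ => hcm k i))
  · filter_upwards [hmain, hcond] with ω h1 h2
    refine h1.congr fun N => congrArg _ (Finset.sum_congr rfl fun k _ => ?_)
    rw [indicator_cylF_futureZ, indicator_cylG_futureZ]
    exact congrArg _ (Finset.prod_congr rfl fun i _ => (h2 k i).symm)
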